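/- (Homogeneous Strichartz estimate for the half-wave propagator in d = 3.) Let (p,q) ∈ [2,∞] × [2,∞) be wave-admissible, i.e. 1/p + 1/q ≤ 1/2, and set γ = 1/p + 3/q − 1/2. There is a constant C = C(p,q) such that for every Schwartz function f on ℝ³, every interval J ⊆ ℝ, and either choice of sign, ‖ e^{±it|∇|} |∇|^γ f ‖_{L_t^p L_x^q(J×ℝ³)} ≤ C ‖ |∇| f ‖_{L²(ℝ³)}. -/

import Mathlib

open MeasureTheory SchwartzMap Metric Set
open scoped ENNReal NNReal FourierTransform RealInnerProductSpace

noncomputable section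

abbrev E3 := EuclideanSpace ℝ (Fin 3)

/-- Fourier multiplier with symbol `m`. -/
def fmul3 (m : E3 → ℂ) (f : E3 → ℂ) : E3 → ℂ :=
  𝓕⁻ (fun ξ => m ξ * 𝓕 f ξ)

/-- The fractional derivative `|∇|^s`. -/
def absGrad3 (s : ℝ) (f : E3 → ℂ) : E3 → ℂ :=
  fmul3 (fun ξ => (((2 * Real.pi * ‖ξ‖) ^ s : ℝ) : ℂ)) f

/-- The half-wave propagator `e^{σ i t |∇|}`. -/
def halfWave3 (σ t : ℝ) (f : E3 → ℂ) : E3 → ℂ :=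
  fmul3 (fun ξ => Complex.exp (Complex.I * (σ * (2 * Real.pi * t * ‖ξ‖)))) f

/-- The propagator `cos(t|∇|)`. -/
def cosProp3 (t : ℝ) (f : E3 → ℂ) : E3 → ℂ :=
  fmul3 (fun ξ => ((Real.cos (2 * Real.pi * t * ‖ξ‖) : ℝ) : ℂ)) f

/-- The propagator `sin(t|∇|)/|∇|`. -/
def sinProp3 (t : ℝ) (g : E3 → ℂ) : E3 → ℂ :=
  fmul3 (fun ξ => ((Real.sin (2 * Real.pi * t * ‖ξ‖) / (2 * Real.pi * ‖ξ‖) : ℝ) : ℂ)) g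

/-- A Littlewood–Paley bump function. -/
structure IsLPBump3 (φ : E3 → ℝ) : Prop where
  smooth : ContDiff ℝ (⊤ : ℕ∞) φ
  mem_Icc : ∀ ξ, φ ξ ∈ Icc (0:ℝ) 1
  eq_one : ∀ ξ : E3, ‖ξ‖ ≤ 1 → φ ξ = 1
  eq_zero : ∀ ξ : E3, 2 ≤ ‖ξ‖ → φ ξ = 0

/-- The Littlewood–Paley projection `P_N`. -/
def LP3 (φ : E3 → ℝ) (N : ℝ) (f : E3 → ℂ) : E3 → ℂ :=
  fmul3 (fun ξ => ((φ (N⁻¹ • ξ) - φ ((2 / N) • ξ) : ℝ) : ℂ)) f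

/-- The homogeneous Besov norm `Ḃ^s_{p,1}`. -/
def besov3 (φ : E3 → ℝ) (s : ℝ) (p : ℝ≥0∞) (f : E3 → ℂ) : ℝ≥0∞ :=
  ∑' n : ℤ, ENNReal.ofReal (((2:ℝ) ^ n) ^ s) * eLpNorm (LP3 φ ((2:ℝ) ^ n) f) p volume

/-- The mixed spacetime norm `L_t^p L_x^q (J × ℝ³)`. -/
def mixedNorm3 (p q : ℝ≥0∞) (J : Set ℝ) (F : ℝ → E3 → ℂ) : ℝ≥0∞ :=
  if p = ∞ then essSup (fun t => eLpNorm (F t) q volume) (volume.restrict J)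
  else (∫⁻ t in J, (eLpNorm (F t) q volume) ^ p.toReal) ^ (1 / p.toReal)

/-- Time derivative `∂ₜ u`. -/
def dt (u : ℝ → E3 → ℝ) (t : ℝ) (x : E3) : ℝ := deriv (fun s => u s x) t

/-- Second time derivative `∂ₜ² u`. -/
def dtt (u : ℝ → E3 → ℝ) (t : ℝ) (x : E3) : ℝ := deriv (fun s => dt u s x) t

/-- The spatial Laplacian: sum of second partial derivatives. -/
def lap3 (f : E3 → ℝ) (x : E3) : ℝ :=
  ∑ i : Fin 3,
    fderiv ℝ (fun y => fderiv ℝ f y (EuclideanSpace.single i (1:ℝ))) x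
      (EuclideanSpace.single i (1:ℝ))

/-- A Schwartz solution of the energy-critical NLW `∂ₜ²u - Δu + ε u⁵ = 0` on `ℝ × ℝ³`:
a jointly smooth function, all of whose time derivatives are Schwartz in space at each time,
solving the equation pointwise. -/
structure IsNLWSolution (ε : ℝ) (u : ℝ → E3 → ℝ) : Prop where
  smooth : ContDiff ℝ (⊤ : ℕ∞) (fun p : ℝ × E3 => u p.1 p.2)
  schwartz : ∀ (k : ℕ) (t : ℝ), ∃ g : 𝓢(E3, ℝ), ∀ x,
    iteratedDeriv k (fun s => u s x) t = g x
  eqn : ∀ t x, dtt u t x - lap3 (u t) x + ε * (u t x) ^ 5 = 0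

/-- `‖∇f‖_{L²}`. -/
def gradL2 (f : E3 → ℝ) : ℝ≥0∞ := eLpNorm (fun x => ‖fderiv ℝ f x‖) 2 volume

/-- `‖(f,g)‖_{Ḣ¹ × L²} = ‖∇f‖_{L²} + ‖g‖_{L²}`. -/
def H1L2 (f g : E3 → ℝ) : ℝ≥0∞ := gradL2 f + eLpNorm g 2 volume

/-- The ground state `W(x) = (1 + |x|²/3)^{-1/2}`. -/
def Wfn : E3 → ℝ := fun x => (1 + ‖x‖ ^ 2 / 3) ^ (-(1/2) : ℝ)

/-- The (focusing-sign) energy `E(f,g) = ∫ ½|∇f|² + ½g² - ⅙f⁶`. -/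
def energyKM (f g : E3 → ℝ) : ℝ :=
  ∫ x, ((1/2) * ‖fderiv ℝ f x‖ ^ 2 + (1/2) * g x ^ 2 - (1/6) * f x ^ 6)

/-- The Kenig–Merle condition: `E(u₀,u₁) < E(W,0)` and `‖∇u₀‖₂ < ‖∇W‖₂`. -/
def KenigMerle (f g : E3 → ℝ) : Prop :=
  energyKM f g < energyKM Wfn (fun _ => 0) ∧ gradL2 f < gradL2 Wfn

/-- Coercion of a real-valued function to a complex-valued one. -/
def rc (f : E3 → ℝ) : E3 → ℂ := fun x => (f x : ℂ)

/-- On `L¹ ∩ L²` the Fourier integral agrees with the `L²` Fourier transform. -/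
lemma fourier_toLp_ae_eq {f : E3 → ℂ} (h1 : Integrable f) (h2 : MemLp f 2) :
    ((𝓕 (h2.toLp f) : Lp (α := E3) ℂ 2) : E3 → ℂ) =ᵐ[volume] 𝓕 f := by
  have hc : Continuous (𝓕 f) :=
    VectorFourier.fourierIntegral_continuous Real.continuous_fourierChar
      (by exact continuous_inner) h1
  refine ae_eq_of_integral_contDiff_smul_eq
    ((Lp.memLp _).locallyIntegrable (by norm_num)) hc.locallyIntegrable ?_
  intro g hg hgs
  have hg' : HasCompactSupport (fun x => (g x : ℂ)) :=
    hgs.comp_left (g := fun x : ℝ => (x : ℂ)) (by simp)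
  set φ : 𝓢(E3, ℂ) := hg'.toSchwartzMap (Complex.ofRealCLM.contDiff.comp hg) with hφ
  have hφx : ∀ x, φ x = (g x : ℂ) := fun x => rfl
  have e1 := congrArg (fun T => T φ) (Lp.fourier_toTemperedDistribution_eq (h2.toLp f))
  simp only [TemperedDistribution.fourier_apply, Lp.toTemperedDistribution_apply] at e1
  have e2 := VectorFourier.integral_fourierIntegral_smul_eq_flip (μ := volume) (ν := volume)
    (L := innerₗ E3) (f := (φ : E3 → ℂ)) (g := f) Real.continuous_fourierChar
    (by exact continuous_inner) φ.integrable h1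
  rw [flip_innerₗ] at e2
  have e3 : ∫ x, (𝓕 φ) x • (h2.toLp f : E3 → ℂ) x = ∫ x, φ x • 𝓕 f x := by
    rw [SchwartzMap.fourier_coe]
    refine Eq.trans (integral_congr_ae ?_) e2
    filter_upwards [h2.coeFn_toLp] with x hx
    rw [hx]; rfl
  rw [e3] at e1
  simp only [hφx, smul_eq_mul] at e1
  simpa only [Complex.real_smul] using e1.symm

lemma eLpNorm_fourier_eq {f : E3 → ℂ} (h1 : Integrable f) (h2 : MemLp f 2) :
    eLpNorm (𝓕 f) 2 volume = eLpNorm f 2 volume := by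
  rw [← eLpNorm_congr_ae (fourier_toLp_ae_eq h1 h2), ← eLpNorm_congr_ae h2.coeFn_toLp]
  have h := Lp.norm_fourier_eq (h2.toLp f)
  rw [Lp.norm_def, Lp.norm_def] at h
  exact (ENNReal.toReal_eq_toReal_iff' (Lp.eLpNorm_ne_top _) (Lp.eLpNorm_ne_top _)).1 h

lemma eLpNorm_fourierInv_eq {f : E3 → ℂ} (h1 : Integrable f) (h2 : MemLp f 2) :
    eLpNorm (𝓕⁻ f) 2 volume = eLpNorm f 2 volume := by
  rw [← eLpNorm_fourier_eq h1 h2]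
  have : 𝓕⁻ f = 𝓕 f ∘ (fun x : E3 => -x) := by
    ext x; exact Real.fourierInv_eq_fourier_neg f x
  rw [this]
  exact eLpNorm_comp_measurePreserving
    (VectorFourier.fourierIntegral_continuous Real.continuous_fourierChar
      (by exact continuous_inner) h1).aestronglyMeasurable (Measure.measurePreserving_neg volume)

/-- The symbol of `|∇|`. -/
def rad (ξ : E3) : ℝ := 2 * Real.pi * ‖ξ‖

lemma continuous_rad : Continuous rad := by unfold rad; fun_prop

lemma measurable_rad : Measurable rad := continuous_rad.measurable

lemma rad_nonneg (ξ : E3) : 0 ≤ rad ξ := by unfold rad; positivity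

lemma rad_pos {ξ : E3} (h : ξ ≠ 0) : 0 < rad ξ := by
  have := norm_pos_iff.2 h
  unfold rad; positivity

lemma ae_rad_pos : ∀ᵐ ξ : E3, 0 < rad ξ := by
  filter_upwards [Measure.ae_ne volume (0 : E3)] with ξ h using rad_pos h

lemma integrable_rad_rpow_mul_exp {r ε : ℝ} (hr : -3 < r) (hε : 0 < ε) :
    Integrable (fun ξ : E3 => rad ξ ^ r * Real.exp (-ε * rad ξ)) := by
  unfold rad
  rw [integrable_fun_norm_addHaar volume
    (f := fun y => (2 * Real.pi * y) ^ r * Real.exp (-ε * (2 * Real.pi * y)))]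
  simp only [finrank_euclideanSpace, Fintype.card_fin, smul_eq_mul]
  have h := (integrableOn_rpow_mul_exp_neg_mul_rpow (p := 1) (s := r + 2) (b := ε * (2 * Real.pi))
    (by linarith) one_pos (by positivity)).const_mul ((2 * Real.pi) ^ r)
  refine IntegrableOn.congr_fun h ?_ measurableSet_Ioi
  intro y hy
  have hy : 0 < y := hy
  simp only [Real.rpow_one]
  rw [Real.mul_rpow (by positivity) hy.le, Real.rpow_add hy]
  norm_num
  rw [show ε * (2 * Real.pi) * y = ε * (2 * Real.pi * y) by ring]
  ring

lemma integral_radial_plane {c : ℝ} (hc : c ≠ 0) {w : ℂ} (hw : 0 < w.re) :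
    ∫ η : EuclideanSpace ℝ (Fin 2),
      ((2 * Real.pi * √(c ^ 2 + ‖η‖ ^ 2) : ℝ) : ℂ)⁻¹ *
        Complex.exp (-w * (2 * Real.pi * √(c ^ 2 + ‖η‖ ^ 2) : ℝ)) =
      Complex.exp (-w * (2 * Real.pi * |c| : ℝ)) / (2 * Real.pi * w) := by
  have hw0 : w ≠ 0 := fun h => by simp [h] at hw
  have hpi := Real.pi_pos
  have hpos : ∀ y : ℝ, 0 < c ^ 2 + y ^ 2 := fun y => by positivity
  rw [integral_fun_norm_addHaar volume (fun y : ℝ => ((2 * Real.pi * √(c ^ 2 + y ^ 2) : ℝ) : ℂ)⁻¹ *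
        Complex.exp (-w * (2 * Real.pi * √(c ^ 2 + y ^ 2) : ℝ)))]
  have hv : (volume : Measure (EuclideanSpace ℝ (Fin 2))).real (ball 0 1) = Real.pi := by
    simp [Measure.real, hpi.le]
  have hderiv : ∀ y ∈ Ici (0 : ℝ), HasDerivAt
      (fun y : ℝ => -(Complex.exp (-w * (2 * Real.pi * √(c ^ 2 + y ^ 2) : ℝ)) /
        (w * (2 * Real.pi) ^ 2)))
      (y • (((2 * Real.pi * √(c ^ 2 + y ^ 2) : ℝ) : ℂ)⁻¹ *
        Complex.exp (-w * (2 * Real.pi * √(c ^ 2 + y ^ 2) : ℝ)))) y := by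
    intro y _
    have h1 : HasDerivAt (fun y : ℝ => 2 * Real.pi * √(c ^ 2 + y ^ 2))
        (2 * Real.pi * ((2 * y) / (2 * √(c ^ 2 + y ^ 2)))) y := by
      refine HasDerivAt.const_mul _ (HasDerivAt.sqrt ?_ (hpos y).ne')
      simpa using (hasDerivAt_pow 2 y).const_add (c ^ 2)
    have h2 := ((h1.ofReal_comp.const_mul (-w)).cexp.div_const (w * (2 * Real.pi) ^ 2)).neg
    refine h2.congr_deriv ?_
    have hs : (√(c ^ 2 + y ^ 2) : ℂ) ≠ 0 := by
      exact_mod_cast (Real.sqrt_pos.2 (hpos y)).ne'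
    have hp : (Real.pi : ℂ) ≠ 0 := by exact_mod_cast hpi.ne'
    push_cast
    rw [Complex.real_smul]
    field_simp
  have hint : IntegrableOn (fun y : ℝ => y • (((2 * Real.pi * √(c ^ 2 + y ^ 2) : ℝ) : ℂ)⁻¹ *
        Complex.exp (-w * (2 * Real.pi * √(c ^ 2 + y ^ 2) : ℝ)))) (Ioi 0) := by
    have h := (integrableOn_exp_mul_Ioi (a := -(w.re * (2 * Real.pi)))
      (by simp; positivity) 0).const_mul ((2 * Real.pi)⁻¹)
    refine Integrable.mono' h ?_ ?_
    · refine Measurable.aestronglyMeasurable ?_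
      fun_prop
    · filter_upwards [ae_restrict_mem measurableSet_Ioi] with y hy
      have hy : 0 < y := hy
      have hsy : y ≤ √(c ^ 2 + y ^ 2) := by
        apply Real.le_sqrt_of_sq_le; nlinarith [sq_nonneg c]
      have hs := Real.sqrt_pos.2 (hpos y)
      rw [norm_smul, norm_mul, norm_inv, Complex.norm_exp, Complex.norm_real,
        Real.norm_of_nonneg hy.le, Real.norm_of_nonneg (by positivity), ← mul_assoc]
      refine mul_le_mul ?_ ?_ (by positivity) (by positivity)
      · rw [mul_inv, mul_comm, mul_assoc]
        refine mul_le_of_le_one_right (by positivity) ?_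
        rw [inv_mul_le_iff₀ hs]; linarith
      · apply Real.exp_le_exp.2
        simp only [neg_mul, Complex.neg_re, Complex.mul_re, Complex.ofReal_re, Complex.ofReal_im,
          mul_zero, sub_zero]
        have := mul_le_mul_of_nonneg_left hsy (by positivity : 0 ≤ w.re * (2 * Real.pi))
        linarith
  have hlim : Filter.Tendsto (fun y : ℝ => -(Complex.exp (-w * (2 * Real.pi * √(c ^ 2 + y ^ 2) : ℝ))
      / (w * (2 * Real.pi) ^ 2))) Filter.atTop (nhds 0) := by
    rw [← neg_zero, ← zero_div (w * (2 * Real.pi) ^ 2 : ℂ)]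
    refine (Filter.Tendsto.div_const ?_ _).neg
    rw [Complex.tendsto_exp_nhds_zero_iff]
    simp only [neg_mul, Complex.neg_re, Complex.mul_re, Complex.ofReal_re, Complex.ofReal_im,
          mul_zero, sub_zero]
    refine Filter.tendsto_neg_atTop_atBot.comp (Filter.Tendsto.const_mul_atTop hw
      (Filter.Tendsto.const_mul_atTop (by positivity) ?_))
    refine Filter.tendsto_atTop_mono (fun y => ?_) Filter.tendsto_id
    apply Real.le_sqrt_of_sq_le; simp; positivity
  have hI := integral_Ioi_of_hasDerivAt_of_tendsto' hderiv hint hlim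
  simp only [finrank_euclideanSpace, Fintype.card_fin, Nat.add_one_sub_one, pow_one, hv]
  rw [hI]
  have hp : (Real.pi : ℂ) ≠ 0 := by exact_mod_cast hpi.ne'
  simp [Real.sqrt_sq_eq_abs]
  field_simp

lemma integral_exp_abs {w : ℂ} (hw : 0 < w.re) (ρ : ℝ) :
    ∫ s : ℝ, Complex.exp ((2 * Real.pi * (s * ρ) : ℝ) * Complex.I) *
      Complex.exp (-w * (2 * Real.pi * |s| : ℝ)) = w / (Real.pi * (w ^ 2 + ρ ^ 2)) := by
  have hpi := Real.pi_pos
  set a : ℂ := 2 * Real.pi * (ρ * Complex.I - w) with ha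
  set b : ℂ := 2 * Real.pi * (ρ * Complex.I + w) with hb
  have hare : a.re < 0 := by
    have : a.re = -(2 * Real.pi * w.re) := by simp [ha]
    rw [this]; simp; positivity
  have hbre : 0 < b.re := by
    have : b.re = 2 * Real.pi * w.re := by simp [hb]
    rw [this]; positivity
  have e1 : EqOn (fun s : ℝ => Complex.exp (a * s))
      (fun s : ℝ => Complex.exp ((2 * Real.pi * (s * ρ) : ℝ) * Complex.I) *
      Complex.exp (-w * (2 * Real.pi * |s| : ℝ))) (Ioi 0) := by
    intro s hs
    have hs : 0 < s := hs
    simp only [← Complex.exp_add, abs_of_pos hs, ha]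
    congr 1; push_cast; ring
  have e2 : EqOn (fun s : ℝ => Complex.exp (b * s))
      (fun s : ℝ => Complex.exp ((2 * Real.pi * (s * ρ) : ℝ) * Complex.I) *
      Complex.exp (-w * (2 * Real.pi * |s| : ℝ))) (Iic 0) := by
    intro s hs
    have hs : s ≤ 0 := hs
    simp only [← Complex.exp_add, abs_of_nonpos hs, hb]
    congr 1; push_cast; ring
  have i1 := (integrableOn_exp_mul_complex_Ioi hare 0).congr_fun e1 measurableSet_Ioi
  have i2 := (integrableOn_exp_mul_complex_Iic hbre 0).congr_fun e2 measurableSet_Iic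
  rw [← intervalIntegral.integral_Iic_add_Ioi i2 i1, ← setIntegral_congr_fun measurableSet_Ioi e1,
    ← setIntegral_congr_fun measurableSet_Iic e2, integral_exp_mul_complex_Ioi hare,
    integral_exp_mul_complex_Iic hbre]
  have hp : (Real.pi : ℂ) ≠ 0 := by exact_mod_cast hpi.ne'
  have ha0 : a ≠ 0 := fun h => by simp [h] at hare
  have hb0 : b ≠ 0 := fun h => by simp [h] at hbre
  have hab : a * b = -(2 * Real.pi) ^ 2 * (w ^ 2 + ρ ^ 2) := by
    rw [ha, hb]; linear_combination (2 * Real.pi) ^ 2 * (ρ : ℂ) ^ 2 * Complex.I_sq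
  have hwr : w ^ 2 + (ρ : ℂ) ^ 2 ≠ 0 := by
    intro h; rw [h, mul_zero] at hab; exact mul_ne_zero ha0 hb0 hab
  have hba : a - b = - (4 * Real.pi * w) := by rw [ha, hb]; ring
  have : Complex.exp (b * ((0 : ℝ) : ℂ)) / b + -Complex.exp (a * ((0 : ℝ) : ℂ)) / a
      = (a - b) / (a * b) := by
    simp; field_simp; ring
  rw [this, hab, hba]
  field_simp
  ring

lemma exists_isometry_inner (x : E3) :
    ∃ A : WithLp 2 (ℝ × EuclideanSpace ℝ (Fin 2)) ≃ₗᵢ[ℝ] E3,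
      ∀ y, ⟪A y, x⟫ = y.fst * ‖x‖ := by
  have hfr : Module.finrank ℝ (WithLp 2 (ℝ × EuclideanSpace ℝ (Fin 2))) = 3 := by
    rw [(WithLp.linearEquiv 2 ℝ (ℝ × EuclideanSpace ℝ (Fin 2))).finrank_eq]
    simp
  let B : WithLp 2 (ℝ × EuclideanSpace ℝ (Fin 2)) ≃ₗᵢ[ℝ] E3 :=
    ((stdOrthonormalBasis ℝ _).reindex (finCongr hfr)).repr
  let e : WithLp 2 (ℝ × EuclideanSpace ℝ (Fin 2)) := WithLp.toLp 2 (‖x‖, 0)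
  have he : ‖B e‖ = ‖x‖ := by
    rw [B.norm_map, WithLp.prod_norm_eq_of_L2]
    simp [e]
  refine ⟨B.trans (Submodule.reflection (ℝ ∙ (B e - x))ᗮ), fun y => ?_⟩
  have hx : (Submodule.reflection (ℝ ∙ (B e - x))ᗮ) (B e) = x := Submodule.reflection_sub he
  set R := Submodule.reflection (ℝ ∙ (B e - x))ᗮ
  have h : ⟪R (B y), x⟫ = ⟪R (B y), R (B e)⟫ := by rw [hx]
  rw [LinearIsometryEquiv.trans_apply, h, LinearIsometryEquiv.inner_map_map,
    LinearIsometryEquiv.inner_map_map, WithLp.prod_inner_apply]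
  simp [e, mul_comm]

/-- The inverse Fourier transform of `|∇|⁻¹ e^{-w|∇|}`, for complex `w` with positive real part. -/
lemma integral_rad_inv_exp {w : ℂ} (hw : 0 < w.re) (x : E3) :
    ∫ ξ : E3, Complex.exp ((2 * Real.pi * ⟪ξ, x⟫ : ℝ) * Complex.I) *
      ((rad ξ : ℂ)⁻¹ * Complex.exp (-w * rad ξ)) =
      1 / (2 * Real.pi ^ 2 * (w ^ 2 + (‖x‖ : ℂ) ^ 2)) := by
  obtain ⟨A, hA⟩ := exists_isometry_inner x
  set H : E3 → ℂ := fun ξ => Complex.exp ((2 * Real.pi * ⟪ξ, x⟫ : ℝ) * Complex.I) *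
      ((rad ξ : ℂ)⁻¹ * Complex.exp (-w * rad ξ)) with hH
  have hHi : Integrable H := by
    refine Integrable.mono' (integrable_rad_rpow_mul_exp (r := -1) (by norm_num) hw) ?_ ?_
    · refine Measurable.aestronglyMeasurable ?_
      have := measurable_rad
      fun_prop
    · refine Filter.Eventually.of_forall fun ξ => ?_
      rw [hH, norm_mul, Complex.norm_exp_ofReal_mul_I, one_mul, norm_mul, norm_inv,
        Complex.norm_real, Real.norm_of_nonneg (rad_nonneg ξ), Complex.norm_exp, Real.rpow_neg_one]
      simp
  have m1 := A.measurePreserving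
  have m2 := (WithLp.volume_preserving_symm_measurableEquiv_toLp_prod
    ℝ (EuclideanSpace ℝ (Fin 2))).symm
  have m3 := m1.comp m2
  have hemb : MeasurableEmbedding (A ∘ (MeasurableEquiv.toLp 2 (ℝ × EuclideanSpace ℝ (Fin 2))).symm.symm) :=
    A.toHomeomorph.measurableEmbedding.comp (MeasurableEquiv.measurableEmbedding _)
  rw [← m3.integral_comp hemb, Measure.volume_eq_prod, integral_prod]
  rotate_left
  · rw [← Measure.volume_eq_prod]; exact (m3.integrable_comp_emb hemb).2 hHi
  have hval : ∀ s : ℝ, ∀ η : EuclideanSpace ℝ (Fin 2),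
      H ((A ∘ (MeasurableEquiv.toLp 2 (ℝ × EuclideanSpace ℝ (Fin 2))).symm.symm) (s, η)) =
      Complex.exp ((2 * Real.pi * (s * ‖x‖) : ℝ) * Complex.I) *
      (((2 * Real.pi * √(s ^ 2 + ‖η‖ ^ 2) : ℝ) : ℂ)⁻¹ *
        Complex.exp (-w * (2 * Real.pi * √(s ^ 2 + ‖η‖ ^ 2) : ℝ))) := by
    intro s η
    have h1 := hA (WithLp.toLp 2 (s, η))
    have h2 : rad (A (WithLp.toLp 2 (s, η))) = 2 * Real.pi * √(s ^ 2 + ‖η‖ ^ 2) := by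
      rw [rad, A.norm_map, WithLp.prod_norm_eq_of_L2]; simp
    simp only [hH, Function.comp, MeasurableEquiv.symm_symm, MeasurableEquiv.toLp_apply]
    rw [h1, h2]
    rfl
  have hval2 : ∀ s : ℝ, ∫ η : EuclideanSpace ℝ (Fin 2),
      H ((A ∘ (MeasurableEquiv.toLp 2 (ℝ × EuclideanSpace ℝ (Fin 2))).symm.symm) (s, η)) = _ :=
    fun s => (integral_congr_ae (Filter.Eventually.of_forall (hval s))).trans
      (integral_const_mul _ _)
  refine (integral_congr_ae (Filter.Eventually.of_forall hval2)).trans ?_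
  have : ∀ᵐ s : ℝ, Complex.exp ((2 * Real.pi * (s * ‖x‖) : ℝ) * Complex.I) *
      ∫ η : EuclideanSpace ℝ (Fin 2), (((2 * Real.pi * √(s ^ 2 + ‖η‖ ^ 2) : ℝ) : ℂ)⁻¹ *
        Complex.exp (-w * (2 * Real.pi * √(s ^ 2 + ‖η‖ ^ 2) : ℝ))) =
      Complex.exp ((2 * Real.pi * (s * ‖x‖) : ℝ) * Complex.I) *
      Complex.exp (-w * (2 * Real.pi * |s| : ℝ)) * (1 / (2 * Real.pi * w)) := by
    filter_upwards [Measure.ae_ne volume (0 : ℝ)] with s hs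
    rw [integral_radial_plane hs hw]; ring
  rw [integral_congr_ae this, integral_mul_const, integral_exp_abs hw]
  have hw0 : w ≠ 0 := fun h => by simp [h] at hw
  have hp : (Real.pi : ℂ) ≠ 0 := by exact_mod_cast Real.pi_ne_zero
  field_simp

/-- The inverse Fourier transform of `|∇|⁻¹ e^{-w|∇|} cos(τ|∇|)`, as a function of `ρ = ‖x‖`. -/
def coneKernel (w τ ρ : ℝ) : ℝ :=
  (w ^ 2 + ρ ^ 2 - τ ^ 2) / (2 * Real.pi ^ 2 * ((w ^ 2 + (τ - ρ) ^ 2) * (w ^ 2 + (τ + ρ) ^ 2)))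

lemma integral_rad_inv_exp_cos {w : ℝ} (hw : 0 < w) (τ : ℝ) (x : E3) :
    ∫ ξ : E3, Complex.exp ((2 * Real.pi * ⟪ξ, x⟫ : ℝ) * Complex.I) *
      (((rad ξ)⁻¹ * Real.exp (-w * rad ξ) * Real.cos (τ * rad ξ) : ℝ) : ℂ) =
      coneKernel w τ ‖x‖ := by
  have key : ∀ v : ℂ, 0 < v.re → Integrable (fun ξ : E3 =>
      Complex.exp ((2 * Real.pi * ⟪ξ, x⟫ : ℝ) * Complex.I) *
      ((rad ξ : ℂ)⁻¹ * Complex.exp (-v * rad ξ))) := by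
    intro v hv
    refine Integrable.mono' (integrable_rad_rpow_mul_exp (r := -1) (by norm_num) hv) ?_ ?_
    · refine Measurable.aestronglyMeasurable ?_
      have := measurable_rad
      fun_prop
    · refine Filter.Eventually.of_forall fun ξ => ?_
      rw [norm_mul, Complex.norm_exp_ofReal_mul_I, one_mul, norm_mul, norm_inv,
        Complex.norm_real, Real.norm_of_nonneg (rad_nonneg ξ), Complex.norm_exp, Real.rpow_neg_one]
      simp
  have h1 : 0 < ((w : ℂ) + τ * Complex.I).re := by simpa
  have h2 : 0 < ((w : ℂ) - τ * Complex.I).re := by simpa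
  have e1 := integral_rad_inv_exp h1 x
  have e2 := integral_rad_inv_exp h2 x
  have e3 : ∀ ξ : E3, Complex.exp ((2 * Real.pi * ⟪ξ, x⟫ : ℝ) * Complex.I) *
      (((rad ξ)⁻¹ * Real.exp (-w * rad ξ) * Real.cos (τ * rad ξ) : ℝ) : ℂ) =
      (1 / 2 : ℂ) * (Complex.exp ((2 * Real.pi * ⟪ξ, x⟫ : ℝ) * Complex.I) *
      ((rad ξ : ℂ)⁻¹ * Complex.exp (-((w : ℂ) + τ * Complex.I) * rad ξ)) +
      Complex.exp ((2 * Real.pi * ⟪ξ, x⟫ : ℝ) * Complex.I) *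
      ((rad ξ : ℂ)⁻¹ * Complex.exp (-((w : ℂ) - τ * Complex.I) * rad ξ))) := by
    intro ξ
    have a1 : -((w : ℂ) + τ * Complex.I) * rad ξ = -w * rad ξ + -(τ * rad ξ) * Complex.I := by ring
    have a2 : -((w : ℂ) - τ * Complex.I) * rad ξ = -w * rad ξ + (τ * rad ξ) * Complex.I := by ring
    rw [a1, a2, Complex.exp_add, Complex.exp_add]
    push_cast
    rw [Complex.cos]
    ring
  simp_rw [e3]
  rw [integral_const_mul, integral_add (key _ h1) (key _ h2), e1, e2, coneKernel]
  have hd1 : (w ^ 2 + (τ - ‖x‖) ^ 2 : ℂ) ≠ 0 := by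
    have : 0 < w ^ 2 + (τ - ‖x‖) ^ 2 := by positivity
    exact_mod_cast this.ne'
  have hd2 : (w ^ 2 + (τ + ‖x‖) ^ 2 : ℂ) ≠ 0 := by
    have : 0 < w ^ 2 + (τ + ‖x‖) ^ 2 := by positivity
    exact_mod_cast this.ne'
  have hp : (Real.pi : ℂ) ≠ 0 := by exact_mod_cast Real.pi_ne_zero
  have hprod : (((w : ℂ) + τ * Complex.I) ^ 2 + (‖x‖ : ℂ) ^ 2) *
      (((w : ℂ) - τ * Complex.I) ^ 2 + (‖x‖ : ℂ) ^ 2) =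
      (w ^ 2 + (τ - ‖x‖) ^ 2) * (w ^ 2 + (τ + ‖x‖) ^ 2) := by
    linear_combination (-2 * (w : ℂ) ^ 2 * τ ^ 2 + τ ^ 4 * (Complex.I ^ 2 - 1) + 2 * ‖x‖ ^ 2 * τ ^ 2) * Complex.I_sq
  have hne := mul_ne_zero hd1 hd2
  have hn1 := hprod ▸ hne
  have n1 := left_ne_zero_of_mul hn1
  have n2 := right_ne_zero_of_mul hn1
  push_cast
  rw [← hprod]
  field_simp
  linear_combination (2 * (τ : ℂ) ^ 2) * Complex.I_sq

lemma abs_coneKernel_le {w lam τ ρ : ℝ} (hlam : 0 < lam) (hw : lam ≤ w) (hτ : 0 < τ) (hρ : 0 ≤ ρ) :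
    |coneKernel w τ ρ| ≤ 1 / (lam ^ 2 + (ρ + τ) ^ 2) +
      |ρ - τ| / (ρ + τ) * (1 / (lam ^ 2 + (ρ - τ) ^ 2)) := by
  have hw0 : 0 < w := hlam.trans_le hw
  have hsq : lam ^ 2 ≤ w ^ 2 := by gcongr
  set D1 := w ^ 2 + (τ - ρ) ^ 2 with hD1
  set D2 := w ^ 2 + (τ + ρ) ^ 2 with hD2
  have h1 : 0 < D1 := by positivity
  have h2 : 0 < D2 := by positivity
  have hs : 0 < ρ + τ := by positivity
  have hpi : 1 ≤ 2 * Real.pi ^ 2 := by nlinarith [Real.pi_gt_three]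
  have hnum : |w ^ 2 + ρ ^ 2 - τ ^ 2| ≤ w ^ 2 + |ρ - τ| * (ρ + τ) := by
    rw [show w ^ 2 + ρ ^ 2 - τ ^ 2 = w ^ 2 + (ρ - τ) * (ρ + τ) by ring]
    refine (abs_add_le _ _).trans ?_
    rw [abs_mul, abs_of_pos hs, abs_of_pos (by positivity : 0 < w ^ 2)]
  have hab := abs_nonneg (ρ - τ)
  calc |coneKernel w τ ρ| = |w ^ 2 + ρ ^ 2 - τ ^ 2| / (2 * Real.pi ^ 2 * (D1 * D2)) := by
        rw [coneKernel, abs_div, abs_of_pos (by positivity : 0 < 2 * Real.pi ^ 2 * (D1 * D2))]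
    _ ≤ (w ^ 2 + |ρ - τ| * (ρ + τ)) / (D1 * D2) := by
        refine div_le_div₀ (by positivity) hnum (by positivity) ?_
        exact le_mul_of_one_le_left (by positivity) hpi
    _ = w ^ 2 / D1 * (1 / D2) + |ρ - τ| / (ρ + τ) * ((ρ + τ) ^ 2 / D2) * (1 / D1) := by
        field_simp
    _ ≤ 1 * (1 / (lam ^ 2 + (ρ + τ) ^ 2)) +
        |ρ - τ| / (ρ + τ) * 1 * (1 / (lam ^ 2 + (ρ - τ) ^ 2)) := by
        gcongr
        · rw [div_le_one h1]; nlinarith [sq_nonneg (τ - ρ)]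
        · rw [hD2, add_comm ρ τ]; gcongr
        · rw [div_le_one h2]; nlinarith
        · rw [hD1]; nlinarith
    _ = _ := by ring

lemma exists_integral_rpow_div_le {β : ℝ} (h0 : 0 < β) (h1 : β ≤ 1) :
    ∃ c : ℝ, 0 ≤ c ∧ ∀ A : ℝ, 0 < A →
      IntegrableOn (fun l : ℝ => l ^ (1 - β) * (1 / (l ^ 2 + A ^ 2))) (Ioi 0) ∧
      ∫ l in Ioi (0 : ℝ), l ^ (1 - β) * (1 / (l ^ 2 + A ^ 2)) = c * A ^ (-β) := by
  set g : ℝ → ℝ := fun l => l ^ (1 - β) * (1 / (l ^ 2 + 1)) with hg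
  have hgi : IntegrableOn g (Ioi 0) := by
    rw [← Ioc_union_Ioi_eq_Ioi zero_le_one]
    refine IntegrableOn.union ?_ ?_
    · refine Measure.integrableOn_of_bounded (M := 1) (by simp) ?_ ?_
      · exact Measurable.aestronglyMeasurable (by fun_prop)
      · filter_upwards [ae_restrict_mem measurableSet_Ioc] with l hl
        have := hl.1
        rw [Real.norm_of_nonneg (by positivity)]
        refine mul_le_one₀ (Real.rpow_le_one hl.1.le hl.2 (by linarith)) (by positivity) ?_
        rw [div_le_one (by positivity)]; nlinarith
    · refine Integrable.mono' (integrableOn_Ioi_rpow_of_lt (a := -1 - β) (by linarith) one_pos) 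
        (Measurable.aestronglyMeasurable (by fun_prop)) ?_
      filter_upwards [ae_restrict_mem measurableSet_Ioi] with l hl
      have hl : 1 < l := hl
      have hl0 : 0 < l := by linarith
      rw [Real.norm_of_nonneg (by positivity), show -1 - β = (1 - β) - 2 by ring,
        Real.rpow_sub hl0 _ 2, Real.rpow_two, div_eq_mul_one_div (l ^ (1 - β))]
      refine mul_le_mul_of_nonneg_left ?_ (by positivity)
      exact one_div_le_one_div_of_le (by positivity) (by linarith)
  refine ⟨∫ l in Ioi (0 : ℝ), g l, setIntegral_nonneg measurableSet_Ioi fun l hl => ?_, fun A hA => ?_⟩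
  · have hl : 0 < l := hl
    positivity
  · have hA' : 0 < A⁻¹ := inv_pos.2 hA
    have e : EqOn (fun l : ℝ => A ^ (-1 - β) * g (A⁻¹ * l))
        (fun l : ℝ => l ^ (1 - β) * (1 / (l ^ 2 + A ^ 2))) (Ioi 0) := by
      intro l hl
      have hl : 0 < l := hl
      simp only [hg]
      rw [Real.mul_rpow hA'.le hl.le, Real.inv_rpow hA.le, ← Real.rpow_neg hA.le,
        show -1 - β = (1 - β) + (-2 : ℝ) by ring, Real.rpow_add hA, 
        Real.rpow_neg hA.le (1 - β), Real.rpow_neg hA.le 2, Real.rpow_two]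
      have : 0 < A ^ (1 - β) := by positivity
      field_simp
    have hi := (integrableOn_Ioi_comp_mul_left_iff g 0 hA').2 (by simpa using hgi)
    refine ⟨IntegrableOn.congr_fun (Integrable.const_mul hi _) e measurableSet_Ioi, ?_⟩
    rw [← setIntegral_congr_fun measurableSet_Ioi e, integral_const_mul,
      integral_comp_mul_left_Ioi g 0 hA', mul_zero, inv_inv, smul_eq_mul,
      show -1 - β = -1 + -β by ring, Real.rpow_add hA, Real.rpow_neg_one]
    field_simp

lemma exists_integral_coneKernel_le {β : ℝ} (h0 : 0 < β) (h1 : β ≤ 1) :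
    ∃ c : ℝ, 0 ≤ c ∧ ∀ ε : ℝ, 0 < ε → ∀ τ : ℝ, τ ≠ 0 → ∀ ρ : ℝ, 0 ≤ ρ →
      ∫ l in Ioi (0 : ℝ), l ^ (1 - β) * |coneKernel (l + ε) τ ρ| ≤ c * |τ| ^ (-β) := by
  obtain ⟨c, hc, H⟩ := exists_integral_rpow_div_le h0 h1
  refine ⟨2 * c, by positivity, fun ε hε τ hτ ρ hρ => ?_⟩
  have habs : ∀ w, coneKernel w τ ρ = coneKernel w |τ| ρ := by
    intro w
    rcases abs_cases τ with h | h
    · rw [h.1]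
    · rw [h.1, coneKernel, coneKernel]; congr 1 <;> ring
  simp_rw [habs]
  set T := |τ|
  have hT : 0 < T := abs_pos.2 hτ
  have hs : 0 < ρ + T := by positivity
  obtain ⟨i1, v1⟩ := H (ρ + T) hs
  set d := |ρ - T| with hd
  have hd2 : (ρ - T) ^ 2 = d ^ 2 := (sq_abs _).symm
  obtain ⟨i2, v2⟩ : IntegrableOn (fun l : ℝ => d * (l ^ (1 - β) * (1 / (l ^ 2 + d ^ 2)))) (Ioi 0) ∧
      ∫ l in Ioi (0 : ℝ), d * (l ^ (1 - β) * (1 / (l ^ 2 + d ^ 2))) ≤ c * (ρ + T) ^ (1 - β) := by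
    rcases (abs_nonneg (ρ - T)).eq_or_lt with h | h
    · rw [← hd] at h
      rw [← h]
      simp; positivity
    · rw [← hd] at h
      obtain ⟨i2, v2⟩ := H d h
      refine ⟨i2.const_mul d, ?_⟩
      rw [integral_const_mul, v2]
      have : d * (c * d ^ (-β)) = c * d ^ (1 - β) := by
        rw [sub_eq_add_neg, Real.rpow_add h, Real.rpow_one]; ring
      rw [this]
      gcongr
      rw [hd, abs_le]; constructor <;> linarith
  calc ∫ l in Ioi (0 : ℝ), l ^ (1 - β) * |coneKernel (l + ε) T ρ| 
      ≤ ∫ l in Ioi (0 : ℝ), (l ^ (1 - β) * (1 / (l ^ 2 + (ρ + T) ^ 2)) + 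
        (ρ + T)⁻¹ * (d * (l ^ (1 - β) * (1 / (l ^ 2 + d ^ 2))))) := by
        refine integral_mono_of_nonneg ?_ (i1.add (i2.const_mul _)) ?_
        · filter_upwards [ae_restrict_mem measurableSet_Ioi] with l hl
          have hl : 0 < l := hl
          simp only [Pi.zero_apply]; positivity
        · filter_upwards [ae_restrict_mem measurableSet_Ioi] with l hl
          have hl : 0 < l := hl
          have h := abs_coneKernel_le hl (by linarith : l ≤ l + ε) hT hρ
          rw [hd2] at h
          refine (mul_le_mul_of_nonneg_left h (by positivity : 0 ≤ l ^ (1 - β))).trans_eq ?_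
          rw [← hd, mul_add]; field_simp
    _ ≤ c * (ρ + T) ^ (-β) + (ρ + T)⁻¹ * (c * (ρ + T) ^ (1 - β)) := by
        rw [integral_add i1 (i2.const_mul _), v1, integral_const_mul]
        gcongr
    _ = 2 * c * (ρ + T) ^ (-β) := by
        rw [sub_eq_add_neg, Real.rpow_add hs, Real.rpow_one]; field_simp; ring
    _ ≤ 2 * c * T ^ (-β) := by
        gcongr 2 * c * ?_
        exact Real.rpow_le_rpow_of_nonpos hT (by linarith) (by linarith)

section ExponentialFamily

variable {X : Type*} {h : X → ℂ} {l : X → ℝ} {a b : ℝ}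

lemma exp_mul_le_exp_add_exp {s x : ℝ} (ha : a ≤ s) (hb : s ≤ b) :
    Real.exp (s * x) ≤ Real.exp (a * x) + Real.exp (b * x) := by
  rcases le_total 0 x with hx | hx
  · have : Real.exp (s * x) ≤ Real.exp (b * x) := Real.exp_le_exp.2 (by nlinarith)
    linarith [Real.exp_pos (a * x)]
  · have : Real.exp (s * x) ≤ Real.exp (a * x) := Real.exp_le_exp.2 (by nlinarith)
    linarith [Real.exp_pos (b * x)]

lemma norm_mul_cexp_le {z : ℂ} (ha : a ≤ z.re) (hb : z.re ≤ b) (x : X) :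
    ‖h x * Complex.exp (z * l x)‖ ≤ ‖h x‖ * Real.exp (a * l x) + ‖h x‖ * Real.exp (b * l x) := by
  rw [norm_mul, Complex.norm_exp, Complex.re_mul_ofReal, ← mul_add]
  gcongr
  exact exp_mul_le_exp_add_exp ha hb

variable [MeasurableSpace X] {μ : Measure X}

lemma norm_integral_mul_cexp_le
    (hia : Integrable (fun x => ‖h x‖ * Real.exp (a * l x)) μ)
    (hib : Integrable (fun x => ‖h x‖ * Real.exp (b * l x)) μ)
    {z : ℂ} (ha : a ≤ z.re) (hb : z.re ≤ b) :
    ‖∫ x, h x * Complex.exp (z * l x) ∂μ‖ ≤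
      ∫ x, (‖h x‖ * Real.exp (a * l x) + ‖h x‖ * Real.exp (b * l x)) ∂μ :=
  norm_integral_le_of_norm_le (hia.add hib)
    (Filter.Eventually.of_forall fun x => norm_mul_cexp_le ha hb x)

lemma differentiableAt_integral_mul_cexp (hh : AEStronglyMeasurable h μ) (hl : Measurable l)
    (hia : Integrable (fun x => ‖h x‖ * Real.exp (a * l x)) μ)
    (hib : Integrable (fun x => ‖h x‖ * Real.exp (b * l x)) μ)
    {z : ℂ} (ha : a < z.re) (hb : z.re < b) :
    DifferentiableAt ℂ (fun z : ℂ => ∫ x, h x * Complex.exp (z * l x) ∂μ) z := by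
  obtain ⟨δ, hδ, hδa, hδb⟩ : ∃ δ : ℝ, 0 < δ ∧ a ≤ z.re - 2 * δ ∧ z.re + 2 * δ ≤ b := by
    refine ⟨min (z.re - a) (b - z.re) / 2, ?_, ?_, ?_⟩
    · have : 0 < min (z.re - a) (b - z.re) := lt_min (by linarith) (by linarith)
      linarith
    · linarith [min_le_left (z.re - a) (b - z.re)]
    · linarith [min_le_right (z.re - a) (b - z.re)]
  have hlc : Measurable fun x => (l x : ℂ) := Complex.measurable_ofReal.comp hl
  have hmeas : ∀ z : ℂ, AEStronglyMeasurable (fun x => h x * Complex.exp (z * l x)) μ := fun z =>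
    hh.mul (by fun_prop : Measurable fun x => Complex.exp (z * l x)).aestronglyMeasurable
  refine (hasDerivAt_integral_of_dominated_loc_of_deriv_le
    (F := fun (z : ℂ) x => h x * Complex.exp (z * l x))
    (F' := fun (z : ℂ) x => h x * (Complex.exp (z * l x) * l x))
    (bound := fun x => δ⁻¹ * (2 * (‖h x‖ * Real.exp (a * l x) + ‖h x‖ * Real.exp (b * l x))))
    (Metric.ball_mem_nhds z hδ) (Filter.Eventually.of_forall hmeas) ?_ ?_ ?_
    (((hia.add hib).const_mul 2).const_mul _) ?_).2.differentiableAt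
  · exact Integrable.mono' (hia.add hib) (hmeas z)
      (Filter.Eventually.of_forall fun x => norm_mul_cexp_le ha.le hb.le x)
  · exact hh.mul (by fun_prop : Measurable fun x =>
      Complex.exp (z * l x) * (l x : ℂ)).aestronglyMeasurable
  · refine Filter.Eventually.of_forall fun x w hw => ?_
    have hre : |w.re - z.re| < δ := by
      rw [← Complex.sub_re]
      exact (Complex.abs_re_le_norm _).trans_lt (by simpa [dist_eq_norm] using hw)
    rw [abs_lt] at hre
    have h1 : |l x| ≤ δ⁻¹ * Real.exp (δ * |l x|) := by
      rw [le_inv_mul_iff₀ hδ]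
      linarith [Real.add_one_le_exp (δ * |l x|)]
    have h2 : Real.exp (w.re * l x) * Real.exp (δ * |l x|) ≤
        2 * (Real.exp (a * l x) + Real.exp (b * l x)) := by
      rcases abs_cases (l x) with hc | hc
      · rw [hc.1, ← Real.exp_add, ← add_mul]
        have := exp_mul_le_exp_add_exp (a := a) (b := b) (s := w.re + δ) (x := l x)
          (by linarith) (by linarith)
        linarith [Real.exp_pos (a * l x), Real.exp_pos (b * l x)]
      · rw [hc.1, ← Real.exp_add, mul_neg, ← sub_eq_add_neg, ← sub_mul]
        have := exp_mul_le_exp_add_exp (a := a) (b := b) (s := w.re - δ) (x := l x)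
          (by linarith) (by linarith)
        linarith [Real.exp_pos (a * l x), Real.exp_pos (b * l x)]
    rw [norm_mul, norm_mul, Complex.norm_exp, Complex.re_mul_ofReal, Complex.norm_real,
      Real.norm_eq_abs]
    calc ‖h x‖ * (Real.exp (w.re * l x) * |l x|)
        ≤ ‖h x‖ * (Real.exp (w.re * l x) * (δ⁻¹ * Real.exp (δ * |l x|))) := by gcongr
      _ = δ⁻¹ * (‖h x‖ * (Real.exp (w.re * l x) * Real.exp (δ * |l x|))) := by ring
      _ ≤ δ⁻¹ * (‖h x‖ * (2 * (Real.exp (a * l x) + Real.exp (b * l x)))) := by gcongr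
      _ = _ := by ring
  · refine Filter.Eventually.of_forall fun x w _ => ?_
    have := ((hasDerivAt_id w).mul_const (l x : ℂ)).cexp.const_mul (h x)
    simpa using this

end ExponentialFamily

lemma norm_Gamma_le {z : ℂ} (hz : 0 < z.re) : ‖Complex.Gamma z‖ ≤ Real.Gamma z.re := by
  rw [Complex.Gamma_eq_integral hz, Real.Gamma_eq_integral hz, Complex.GammaIntegral]
  refine (norm_integral_le_integral_norm _).trans_eq (setIntegral_congr_fun measurableSet_Ioi ?_)
  intro x hx
  have hx : 0 < x := hx
  simp only [norm_mul, Complex.norm_cpow_eq_rpow_re_of_pos hx, Complex.norm_real,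
    Real.norm_of_nonneg (Real.exp_pos _).le, Complex.sub_re, Complex.one_re]

/-- The dispersive bound on the kernels at the right edge of the strip. -/
lemma exists_norm_Gamma_mul_integral_le {β : ℝ} (h0 : 0 < β) (h1 : β ≤ 1) :
    ∃ c : ℝ, 0 ≤ c ∧ ∀ ε : ℝ, 0 < ε → ∀ τ : ℝ, τ ≠ 0 → ∀ (x : E3) (a : ℂ), a.re = 2 - β →
      ‖Complex.Gamma a * ∫ ξ : E3, Complex.exp ((2 * Real.pi * ⟪ξ, x⟫ : ℝ) * Complex.I) *
        (Complex.exp (-a * Real.log (rad ξ)) *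
          ((rad ξ)⁻¹ * Real.exp (-ε * rad ξ) * Real.cos (τ * rad ξ) : ℝ))‖ ≤ c * |τ| ^ (-β) := by
  obtain ⟨c, hc, H⟩ := exists_integral_coneKernel_le h0 h1
  refine ⟨c, hc, fun ε hε τ hτ x a ha => ?_⟩
  have ha0 : 0 < a.re := by rw [ha]; linarith
  set e : E3 → ℂ := fun ξ => Complex.exp ((2 * Real.pi * ⟪ξ, x⟫ : ℝ) * Complex.I) with he
  set m : E3 → ℂ := fun ξ => (((rad ξ)⁻¹ * Real.exp (-ε * rad ξ) * Real.cos (τ * rad ξ) : ℝ) : ℂ)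
    with hm
  set P : E3 → ℝ → ℂ := fun ξ l => e ξ * ((l : ℂ) ^ (a - 1) * Complex.exp (-(rad ξ * l)) * m ξ)
    with hP
  have hmr := measurable_rad
  have e1 : Complex.Gamma a * ∫ ξ : E3, e ξ * (Complex.exp (-a * Real.log (rad ξ)) * m ξ) =
      ∫ ξ : E3, ∫ l in Ioi (0 : ℝ), P ξ l := by
    rw [← integral_const_mul]
    refine integral_congr_ae ?_
    filter_upwards [ae_rad_pos] with ξ hξ
    have hr : (rad ξ : ℂ) ≠ 0 := by exact_mod_cast hξ.ne'
    have h2 := Complex.integral_cpow_mul_exp_neg_mul_Ioi ha0 hξ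
    have h3 : (1 / (rad ξ : ℂ)) ^ a = Complex.exp (-a * Real.log (rad ξ)) := by
      rw [Complex.cpow_def_of_ne_zero (by simpa using hr), one_div, ← Complex.ofReal_inv,
        ← Complex.ofReal_log (by positivity), Real.log_inv]
      congr 1; push_cast; ring
    simp only [hP]
    rw [integral_const_mul, integral_mul_const, h2, h3]
    ring
  have hPi : Integrable (Function.uncurry P) (volume.prod (volume.restrict (Ioi 0))) := by
    have hdom : Integrable (fun z : E3 × ℝ => z.2 ^ (2 - β - 1) * Real.exp (-(rad z.1 * z.2)) *
        ((rad z.1)⁻¹ * Real.exp (-ε * rad z.1))) (volume.prod (volume.restrict (Ioi 0))) := by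
      have hmd : AEStronglyMeasurable (fun z : E3 × ℝ =>
          z.2 ^ (2 - β - 1) * Real.exp (-(rad z.1 * z.2)) *
          ((rad z.1)⁻¹ * Real.exp (-ε * rad z.1))) (volume.prod (volume.restrict (Ioi 0))) :=
        Measurable.aestronglyMeasurable (by fun_prop)
      rw [integrable_prod_iff hmd]
      constructor
      · filter_upwards [ae_rad_pos] with ξ hξ
        refine Integrable.mul_const ?_ _
        have := integrableOn_rpow_mul_exp_neg_mul_rpow (p := 1) (s := 2 - β - 1) (b := rad ξ)
          (by linarith) one_pos hξ
        simpa [IntegrableOn] using this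
      · refine ((integrable_rad_rpow_mul_exp (r := -(2 - β) - 1) (by linarith) hε).const_mul
          (Real.Gamma (2 - β))).congr ?_
        filter_upwards [ae_rad_pos] with ξ hξ
        have h2 := Real.integral_rpow_mul_exp_neg_mul_Ioi (a := 2 - β) (by linarith) hξ
        rw [Real.rpow_sub hξ, Real.rpow_neg hξ.le, Real.rpow_one]
        have h4 : ∀ l ∈ Ioi (0 : ℝ), ‖l ^ (2 - β - 1) * Real.exp (-(rad ξ * l)) *
          ((rad ξ)⁻¹ * Real.exp (-ε * rad ξ))‖ = l ^ (2 - β - 1) * Real.exp (-(rad ξ * l)) *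
          ((rad ξ)⁻¹ * Real.exp (-ε * rad ξ)) := fun l hl => by
            have hl : 0 < l := hl
            rw [Real.norm_of_nonneg (by positivity)]
        rw [setIntegral_congr_fun measurableSet_Ioi h4, integral_mul_const, h2, one_div,
          Real.inv_rpow hξ.le]
        field_simp
    refine hdom.mono' ?_ ?_
    · refine Measurable.aestronglyMeasurable ?_
      simp only [hP, he, hm, Function.uncurry_def]
      fun_prop
    · have hpos : ∀ᵐ z ∂((volume : Measure E3).prod (volume.restrict (Ioi (0 : ℝ)))), 0 < z.2 :=
        Measure.quasiMeasurePreserving_snd.ae (ae_restrict_mem measurableSet_Ioi)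
      filter_upwards [hpos] with z hz
      have h5 := rad_nonneg z.1
      simp only [Function.uncurry_def, hP, he, hm]
      rw [norm_mul, Complex.norm_exp_ofReal_mul_I, one_mul, norm_mul, norm_mul,
        Complex.norm_cpow_eq_rpow_re_of_pos hz, Complex.norm_exp, Complex.norm_real,
        Complex.sub_re, Complex.one_re, ha, ← Complex.ofReal_mul, ← Complex.ofReal_neg,
        Complex.ofReal_re, norm_mul, Real.norm_of_nonneg (by positivity : 0 ≤ (rad z.1)⁻¹ *
          Real.exp (-ε * rad z.1))]
      refine mul_le_mul_of_nonneg_left ?_ (by positivity)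
      exact mul_le_of_le_one_right (by positivity) (Real.abs_cos_le_one _)
  rw [e1, integral_integral_swap hPi]
  have e2 : ∀ l ∈ Ioi (0 : ℝ), ∫ ξ, P ξ l = (l : ℂ) ^ (a - 1) * coneKernel (l + ε) τ ‖x‖ := by
    intro l hl
    have hl : 0 < l := hl
    rw [← integral_rad_inv_exp_cos (by linarith : 0 < l + ε) τ x, ← integral_const_mul]
    refine integral_congr_ae (Filter.Eventually.of_forall fun ξ => ?_)
    simp only [hP, he, hm]
    rw [show -(l + ε) * rad ξ = -(rad ξ * l) + -ε * rad ξ by ring, Real.exp_add]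
    push_cast
    ring
  rw [setIntegral_congr_fun measurableSet_Ioi e2]
  refine (norm_integral_le_integral_norm _).trans (le_trans (le_of_eq ?_) (H ε hε τ hτ ‖x‖
    (norm_nonneg x)))
  refine setIntegral_congr_fun measurableSet_Ioi fun l hl => ?_
  have hl : 0 < l := hl
  rw [norm_mul, Complex.norm_cpow_eq_rpow_re_of_pos hl, Complex.norm_real, Real.norm_eq_abs,
    Complex.sub_re, Complex.one_re, ha]
  congr 2; ring

/-- Bounded measurable functions supported on a set of finite measure. -/
structure BddFinSupp (F : E3 → ℂ) : Prop where
  meas : Measurable F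
  bdd : ∃ M, ∀ x, ‖F x‖ ≤ M
  supp : volume (Function.support F) < ∞

namespace BddFinSupp

variable {F : E3 → ℂ}

lemma integrable_norm_rpow (hF : BddFinSupp F) {s : ℝ} (hs : 0 < s) :
    Integrable fun x => ‖F x‖ ^ s := by
  obtain ⟨M, hM⟩ := hF.bdd
  have hm := hF.meas
  rw [← integrableOn_iff_integrable_of_support_subset (s := Function.support F)]
  · refine Measure.integrableOn_of_bounded (M := M ^ s) hF.supp.ne
      (Measurable.aestronglyMeasurable (by fun_prop)) (Filter.Eventually.of_forall fun x => ?_)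
    rw [Real.norm_of_nonneg (by positivity)]
    exact Real.rpow_le_rpow (norm_nonneg _) (hM x) hs.le
  · intro x hx hFx
    simp only [Function.mem_support] at hFx hx
    simp [hFx, Real.zero_rpow hs.ne'] at hx

lemma integrable (hF : BddFinSupp F) : Integrable F := by
  rw [← integrable_norm_iff hF.meas.aestronglyMeasurable]
  simpa using hF.integrable_norm_rpow one_pos

lemma memLp_two (hF : BddFinSupp F) : MemLp F 2 := by
  rw [← integrable_norm_rpow_iff hF.meas.aestronglyMeasurable (by norm_num) (by norm_num)]
  simpa using hF.integrable_norm_rpow two_pos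

end BddFinSupp

lemma MeasureTheory.MemLp.integral_norm_sq_eq {f g : E3 → ℂ} (hf : MemLp f 2) (hg : MemLp g 2)
    (h : eLpNorm f 2 volume = eLpNorm g 2 volume) : ∫ x, ‖f x‖ ^ (2 : ℝ) = ∫ x, ‖g x‖ ^ (2 : ℝ) := by
  rw [hf.eLpNorm_eq_integral_rpow_norm (by norm_num) (by norm_num),
    hg.eLpNorm_eq_integral_rpow_norm (by norm_num) (by norm_num),
    ENNReal.ofReal_eq_ofReal_iff (by positivity) (by positivity),
    Real.rpow_left_inj (by positivity) (by positivity) (by norm_num)] at h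
  simpa using h

lemma continuous_fourier {f : E3 → ℂ} (h : Integrable f) : Continuous (𝓕 f) :=
  VectorFourier.fourierIntegral_continuous Real.continuous_fourierChar
    (by exact continuous_inner) h

lemma continuous_fourierInv {f : E3 → ℂ} (h : Integrable f) : Continuous (𝓕⁻ f) := by
  have : 𝓕⁻ f = 𝓕 f ∘ (fun x : E3 => -x) := by
    ext x; exact Real.fourierInv_eq_fourier_neg f x
  rw [this]
  exact (continuous_fourier h).comp continuous_neg

lemma memLp_fourier {f : E3 → ℂ} (h1 : Integrable f) (h2 : MemLp f 2) : MemLp (𝓕 f) 2 :=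
  ⟨(continuous_fourier h1).aestronglyMeasurable, (eLpNorm_fourier_eq h1 h2).trans_lt h2.2⟩

lemma memLp_fourierInv {f : E3 → ℂ} (h1 : Integrable f) (h2 : MemLp f 2) : MemLp (𝓕⁻ f) 2 :=
  ⟨(continuous_fourierInv h1).aestronglyMeasurable, (eLpNorm_fourierInv_eq h1 h2).trans_lt h2.2⟩

/-- The analytic family `F |F|^{α(1+z)-1}`. -/
def twist (α : ℝ) (F : E3 → ℂ) (z : ℂ) (x : E3) : ℂ :=
  F x * ((‖F x‖ ^ (α - 1) : ℝ) : ℂ) * Complex.exp (z * (α * Real.log ‖F x‖ : ℝ))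

lemma norm_twist {α : ℝ} (hα : 0 < α) (F : E3 → ℂ) {z : ℂ} (hz : -1 < z.re) (x : E3) :
    ‖twist α F z x‖ = ‖F x‖ ^ (α * (1 + z.re)) := by
  rcases eq_or_ne (F x) 0 with h | h
  · have : 0 < α * (1 + z.re) := mul_pos hα (by linarith)
    simp [twist, h, Real.zero_rpow this.ne']
  · have hp : 0 < ‖F x‖ := norm_pos_iff.2 h
    rw [twist, norm_mul, norm_mul, Complex.norm_exp, Complex.re_mul_ofReal, Complex.norm_real,
      Real.norm_of_nonneg (by positivity), Real.rpow_def_of_pos hp, Real.rpow_def_of_pos hp]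
    nth_rw 1 [← Real.exp_log hp]
    rw [← Real.exp_add, ← Real.exp_add]
    congr 1; ring

lemma twist_eq_self {α θ : ℝ} (h : α * (1 + θ) = 1) (F : E3 → ℂ) (x : E3) :
    twist α F θ x = F x := by
  rcases eq_or_ne (F x) 0 with h0 | h0
  · simp [twist, h0]
  · have hp : 0 < ‖F x‖ := norm_pos_iff.2 h0
    rw [twist, ← Complex.ofReal_mul, ← Complex.ofReal_exp, mul_assoc, ← Complex.ofReal_mul,
      Real.rpow_def_of_pos hp, ← Real.exp_add]
    have : Real.log ‖F x‖ * (α - 1) + θ * (α * Real.log ‖F x‖) = 0 := by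
      linear_combination Real.log ‖F x‖ * h
    rw [this]; simp

lemma BddFinSupp.twist {F : E3 → ℂ} (hF : BddFinSupp F) {α : ℝ} (hα : 0 < α) {z : ℂ}
    (hz : -1 < z.re) : BddFinSupp (twist α F z) := by
  have hm := hF.meas
  refine ⟨by unfold _root_.twist; fun_prop, ?_, ?_⟩
  · obtain ⟨M, hM⟩ := hF.bdd
    refine ⟨M ^ (α * (1 + z.re)), fun x => ?_⟩
    rw [norm_twist hα F hz]
    exact Real.rpow_le_rpow (norm_nonneg _) (hM x) (mul_nonneg hα.le (by linarith))
  · refine (measure_mono ?_).trans_lt hF.supp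
    intro x hx h
    exact hx (by simp only [_root_.twist]; rw [h]; simp)

section Family

variable (α c ε τ : ℝ) (F G : E3 → ℂ)

/-- The integrand of the analytic family, on `(ξ, x, y)`-space. -/
def famIntegrand (z : ℂ) (w : E3 × E3 × E3) : ℂ :=
  Complex.exp (-(z * c) * Real.log (rad w.1)) *
    (Real.exp (-ε * rad w.1) * Real.cos (τ * rad w.1) : ℝ) *
    (Complex.exp ((2 * Real.pi * ⟪w.1, w.2.2 - w.2.1⟫ : ℝ) * Complex.I) *
      (twist α F z w.2.1 * twist α G z w.2.2))

/-- The logarithmic weight of the analytic family. -/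
def famLog (w : E3 × E3 × E3) : ℝ :=
  α * Real.log ‖F w.2.1‖ + α * Real.log ‖G w.2.2‖ - c * Real.log (rad w.1)

variable {α c ε τ F G}

lemma famIntegrand_eq (z : ℂ) (w : E3 × E3 × E3) :
    famIntegrand α c ε τ F G z w =
      famIntegrand α c ε τ F G 0 w * Complex.exp (z * famLog α c F G w) := by
  have : z * famLog α c F G w = z * (α * Real.log ‖F w.2.1‖ : ℝ) +
      z * (α * Real.log ‖G w.2.2‖ : ℝ) + -(z * c) * Real.log (rad w.1) := by
    simp only [famLog]; push_cast; ring
  rw [this, Complex.exp_add, Complex.exp_add]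
  simp only [famIntegrand, twist]
  simp only [zero_mul, neg_zero, Complex.exp_zero]
  ring

lemma measurable_famIntegrand (hF : Measurable F) (hG : Measurable G) (z : ℂ) :
    Measurable (famIntegrand α c ε τ F G z) := by
  have := measurable_rad
  unfold famIntegrand twist
  fun_prop

lemma measurable_famLog (hF : Measurable F) (hG : Measurable G) :
    Measurable (famLog α c F G) := by
  have := measurable_rad
  unfold famLog
  fun_prop

lemma integrable_famIntegrand (hα : 0 < α) (hε : 0 < ε) (hF : BddFinSupp F) (hG : BddFinSupp G)
    {z : ℂ} (hz : -1 < z.re) (hzc : z.re * c < 3) :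
    Integrable (famIntegrand α c ε τ F G z) := by
  have i1 := integrable_rad_rpow_mul_exp (r := -(z.re * c)) (by linarith) hε
  have i2 := ((hF.twist hα hz).integrable.norm).mul_prod ((hG.twist hα hz).integrable.norm)
  refine (i1.mul_prod i2).mono' (measurable_famIntegrand hF.meas hG.meas z).aestronglyMeasurable ?_
  have hpos : ∀ᵐ w : E3 × E3 × E3, 0 < rad w.1 :=
    Measure.quasiMeasurePreserving_fst.ae ae_rad_pos
  filter_upwards [hpos] with w hw
  rw [famIntegrand, norm_mul, norm_mul, norm_mul, norm_mul, Complex.norm_exp_ofReal_mul_I, one_mul,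
    Complex.norm_exp, Complex.re_mul_ofReal, Complex.norm_real, norm_mul,
    Real.norm_of_nonneg (Real.exp_pos _).le, Real.rpow_def_of_pos hw]
  have : (-(z * c)).re = -(z.re * c) := by simp
  rw [this, mul_comm (-(z.re * c))]
  refine mul_le_mul_of_nonneg_right ?_ (by positivity)
  refine mul_le_mul_of_nonneg_left ?_ (by positivity)
  exact mul_le_of_le_one_right (by positivity) (Real.abs_cos_le_one _)

/-- Integrating out the space variables. -/
lemma integral_famIntegrand_space (z : ℂ) (ξ : E3) :
    ∫ w : E3 × E3, famIntegrand α c ε τ F G z (ξ, w) =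
      Complex.exp (-(z * c) * Real.log (rad ξ)) *
        (Real.exp (-ε * rad ξ) * Real.cos (τ * rad ξ) : ℝ) *
        (𝓕 (twist α F z) ξ * 𝓕⁻ (twist α G z) ξ) := by
  simp only [famIntegrand]
  rw [integral_const_mul, Real.fourier_eq', Real.fourierInv_eq', Measure.volume_eq_prod,
    ← integral_prod_mul]
  congr 1
  refine integral_congr_ae (Filter.Eventually.of_forall fun w => ?_)
  simp only [smul_eq_mul]
  rw [inner_sub_right, real_inner_comm w.2 ξ, real_inner_comm w.1 ξ]
  have : ((2 * Real.pi * (⟪w.2, ξ⟫ - ⟪w.1, ξ⟫) : ℝ) : ℂ) * Complex.I =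
    ((2 * Real.pi * ⟪w.2, ξ⟫ : ℝ) : ℂ) * Complex.I +
    ((-2 * Real.pi * ⟪w.1, ξ⟫ : ℝ) : ℂ) * Complex.I := by push_cast; ring
  rw [this, Complex.exp_add]
  ring

lemma norm_integral_famIntegrand_le_left (hα : 0 < α) (hε : 0 < ε) (hF : BddFinSupp F)
    (hG : BddFinSupp G) {z : ℂ} (hz : z.re = 0) :
    ‖∫ w, famIntegrand α c ε τ F G z w‖ ≤
      (∫ x, ‖F x‖ ^ (2 * α)) ^ (1 / 2 : ℝ) * (∫ x, ‖G x‖ ^ (2 * α)) ^ (1 / 2 : ℝ) := by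
  have hz1 : -1 < z.re := by linarith
  have hi := integrable_famIntegrand (τ := τ) (c := c) hα hε hF hG hz1 (by rw [hz]; norm_num)
  have hF' := hF.twist hα hz1
  have hG' := hG.twist hα hz1
  have mF := memLp_fourier hF'.integrable hF'.memLp_two
  have mG := memLp_fourierInv hG'.integrable hG'.memLp_two
  have nF := mF.integral_norm_sq_eq hF'.memLp_two
    (eLpNorm_fourier_eq hF'.integrable hF'.memLp_two)
  have nG := mG.integral_norm_sq_eq hG'.memLp_two
    (eLpNorm_fourierInv_eq hG'.integrable hG'.memLp_two)
  have hsq : ∀ (H : E3 → ℂ) x, ‖twist α H z x‖ ^ (2 : ℝ) = ‖H x‖ ^ (2 * α) := fun H x => by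
    rw [norm_twist hα H hz1, hz, ← Real.rpow_mul (norm_nonneg _)]; congr 1; ring
  simp_rw [hsq] at nF nG
  have h22 : (2 : ℝ).HolderConjugate 2 := Real.HolderConjugate.two_two
  have hCS := integral_mul_le_Lp_mul_Lq_of_nonneg (μ := (volume : Measure E3)) h22
    (f := fun ξ => ‖𝓕 (twist α F z) ξ‖) (g := fun ξ => ‖𝓕⁻ (twist α G z) ξ‖)
    (Filter.Eventually.of_forall fun _ => norm_nonneg _)
    (Filter.Eventually.of_forall fun _ => norm_nonneg _)
    (by simpa using mF.norm) (by simpa using mG.norm)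
  rw [nF, nG] at hCS
  refine le_trans ?_ hCS
  rw [Measure.volume_eq_prod, integral_prod _ hi]
  refine norm_integral_le_of_norm_le (mF.norm.integrable_mul mG.norm) ?_
  refine Filter.Eventually.of_forall fun ξ => ?_
  rw [integral_famIntegrand_space, norm_mul, norm_mul, norm_mul,
    Complex.norm_exp, Complex.re_mul_ofReal, Complex.norm_real]
  have : (-(z * c)).re = 0 := by simp [hz]
  rw [this, zero_mul, Real.exp_zero, one_mul]
  refine mul_le_of_le_one_left (by positivity) ?_
  rw [norm_mul, Real.norm_of_nonneg (Real.exp_pos _).le]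
  refine mul_le_one₀ ?_ (norm_nonneg _) (Real.abs_cos_le_one _)
  rw [Real.exp_le_one_iff, neg_mul, Left.neg_nonpos_iff]
  exact mul_nonneg hε.le (rad_nonneg ξ)

end Family

lemma exists_norm_Gamma_mul_integral_famIntegrand_le {β : ℝ} (h0 : 0 < β) (h1 : β ≤ 1) {α : ℝ}
    (hα : 0 < α) :
    ∃ C : ℝ, 0 ≤ C ∧ ∀ ε : ℝ, 0 < ε → ∀ τ : ℝ, τ ≠ 0 → ∀ F G : E3 → ℂ, BddFinSupp F →
      BddFinSupp G → ∀ z : ℂ, z.re = 1 →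
      ‖Complex.Gamma (z * (3 - β : ℝ) - 1) * ∫ w, famIntegrand α (3 - β) ε τ F G z w‖ ≤
        C * |τ| ^ (-β) * ((∫ x, ‖F x‖ ^ (2 * α)) * ∫ x, ‖G x‖ ^ (2 * α)) := by
  obtain ⟨C, hC, H⟩ := exists_norm_Gamma_mul_integral_le h0 h1
  refine ⟨C, hC, fun ε hε τ hτ F G hF hG z hz => ?_⟩
  have hz1 : -1 < z.re := by linarith
  have hi := integrable_famIntegrand (τ := τ) (c := 3 - β) hα hε hF hG hz1 (by rw [hz]; linarith)
  have hF' := hF.twist hα hz1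
  have hG' := hG.twist hα hz1
  have hn : ∀ (H : E3 → ℂ) x, ‖twist α H z x‖ = ‖H x‖ ^ (2 * α) := fun H x => by
    rw [norm_twist hα H hz1, hz]; congr 1; ring
  rw [Measure.volume_eq_prod, integral_prod_symm _ hi, ← integral_const_mul, ← integral_prod_mul,
    ← integral_const_mul]
  refine norm_integral_le_of_norm_le ?_ (Filter.Eventually.of_forall fun w => ?_)
  · exact ((hF.integrable_norm_rpow (by positivity)).mul_prod
      (hG.integrable_norm_rpow (by positivity))).const_mul _
  · have key := H ε hε τ hτ (w.2 - w.1) (z * (3 - β : ℝ) - 1) (by simp [hz]; ring)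
    have : ∫ ξ, famIntegrand α (3 - β) ε τ F G z (ξ, w) =
        (∫ ξ : E3, Complex.exp ((2 * Real.pi * ⟪ξ, w.2 - w.1⟫ : ℝ) * Complex.I) *
        (Complex.exp (-(z * (3 - β : ℝ) - 1) * Real.log (rad ξ)) *
          ((rad ξ)⁻¹ * Real.exp (-ε * rad ξ) * Real.cos (τ * rad ξ) : ℝ))) *
        (twist α F z w.1 * twist α G z w.2) := by
      rw [← integral_mul_const]
      refine integral_congr_ae ?_
      filter_upwards [ae_rad_pos] with ξ hξ
      have e1 : -(z * (3 - β : ℝ)) * Real.log (rad ξ) = -(z * (3 - β : ℝ) - 1) * Real.log (rad ξ) +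
        ((-Real.log (rad ξ) : ℝ) : ℂ) := by push_cast; ring
      simp only [famIntegrand]
      rw [e1, Complex.exp_add, ← Complex.ofReal_exp, Real.exp_neg, Real.exp_log hξ]
      push_cast
      ring
    rw [this, ← mul_assoc, norm_mul, norm_mul (twist α F z w.1), hn, hn]
    gcongr

/-- Fixed-time dispersive estimate, paired with a test function. -/
lemma exists_norm_integral_fourier_mul_le {β r : ℝ} (h0 : 0 < β) (h1 : β ≤ 1) (hr1 : 1 < r)
    (hr2 : r < 2) :
    ∃ C : ℝ, 0 ≤ C ∧ ∀ ε : ℝ, 0 < ε → ∀ τ : ℝ, τ ≠ 0 → ∀ F G : E3 → ℂ, BddFinSupp F →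
      BddFinSupp G →
      ‖∫ ξ : E3, ((rad ξ ^ (-((3 - β) * (2 / r - 1))) * Real.exp (-ε * rad ξ) *
          Real.cos (τ * rad ξ) : ℝ) : ℂ) * (𝓕 F ξ * 𝓕⁻ G ξ)‖ ≤
        C * |τ| ^ (-(β * (2 / r - 1))) *
          ((∫ x, ‖F x‖ ^ r) ^ (1 / r) * (∫ x, ‖G x‖ ^ r) ^ (1 / r)) := by
  have hr0 : 0 < r := by linarith
  set α : ℝ := r / 2 with hα
  have hα0 : 0 < α := by positivity
  set c : ℝ := 3 - β with hc
  have hc0 : 0 < c := by linarith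
  set θ : ℝ := 2 / r - 1 with hθ
  have hθ0 : 0 < θ := by rw [hθ, sub_pos, lt_div_iff₀ hr0]; linarith
  have hθ1 : θ < 1 := by rw [hθ, sub_lt_iff_lt_add, div_lt_iff₀ hr0]; linarith
  have hαθ : α * (1 + θ) = 1 := by rw [hα, hθ]; field_simp; ring
  have h2α : 2 * α = r := by rw [hα]; ring
  obtain ⟨C, hC, H⟩ := exists_norm_Gamma_mul_integral_famIntegrand_le h0 h1 hα0
  have hΓ : 0 < Real.Gamma (1 + θ * c) := Real.Gamma_pos_of_pos (by positivity)
  refine ⟨(1 + θ) ^ 2 / Real.Gamma (1 + θ * c) * (12 * C) ^ θ, by positivity,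
    fun ε hε τ hτ F G hF hG => ?_⟩
  set IF := ∫ x, ‖F x‖ ^ r with hIF
  set IG := ∫ x, ‖G x‖ ^ r with hIG
  have hIF0 : 0 ≤ IF := integral_nonneg fun x => by positivity
  have hIG0 : 0 ≤ IG := integral_nonneg fun x => by positivity
  have hτ0 : 0 < |τ| := abs_pos.2 hτ
  set Φ : ℂ → ℂ := fun z => ∫ w, famIntegrand α c ε τ F G z w with hΦ
  set Ψ : ℂ → ℂ := fun z => Complex.Gamma (1 + z * c) * Φ z / (z + 1) ^ 2 with hΨ
  have hΦ' : Φ = fun z => ∫ w, famIntegrand α c ε τ F G 0 w * Complex.exp (z * famLog α c F G w) :=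
    funext fun z => integral_congr_ae (Filter.Eventually.of_forall fun w => famIntegrand_eq z w)
  obtain ⟨b, hb1, hbc⟩ : ∃ b : ℝ, 1 < b ∧ b * c < 3 :=
    ⟨1 + β / 3, by linarith, by rw [hc]; nlinarith⟩
  have hint : ∀ s : ℝ, -1 < s → s * c < 3 →
      Integrable fun w => ‖famIntegrand α c ε τ F G 0 w‖ * Real.exp (s * famLog α c F G w) := by
    intro s hs hsc
    have := (integrable_famIntegrand (z := (s : ℂ)) (τ := τ) (c := c) hα0 hε hF hG
      (by simpa using hs) (by simpa using hsc)).norm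
    refine this.congr (Filter.Eventually.of_forall fun w => ?_)
    beta_reduce
    rw [famIntegrand_eq, norm_mul, Complex.norm_exp, Complex.re_mul_ofReal, Complex.ofReal_re]
  have hia := hint (-(1 / 2)) (by norm_num) (by linarith)
  have hib := hint b (by linarith) hbc
  have hdΦ : ∀ z : ℂ, 0 ≤ z.re → z.re ≤ 1 → DifferentiableAt ℂ Φ z := fun z hz0 hz1 => by
    rw [hΦ']
    exact differentiableAt_integral_mul_cexp
      (measurable_famIntegrand hF.meas hG.meas 0).aestronglyMeasurable
      (measurable_famLog hF.meas hG.meas) hia hib (by linarith) (by linarith)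
  have hre1 : ∀ z : ℂ, (1 + z * c).re = 1 + z.re * c := fun z => by simp
  have hone : ∀ z : ℂ, 0 ≤ z.re → 1 ≤ ‖z + 1‖ := fun z hz =>
    le_trans (by simp; linarith) (Complex.re_le_norm (z + 1))
  have hdΨ : ∀ z : ℂ, 0 ≤ z.re → z.re ≤ 1 → DifferentiableAt ℂ Ψ z := fun z hz0 hz1 => by
    have hpos : 0 < (1 + z * c).re := by rw [hre1]; positivity
    have hg : DifferentiableAt ℂ Complex.Gamma (1 + z * c) := by
      refine Complex.differentiableAt_Gamma _ fun m hm => ?_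
      have := congrArg Complex.re hm
      simp only [Complex.neg_re, Complex.natCast_re] at this
      have : (0 : ℝ) ≤ m := by positivity
      linarith
    have hg' : DifferentiableAt ℂ (fun z : ℂ => Complex.Gamma (1 + z * c)) z :=
      DifferentiableAt.comp z hg (by fun_prop)
    refine DifferentiableAt.div (hg'.mul (hdΦ z hz0 hz1)) (by fun_prop) ?_
    have := hone z hz0
    exact pow_ne_zero 2 (norm_pos_iff.1 (by linarith))
  have hDC : DiffContOnCl ℂ Ψ (Complex.HadamardThreeLines.verticalStrip 0 1) := by
    refine DifferentiableOn.diffContOnCl fun z hz => ?_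
    have hz' : z ∈ Complex.re ⁻¹' Icc (0 : ℝ) 1 := by
      refine closure_minimal ?_ (isClosed_Icc.preimage Complex.continuous_re) hz
      exact preimage_mono Ioo_subset_Icc_self
    exact (hdΨ z hz'.1 hz'.2).differentiableWithinAt
  obtain ⟨B, hB⟩ := (isCompact_Icc (a := (1 : ℝ)) (b := 1 + c)).exists_bound_of_continuousOn
    (f := Real.Gamma) (fun x hx => (Real.differentiableAt_Gamma fun m => by
      have : (0 : ℝ) ≤ m := by positivity
      have := hx.1
      linarith).continuousAt.continuousWithinAt)
  have hB0 : 0 ≤ B := (norm_nonneg _).trans (hB 1 ⟨le_rfl, by linarith⟩)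
  have hBA : BddAbove ((norm ∘ Ψ) '' Complex.HadamardThreeLines.verticalClosedStrip 0 1) := by
    refine ⟨B * ∫ w, (‖famIntegrand α c ε τ F G 0 w‖ * Real.exp (-(1 / 2) * famLog α c F G w) +
      ‖famIntegrand α c ε τ F G 0 w‖ * Real.exp (b * famLog α c F G w)), ?_⟩
    rintro _ ⟨z, hz, rfl⟩
    have hz0 : 0 ≤ z.re := hz.1
    have hz1 : z.re ≤ 1 := hz.2
    have h1 := hone z hz0
    have hΦz := norm_integral_mul_cexp_le (h := famIntegrand α c ε τ F G 0) hia hib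
      (by linarith : -(1 / 2) ≤ z.re) (by linarith)
    rw [← congrFun hΦ' z] at hΦz
    have hΓz : ‖Complex.Gamma (1 + z * c)‖ ≤ B := by
      refine (norm_Gamma_le (by rw [hre1]; positivity)).trans ?_
      rw [hre1]
      exact (le_abs_self _).trans (hB _ ⟨by simp; positivity, by nlinarith⟩)
    simp only [Function.comp, hΨ]
    rw [norm_div, norm_mul, norm_pow]
    refine (div_le_self (by positivity) (one_le_pow₀ h1)).trans ?_
    gcongr
  have hleft : ∀ z ∈ Complex.re ⁻¹' {0}, ‖Ψ z‖ ≤ IF ^ (1 / 2 : ℝ) * IG ^ (1 / 2 : ℝ) := by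
    intro z hz
    have hz : z.re = 0 := hz
    have h1 := hone z hz.ge
    have hΦz := norm_integral_famIntegrand_le_left (τ := τ) (c := c) hα0 hε hF hG hz
    rw [h2α] at hΦz
    have hΓz : ‖Complex.Gamma (1 + z * c)‖ ≤ 1 := by
      refine (norm_Gamma_le (by rw [hre1, hz]; norm_num)).trans ?_
      rw [hre1, hz]; simp
    simp only [hΨ]
    rw [norm_div, norm_mul, norm_pow]
    refine (div_le_self (by positivity) (one_le_pow₀ h1)).trans ?_
    exact (mul_le_of_le_one_left (norm_nonneg _) hΓz).trans hΦz
  have hright : ∀ z ∈ Complex.re ⁻¹' {1}, ‖Ψ z‖ ≤ 12 * C * |τ| ^ (-β) * (IF * IG) := by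
    intro z hz
    have hz : z.re = 1 := hz
    have h1 := hone z (by linarith)
    have key := H ε hε τ hτ F G hF hG z hz
    rw [h2α] at key
    have hzn : ‖z‖ ≤ ‖z + 1‖ := by
      rw [← sq_le_sq₀ (norm_nonneg _) (norm_nonneg _), Complex.sq_norm, Complex.sq_norm,
        Complex.normSq_apply, Complex.normSq_apply]
      simp; nlinarith
    have hcn : ‖(c : ℂ)‖ ≤ 3 := by
      rw [Complex.norm_real, Real.norm_of_nonneg hc0.le]; linarith
    have hn1 : ‖z * c‖ ≤ 3 * ‖z + 1‖ := by
      rw [norm_mul, mul_comm]; gcongr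
    have hn2 : ‖z * c - 1‖ ≤ 4 * ‖z + 1‖ := by
      refine (norm_sub_le _ _).trans ?_
      rw [norm_one]; linarith
    have hne : z * c ≠ 0 := by
      refine mul_ne_zero (fun h => ?_) (by exact_mod_cast hc0.ne')
      rw [h] at hz; simp at hz
    have hne1 : z * c - 1 ≠ 0 := by
      intro h
      have := congrArg Complex.re h
      simp [hz] at this
      linarith
    have hG1 : Complex.Gamma (1 + z * c) = (z * c) * ((z * c - 1) * Complex.Gamma (z * c - 1)) := by
      rw [← Complex.Gamma_add_one _ hne1, sub_add_cancel, ← Complex.Gamma_add_one _ hne, add_comm]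
    simp only [hΨ]
    rw [hG1, norm_div, norm_pow, div_le_iff₀ (by positivity)]
    calc ‖z * c * ((z * c - 1) * Complex.Gamma (z * c - 1)) * Φ z‖
        = ‖z * c‖ * ‖z * c - 1‖ * ‖Complex.Gamma (z * c - 1) * Φ z‖ := by
          simp only [norm_mul]; ring
      _ ≤ (3 * ‖z + 1‖) * (4 * ‖z + 1‖) * (C * |τ| ^ (-β) * (IF * IG)) := by gcongr
      _ = _ := by ring
  have hmem : (θ : ℂ) ∈ Complex.HadamardThreeLines.verticalClosedStrip 0 1 := by
    simp [Complex.HadamardThreeLines.verticalClosedStrip, hθ0.le, hθ1.le]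
  have hmain := Complex.HadamardThreeLines.norm_le_interp_of_mem_verticalClosedStrip₀₁' Ψ hmem hDC
    hBA hleft hright
  rw [Complex.ofReal_re] at hmain
  have hΦθ : Φ θ = ∫ ξ : E3, ((rad ξ ^ (-(c * θ)) * Real.exp (-ε * rad ξ) *
          Real.cos (τ * rad ξ) : ℝ) : ℂ) * (𝓕 F ξ * 𝓕⁻ G ξ) := by
    have hi := integrable_famIntegrand (z := (θ : ℂ)) (τ := τ) (c := c) hα0 hε hF hG
      (by simp; linarith) (by simp; nlinarith)
    simp only [hΦ]
    rw [Measure.volume_eq_prod, integral_prod _ hi]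
    refine integral_congr_ae ?_
    filter_upwards [ae_rad_pos] with ξ hξ
    rw [integral_famIntegrand_space, funext (twist_eq_self hαθ F), funext (twist_eq_self hαθ G),
      Real.rpow_def_of_pos hξ]
    have e : -((θ : ℂ) * c) * Real.log (rad ξ) = ((Real.log (rad ξ) * -(c * θ) : ℝ) : ℂ) := by
      push_cast; ring
    rw [e, ← Complex.ofReal_exp]
    push_cast
    ring
  rw [← hΦθ]
  have hΦn : ‖Φ θ‖ = (1 + θ) ^ 2 / Real.Gamma (1 + θ * c) * ‖Ψ θ‖ := by
    have e1 : (1 + (θ : ℂ) * c) = ((1 + θ * c : ℝ) : ℂ) := by push_cast; ring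
    have e2 : ((θ : ℂ) + 1) = ((1 + θ : ℝ) : ℂ) := by push_cast; ring
    simp only [hΨ]
    rw [e1, e2, Complex.Gamma_ofReal, norm_div, norm_mul, norm_pow, Complex.norm_real,
      Complex.norm_real, Real.norm_of_nonneg hΓ.le, Real.norm_of_nonneg (by positivity)]
    field_simp
  rw [hΦn, mul_assoc, mul_assoc]
  gcongr ?_ * ?_
  refine hmain.trans_eq ?_
  have hexp : (1 - θ) / 2 + θ = 1 / r := by rw [hθ]; field_simp; ring
  have hsplit : ∀ I : ℝ, 0 ≤ I → I ^ (1 / r) = I ^ ((1 - θ) / 2) * I ^ θ := by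
    intro I hI
    rw [← hexp, Real.rpow_add_of_nonneg hI (by linarith) hθ0.le]
  rw [hsplit IF hIF0, hsplit IG hIG0, Real.mul_rpow (by positivity) (by positivity),
    Real.mul_rpow (by positivity) (by positivity), Real.mul_rpow (by positivity) (by positivity),
    Real.mul_rpow (by positivity) (by positivity), Real.mul_rpow hIF0 hIG0, ← Real.rpow_mul hτ0.le, ← Real.rpow_mul hIF0,
    ← Real.rpow_mul hIG0, neg_mul, show 1 / 2 * (1 - θ) = (1 - θ) / 2 by ring]
  ring

/-- `∫₀^A x^{-κ} dx`, as a lower Lebesgue integral. -/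
lemma lintegral_Ioc_rpow_neg {κ A : ℝ} (hκ : κ < 1) (hA : 0 ≤ A) :
    ∫⁻ x in Ioc 0 A, ENNReal.ofReal (x ^ (-κ)) = ENNReal.ofReal (A ^ (1 - κ) / (1 - κ)) := by
  have hi : IntegrableOn (fun x : ℝ => x ^ (-κ)) (Ioc 0 A) := by
    rw [← intervalIntegrable_iff_integrableOn_Ioc_of_le hA]
    exact intervalIntegral.intervalIntegrable_rpow' (by linarith)
  rw [← ofReal_integral_eq_lintegral_ofReal hi, ← intervalIntegral.integral_of_le hA,
    integral_rpow (Or.inl (by linarith)), Real.zero_rpow (by linarith), sub_zero,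
    show -κ + 1 = 1 - κ by ring]
  filter_upwards [ae_restrict_mem measurableSet_Ioc] with x hx
  exact Real.rpow_nonneg hx.1.le _

lemma setLIntegral_abs_comp_rpow_neg_le {θ : ℝ} (h0 : 0 < θ) (h1 : θ < 1) {φ : ℝ → ℝ}
    (hφ : MeasurePreserving φ) (E : Set ℝ) :
    ∫⁻ s in E, ENNReal.ofReal (|φ s| ^ (-θ)) ≤
      ENNReal.ofReal (2 / (1 - θ) + 1) * volume E ^ (1 - θ) := by
  have h1' : 0 < 1 - θ := by linarith
  rcases eq_or_ne (volume E) ∞ with hE | hE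
  · rw [hE, ENNReal.top_rpow_of_pos h1', ENNReal.mul_top]
    · exact le_top
    · exact (ENNReal.ofReal_pos.2 (by positivity)).ne'
  rcases eq_or_ne (volume E) 0 with hE0 | hE0
  · rw [Measure.restrict_eq_zero.2 hE0, lintegral_zero_measure]; exact zero_le
  set R := (volume E).toReal with hR
  have hR0 : 0 < R := ENNReal.toReal_pos hE0 hE
  have hER : volume E = ENNReal.ofReal R := (ENNReal.ofReal_toReal hE).symm
  set g : ℝ → ℝ≥0∞ := (Ioc 0 R).indicator fun x => ENNReal.ofReal (x ^ (-θ)) with hg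
  have hgm : Measurable g := Measurable.indicator (by fun_prop) measurableSet_Ioc
  have hpt : ∀ x : ℝ, ENNReal.ofReal (|x| ^ (-θ)) ≤ g x + g (-x) + ENNReal.ofReal (R ^ (-θ)) := by
    intro x
    rcases eq_or_ne x 0 with rfl | hx
    · rw [abs_zero, Real.zero_rpow (by linarith), ENNReal.ofReal_zero]; exact zero_le
    rcases le_or_gt |x| R with hxR | hxR
    · rcases lt_or_gt_of_ne hx with hx | hx
      · have : -x ∈ Ioc 0 R := ⟨by linarith, by rwa [abs_of_neg hx] at hxR⟩
        rw [hg, indicator_of_mem this, abs_of_neg hx]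
        exact le_add_right le_add_self
      · have : x ∈ Ioc 0 R := ⟨hx, by rwa [abs_of_pos hx] at hxR⟩
        rw [hg, indicator_of_mem this, abs_of_pos hx]
        exact le_add_right le_self_add
    · refine le_add_left (ENNReal.ofReal_le_ofReal ?_)
      exact Real.rpow_le_rpow_of_nonpos hR0 hxR.le (by linarith)
  have hgi : ∫⁻ x, g x = ENNReal.ofReal (R ^ (1 - θ) / (1 - θ)) := by
    rw [hg, lintegral_indicator measurableSet_Ioc, lintegral_Ioc_rpow_neg h1 hR0.le]
  have hgn : ∫⁻ x, g (-x) = ∫⁻ x, g x := lintegral_neg_eq_self g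
  calc ∫⁻ s in E, ENNReal.ofReal (|φ s| ^ (-θ))
      ≤ ∫⁻ s in E, (g (φ s) + g (-φ s) + ENNReal.ofReal (R ^ (-θ))) :=
        lintegral_mono fun s => hpt (φ s)
    _ = (∫⁻ s in E, (g (φ s) + g (-φ s))) + ENNReal.ofReal (R ^ (-θ)) * volume E := by
        rw [lintegral_add_right _ measurable_const, setLIntegral_const]
    _ ≤ (∫⁻ s, (g (φ s) + g (-φ s))) + ENNReal.ofReal (R ^ (-θ)) * volume E := by
        gcongr; exact Measure.restrict_le_self
    _ = (∫⁻ x, (g x + g (-x))) + ENNReal.ofReal (R ^ (-θ)) * volume E := by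
        rw [hφ.lintegral_comp (f := fun x => g x + g (-x)) (by fun_prop)]
    _ = ENNReal.ofReal (2 / (1 - θ) + 1) * volume E ^ (1 - θ) := by
        rw [lintegral_add_left hgm, hgn, hgi, hER, ENNReal.ofReal_rpow_of_pos hR0,
          ← ENNReal.ofReal_mul (by positivity), ← ENNReal.ofReal_mul (by positivity),
          ← ENNReal.ofReal_add (by positivity) (by positivity),
          ← ENNReal.ofReal_add (by positivity) (by positivity)]
        congr 1
        have : R ^ (-θ) * R = R ^ (1 - θ) := by
          nth_rw 2 [← Real.rpow_one R]
          rw [← Real.rpow_add hR0]; congr 1; ring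
        rw [this]; ring

/-- Hardy–Littlewood–Sobolev inequality on the diagonal, for symmetric kernels of weak type. -/
lemma lintegral_lintegral_mul_kernel_le {θ ρ : ℝ} (h0 : 0 < θ) (h1 : θ < 1)
    (hρ : ρ * (2 - θ) = 2) {k : ℝ → ℝ → ℝ≥0∞} (hk : Measurable (Function.uncurry k))
    (hsymm : ∀ t s, k t s = k s t) {C : ℝ≥0∞}
    (hC : ∀ t, ∀ E : Set ℝ, ∫⁻ s in E, k t s ≤ C * volume E ^ (1 - θ))
    {a : ℝ → ℝ} (ha : Measurable a) (ha0 : ∀ t, 0 ≤ a t) :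
    ∫⁻ t, ∫⁻ s, ENNReal.ofReal (a t) * ENNReal.ofReal (a s) * k t s ≤
      2 * C * ENNReal.ofReal (1 / (ρ - 1)) * (∫⁻ t, ENNReal.ofReal (a t ^ ρ)) ^ (2 / ρ) := by
  have hρ1 : 1 < ρ := by nlinarith
  have hρκ : ρ * (1 - θ) = 2 - ρ := by linarith
  have hρ2 : 2 / ρ = (1 - θ) + 1 := by field_simp; linarith
  have h1' : 0 < 1 - θ := by linarith
  set I := ∫⁻ t, ENNReal.ofReal (a t ^ ρ) with hI
  have hcheb : ∀ l : ℝ, 0 < l → volume {s | l < a s} ≤ ENNReal.ofReal (l ^ (-ρ)) * I := by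
    intro l hl
    have hlρ : 0 < l ^ ρ := by positivity
    have key := meas_ge_le_lintegral_div (μ := volume) (f := fun t => ENNReal.ofReal (a t ^ ρ))
      (by fun_prop) (ENNReal.ofReal_pos.2 hlρ).ne' ENNReal.ofReal_ne_top
    rw [ENNReal.div_eq_inv_mul, ← ENNReal.ofReal_inv_of_pos hlρ, ← Real.rpow_neg hl.le] at key
    refine (measure_mono fun s hs => ?_).trans key
    exact ENNReal.ofReal_le_ofReal (Real.rpow_le_rpow hl.le (le_of_lt hs) (by linarith))
  have hinner : ∀ t, ∫⁻ s in {s | a s ≤ a t}, ENNReal.ofReal (a s) * k t s ≤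
      C * I ^ (1 - θ) * ENNReal.ofReal (a t ^ (ρ - 1) / (ρ - 1)) := by
    intro t
    have hkt : Measurable (k t) := hk.comp measurable_prodMk_left
    have hms : MeasurableSet {s | a s ≤ a t} := measurableSet_le ha measurable_const
    set ν := (volume.restrict {s | a s ≤ a t}).withDensity (k t) with hν
    have e1 : ∫⁻ s in {s | a s ≤ a t}, ENNReal.ofReal (a s) * k t s =
        ∫⁻ s, ENNReal.ofReal (a s) ∂ν := by
      rw [hν, lintegral_withDensity_eq_lintegral_mul _ hkt (by fun_prop)]
      simp only [Pi.mul_apply, mul_comm]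
    rw [e1, lintegral_eq_lintegral_meas_lt ν (Filter.Eventually.of_forall ha0) ha.aemeasurable]
    have hνl : ∀ l : ℝ, ν {s | l < a s} = ∫⁻ s in {s | l < a s} ∩ {s | a s ≤ a t}, k t s := by
      intro l
      have hml : MeasurableSet {s | l < a s} := measurableSet_lt measurable_const ha
      rw [hν, withDensity_apply _ hml, Measure.restrict_restrict hml]
    calc ∫⁻ l in Ioi 0, ν {s | l < a s}
        ≤ ∫⁻ l in Ioi 0, (Ioc 0 (a t)).indicator
            (fun l => C * I ^ (1 - θ) * ENNReal.ofReal (l ^ (-(2 - ρ)))) l := by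
          refine setLIntegral_mono' measurableSet_Ioi fun l hl => ?_
          have hl : 0 < l := hl
          rw [hνl]
          by_cases hlt : l ≤ a t
          · rw [indicator_of_mem (show l ∈ Ioc 0 (a t) from ⟨hl, hlt⟩)]
            refine (hC t _).trans ?_
            rw [mul_assoc]
            gcongr
            calc volume ({s | l < a s} ∩ {s | a s ≤ a t}) ^ (1 - θ)
                ≤ (ENNReal.ofReal (l ^ (-ρ)) * I) ^ (1 - θ) := by
                  gcongr; exact (measure_mono inter_subset_left).trans (hcheb l hl)
              _ = I ^ (1 - θ) * ENNReal.ofReal (l ^ (-(2 - ρ))) := by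
                  rw [ENNReal.mul_rpow_of_nonneg _ _ h1'.le,
                    ENNReal.ofReal_rpow_of_pos (by positivity), ← Real.rpow_mul hl.le, mul_comm,
                    neg_mul, hρκ]
          · have : {s | l < a s} ∩ {s | a s ≤ a t} = ∅ :=
              eq_empty_of_forall_notMem fun s hs => hlt (hs.1.le.trans hs.2)
            rw [this]; simp
      _ = ∫⁻ l in Ioc 0 (a t), C * I ^ (1 - θ) * ENNReal.ofReal (l ^ (-(2 - ρ))) := by
          rw [setLIntegral_indicator measurableSet_Ioc,
            inter_eq_left.2 Ioc_subset_Ioi_self]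
      _ = C * I ^ (1 - θ) * ENNReal.ofReal (a t ^ (ρ - 1) / (ρ - 1)) := by
          rw [lintegral_const_mul _ (by fun_prop), lintegral_Ioc_rpow_neg (by linarith) (ha0 t),
            show 1 - (2 - ρ) = ρ - 1 by ring]
  have hpt : ∀ t s, ENNReal.ofReal (a t) * ENNReal.ofReal (a s) * k t s ≤
      {s | a s ≤ a t}.indicator (fun s => ENNReal.ofReal (a t) * (ENNReal.ofReal (a s) * k t s)) s +
      {t | a t ≤ a s}.indicator
        (fun t => ENNReal.ofReal (a s) * (ENNReal.ofReal (a t) * k s t)) t := by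
    intro t s
    rcases le_total (a s) (a t) with h | h
    · rw [indicator_of_mem (show s ∈ {s | a s ≤ a t} from h), mul_assoc]
      exact le_self_add
    · rw [indicator_of_mem (show t ∈ {t | a t ≤ a s} from h), hsymm s t, mul_comm (ENNReal.ofReal _),
        mul_assoc]
      exact le_add_self
  set K : ℝ → ℝ → ℝ≥0∞ := fun t s =>
    {s | a s ≤ a t}.indicator (fun s => ENNReal.ofReal (a t) * (ENNReal.ofReal (a s) * k t s)) s
    with hK
  have hKm : Measurable (Function.uncurry K) := by
    have : Function.uncurry K = {w : ℝ × ℝ | a w.2 ≤ a w.1}.indicator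
        (fun w => ENNReal.ofReal (a w.1) * (ENNReal.ofReal (a w.2) * Function.uncurry k w)) := by
      ext ⟨t, s⟩; rfl
    rw [this]
    exact Measurable.indicator (by fun_prop)
      (measurableSet_le (ha.comp measurable_snd) (ha.comp measurable_fst))
  have hKi : ∫⁻ t, ∫⁻ s, K t s ≤ C * ENNReal.ofReal (1 / (ρ - 1)) * I ^ (2 / ρ) := by
    calc ∫⁻ t, ∫⁻ s, K t s
        = ∫⁻ t, ENNReal.ofReal (a t) *
            ∫⁻ s in {s | a s ≤ a t}, ENNReal.ofReal (a s) * k t s := by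
          refine lintegral_congr fun t => ?_
          have hms : MeasurableSet {s | a s ≤ a t} := measurableSet_le ha measurable_const
          simp only [hK]
          have hkt : Measurable (k t) := hk.comp measurable_prodMk_left
          rw [lintegral_indicator hms, lintegral_const_mul _ (by fun_prop)]
      _ ≤ ∫⁻ t, ENNReal.ofReal (a t) *
            (C * I ^ (1 - θ) * ENNReal.ofReal (a t ^ (ρ - 1) / (ρ - 1))) := by
          gcongr with t; exact hinner t
      _ = ∫⁻ t, C * I ^ (1 - θ) * ENNReal.ofReal (1 / (ρ - 1)) * ENNReal.ofReal (a t ^ ρ) := by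
          refine lintegral_congr fun t => ?_
          have : a t ^ ρ = a t * a t ^ (ρ - 1) := by
            rcases (ha0 t).eq_or_lt with h | h
            · rw [← h, Real.zero_rpow (by linarith), zero_mul]
            · nth_rw 2 [← Real.rpow_one (a t)]
              rw [← Real.rpow_add h]; congr 1; ring
          have h2 : 0 ≤ a t ^ (ρ - 1) := Real.rpow_nonneg (ha0 t) _
          have h3 : 0 ≤ 1 / (ρ - 1) := by rw [one_div_nonneg]; linarith
          rw [this, ENNReal.ofReal_mul (ha0 t), div_eq_mul_one_div, ENNReal.ofReal_mul h2]
          ring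
      _ = C * ENNReal.ofReal (1 / (ρ - 1)) * I ^ (2 / ρ) := by
          rw [lintegral_const_mul _ (by fun_prop), ← hI, hρ2,
            ENNReal.rpow_add_of_nonneg _ _ h1'.le zero_le_one, ENNReal.rpow_one]
          ring
  calc ∫⁻ t, ∫⁻ s, ENNReal.ofReal (a t) * ENNReal.ofReal (a s) * k t s
      ≤ ∫⁻ t, ∫⁻ s, (K t s + K s t) := by
        gcongr with t s; exact hpt t s
    _ = (∫⁻ t, ∫⁻ s, K t s) + ∫⁻ t, ∫⁻ s, K s t := by
        have h1 : ∀ t, ∫⁻ s, (K t s + K s t) = (∫⁻ s, K t s) + ∫⁻ s, K s t := fun t =>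
          lintegral_add_left (f := K t) (hKm.comp measurable_prodMk_left) _
        simp_rw [h1]
        exact lintegral_add_left (hKm.lintegral_prod_right) _
    _ = 2 * ∫⁻ t, ∫⁻ s, K t s := by
        rw [lintegral_lintegral_swap (f := fun t s => K s t)
          (hKm.comp measurable_swap).aemeasurable, two_mul]
    _ ≤ 2 * (C * ENNReal.ofReal (1 / (ρ - 1)) * I ^ (2 / ρ)) := by gcongr
    _ = _ := by ring

/-- Functions on the line satisfying the product-to-sum formula of `cos` or `sin`. -/
structure TrigLike (κ : ℝ → ℝ) : Prop where
  cont : Continuous κ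
  bdd : ∀ a, |κ a| ≤ 1
  mul : ∃ η : ℝ, |η| ≤ 1 ∧ ∀ a b, κ a * κ b = (Real.cos (a - b) + η * Real.cos (a + b)) / 2

lemma trigLike_cos : TrigLike Real.cos :=
  ⟨Real.continuous_cos, Real.abs_cos_le_one, 1, by simp, fun a b => by
    rw [Real.cos_sub, Real.cos_add]; ring⟩

lemma trigLike_sin : TrigLike Real.sin :=
  ⟨Real.continuous_sin, Real.abs_sin_le_one, -1, by simp, fun a b => by
    rw [Real.cos_sub, Real.cos_add]; ring⟩

lemma norm_fourier_le {f : E3 → ℂ} (ξ : E3) : ‖𝓕 f ξ‖ ≤ ∫ x, ‖f x‖ :=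
  VectorFourier.norm_fourierIntegral_le_integral_norm _ _ _ _ _

lemma norm_fourierInv_le {f : E3 → ℂ} (ξ : E3) : ‖𝓕⁻ f ξ‖ ≤ ∫ x, ‖f x‖ := by
  rw [Real.fourierInv_eq_fourier_neg]; exact norm_fourier_le _

lemma integrable_weight_mul {c ε : ℝ} (hc : c < 3) (hε : 0 < ε) {m : E3 → ℝ} (hm : Continuous m)
    (hm1 : ∀ ξ, |m ξ| ≤ 1) {F G : E3 → ℂ} (hF : Integrable F) (hG : Integrable G) :
    Integrable fun ξ : E3 => ((rad ξ ^ (-c) * Real.exp (-ε * rad ξ) * m ξ : ℝ) : ℂ) *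
      (𝓕 F ξ * 𝓕⁻ G ξ) := by
  have hmr := measurable_rad
  have h1 := (continuous_fourier hF).measurable
  have h2 := (continuous_fourierInv hG).measurable
  have h3 := hm.measurable
  refine ((integrable_rad_rpow_mul_exp (r := -c) (by linarith) hε).mul_const
    ((∫ x, ‖F x‖) * ∫ x, ‖G x‖)).mono' (by fun_prop) (Filter.Eventually.of_forall fun ξ => ?_)
  have : 0 ≤ rad ξ ^ (-c) := Real.rpow_nonneg (rad_nonneg ξ) _
  rw [norm_mul, norm_mul, Complex.norm_real, norm_mul, Real.norm_of_nonneg (by positivity)]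
  refine mul_le_mul (mul_le_of_le_one_right (by positivity) (hm1 ξ)) ?_ (by positivity)
    (by positivity)
  gcongr
  exacts [norm_fourier_le ξ, norm_fourierInv_le ξ]

lemma exists_norm_integral_fourier_mul_trigLike_le {β r : ℝ} (h0 : 0 < β) (h1 : β ≤ 1)
    (hr1 : 1 < r) (hr2 : r < 2) :
    ∃ C : ℝ, 0 ≤ C ∧ ∀ κ : ℝ → ℝ, TrigLike κ → ∀ ε : ℝ, 0 < ε → ∀ t s : ℝ, t - s ≠ 0 →
      t + s ≠ 0 → ∀ F G : E3 → ℂ, BddFinSupp F → BddFinSupp G →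
      ‖∫ ξ : E3, ((rad ξ ^ (-((3 - β) * (2 / r - 1))) * Real.exp (-ε * rad ξ) *
          (κ (t * rad ξ) * κ (s * rad ξ)) : ℝ) : ℂ) * (𝓕 F ξ * 𝓕⁻ G ξ)‖ ≤
        C * (|t - s| ^ (-(β * (2 / r - 1))) + |t + s| ^ (-(β * (2 / r - 1)))) *
          ((∫ x, ‖F x‖ ^ r) ^ (1 / r) * (∫ x, ‖G x‖ ^ r) ^ (1 / r)) := by
  obtain ⟨C, hC, H⟩ := exists_norm_integral_fourier_mul_le h0 h1 hr1 hr2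
  refine ⟨C, hC, fun κ hκ ε hε t s hts hts' F G hF hG => ?_⟩
  obtain ⟨η, hη, hmul⟩ := hκ.mul
  have hr0 : 0 < r := by linarith
  have hθ1 : 2 / r - 1 < 1 := by rw [sub_lt_iff_lt_add, div_lt_iff₀ hr0]; linarith
  have hθ0 : 0 < 2 / r - 1 := by rw [sub_pos, lt_div_iff₀ hr0]; linarith
  have hc : (3 - β) * (2 / r - 1) < 3 := by nlinarith
  have hcr := continuous_rad
  have hI : ∀ τ : ℝ, Integrable fun ξ : E3 => ((rad ξ ^ (-((3 - β) * (2 / r - 1))) *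
      Real.exp (-ε * rad ξ) * Real.cos (τ * rad ξ) : ℝ) : ℂ) * (𝓕 F ξ * 𝓕⁻ G ξ) := fun τ =>
    integrable_weight_mul hc hε (by fun_prop) (fun ξ => Real.abs_cos_le_one _)
      hF.integrable hG.integrable
  have e : ∀ ξ : E3, ((rad ξ ^ (-((3 - β) * (2 / r - 1))) * Real.exp (-ε * rad ξ) *
          (κ (t * rad ξ) * κ (s * rad ξ)) : ℝ) : ℂ) * (𝓕 F ξ * 𝓕⁻ G ξ) =
      (1 / 2 : ℂ) * (((rad ξ ^ (-((3 - β) * (2 / r - 1))) *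
      Real.exp (-ε * rad ξ) * Real.cos ((t - s) * rad ξ) : ℝ) : ℂ) * (𝓕 F ξ * 𝓕⁻ G ξ)) +
      (η / 2 : ℂ) * (((rad ξ ^ (-((3 - β) * (2 / r - 1))) *
      Real.exp (-ε * rad ξ) * Real.cos ((t + s) * rad ξ) : ℝ) : ℂ) * (𝓕 F ξ * 𝓕⁻ G ξ)) := by
    intro ξ
    rw [hmul, sub_mul, add_mul]
    push_cast; ring_nf
  simp_rw [e]
  rw [integral_add ((hI _).const_mul _) ((hI _).const_mul _), integral_const_mul,
    integral_const_mul]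
  have k1 := H ε hε (t - s) hts F G hF hG
  have k2 := H ε hε (t + s) hts' F G hF hG
  have n1 : ‖(1 / 2 : ℂ)‖ ≤ 1 := by norm_num
  have n2 : ‖(η / 2 : ℂ)‖ ≤ 1 := by
    rw [norm_div, Complex.norm_real, Real.norm_eq_abs]; norm_num; linarith
  refine (norm_add_le _ _).trans ?_
  rw [norm_mul, norm_mul, mul_add, add_mul]
  exact add_le_add ((mul_le_of_le_one_left (norm_nonneg _) n1).trans k1)
    ((mul_le_of_le_one_left (norm_nonneg _) n2).trans k2)

/-- Bounded measurable functions on spacetime with bounded support. -/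
structure TestFun (F : ℝ → E3 → ℂ) : Prop where
  meas : Measurable (Function.uncurry F)
  bdd : ∃ M, ∀ t x, ‖F t x‖ ≤ M
  supp : ∃ R, ∀ t x, F t x ≠ 0 → |t| ≤ R ∧ ‖x‖ ≤ R

namespace TestFun

variable {F : ℝ → E3 → ℂ}

lemma bddFinSupp (hF : TestFun F) (t : ℝ) : BddFinSupp (F t) := by
  obtain ⟨M, hM⟩ := hF.bdd
  obtain ⟨R, hR⟩ := hF.supp
  refine ⟨hF.meas.comp measurable_prodMk_left, ⟨M, hM t⟩, ?_⟩
  refine (measure_mono fun x hx => ?_).trans_lt (measure_closedBall_lt_top (x := (0 : E3)) (r := R))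
  simpa using (hR t x hx).2

lemma integrable (hF : TestFun F) : Integrable (Function.uncurry F) := by
  obtain ⟨M, hM⟩ := hF.bdd
  obtain ⟨R, hR⟩ := hF.supp
  rw [← integrableOn_iff_integrable_of_support_subset (s := Icc (-R) R ×ˢ closedBall (0 : E3) R)]
  · refine Measure.integrableOn_of_bounded (M := M) ?_ hF.meas.aestronglyMeasurable
      (Filter.Eventually.of_forall fun w => hM w.1 w.2)
    rw [Measure.volume_eq_prod, Measure.prod_prod]
    exact ENNReal.mul_ne_top measure_Icc_lt_top.ne measure_closedBall_lt_top.ne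
  · rintro ⟨t, x⟩ hw
    have := hR t x hw
    exact ⟨abs_le.1 this.1, by simpa using this.2⟩

lemma integrable_norm (hF : TestFun F) : Integrable fun t => ∫ x, ‖F t x‖ :=
  hF.integrable.norm.integral_prod_left

lemma measurable_fourierInv (hF : TestFun F) :
    Measurable fun w : ℝ × E3 => 𝓕⁻ (F w.1) w.2 := by
  have hm := hF.meas
  have : (fun w : ℝ × E3 => 𝓕⁻ (F w.1) w.2) = fun w => ∫ x,
      Complex.exp ((2 * Real.pi * ⟪x, w.2⟫ : ℝ) * Complex.I) * Function.uncurry F (w.1, x) := by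
    ext w; rw [Real.fourierInv_eq']; rfl
  rw [this]
  refine (StronglyMeasurable.integral_prod_right (f := fun (w : ℝ × E3) (x : E3) =>
    Complex.exp ((2 * Real.pi * ⟪x, w.2⟫ : ℝ) * Complex.I) * Function.uncurry F (w.1, x))
    (Measurable.stronglyMeasurable ?_)).measurable
  unfold Function.uncurry at *
  fun_prop

lemma measurable_integral_norm_rpow (hF : TestFun F) (r : ℝ) :
    Measurable fun t => ∫ x, ‖F t x‖ ^ r := by
  have hm := hF.meas
  refine (StronglyMeasurable.integral_prod_right (f := fun (t : ℝ) (x : E3) => ‖F t x‖ ^ r)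
    (Measurable.stronglyMeasurable ?_)).measurable
  exact (hm.norm.pow_const r)

end TestFun

lemma conj_fourierInv (f : E3 → ℂ) (ξ : E3) :
    (starRingEnd ℂ) (𝓕⁻ f ξ) = 𝓕 (fun x => (starRingEnd ℂ) (f x)) ξ := by
  rw [Real.fourierInv_eq', Real.fourier_eq', ← integral_conj]
  refine integral_congr_ae (Filter.Eventually.of_forall fun x => ?_)
  simp only [smul_eq_mul, map_mul, ← Complex.exp_conj, Complex.conj_I, Complex.conj_ofReal]
  congr 2
  push_cast
  simp only [neg_mul, mul_neg]

lemma BddFinSupp.conj {F : E3 → ℂ} (hF : BddFinSupp F) :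
    BddFinSupp fun x => (starRingEnd ℂ) (F x) := by
  refine ⟨Complex.continuous_conj.measurable.comp hF.meas, ?_, ?_⟩
  · simpa using hF.bdd
  · simpa [Function.support] using hF.supp

/-- The adjoint of the (trigonometric) propagator. -/
def adj (κ : ℝ → ℝ) (F : ℝ → E3 → ℂ) (ξ : E3) : ℂ :=
  ∫ t, (κ (t * rad ξ) : ℂ) * 𝓕⁻ (F t) ξ

/-- The `TT*` bound, with an exponential regularisation. -/
lemma exists_lintegral_adj_sq_le {β r ρ : ℝ} (h0 : 0 < β) (h1 : β ≤ 1)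
    (hr1 : 1 < r) (hr2 : r < 2) (hρ : ρ * (2 - β * (2 / r - 1)) = 2) :
    ∃ C : ℝ≥0, ∀ κ : ℝ → ℝ, TrigLike κ → ∀ ε : ℝ, 0 < ε → ∀ F : ℝ → E3 → ℂ, TestFun F →
      ∫⁻ ξ, ENNReal.ofReal (rad ξ ^ (-((3 - β) * (2 / r - 1))) * Real.exp (-ε * rad ξ) *
          ‖adj κ F ξ‖ ^ 2) ≤
        C * (∫⁻ t, ENNReal.ofReal (((∫ x, ‖F t x‖ ^ r) ^ (1 / r)) ^ ρ)) ^ (2 / ρ) := by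
  obtain ⟨C₀, hC₀, H₀⟩ := exists_norm_integral_fourier_mul_trigLike_le h0 h1 hr1 hr2
  have hr0 : 0 < r := by linarith
  have hθ1 : 2 / r - 1 < 1 := by rw [sub_lt_iff_lt_add, div_lt_iff₀ hr0]; linarith
  have hθ0 : 0 < 2 / r - 1 := by rw [sub_pos, lt_div_iff₀ hr0]; linarith
  have hc : (3 - β) * (2 / r - 1) < 3 := by nlinarith
  set δ := β * (2 / r - 1) with hδ
  set c := (3 - β) * (2 / r - 1) with hcdef
  have hδ0 : 0 < δ := by positivity
  have hδ1 : δ < 1 := by nlinarith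
  set k : ℝ → ℝ → ℝ≥0∞ := fun t s =>
    ENNReal.ofReal (|t - s| ^ (-δ)) + ENNReal.ofReal (|t + s| ^ (-δ)) with hk
  have hkm : Measurable (Function.uncurry k) := by
    simp only [hk, Function.uncurry_def]; fun_prop
  have hks : ∀ t s, k t s = k s t := fun t s => by
    simp only [hk]; rw [abs_sub_comm, add_comm t s]
  set D : ℝ≥0 := Real.toNNReal (2 / (1 - δ) + 1) with hD
  have hkC : ∀ t, ∀ E : Set ℝ, ∫⁻ s in E, k t s ≤ ((2 * D : ℝ≥0) : ℝ≥0∞) * volume E ^ (1 - δ) := by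
    intro t E
    simp only [hk]
    rw [lintegral_add_left (by fun_prop)]
    refine (add_le_add
      (setLIntegral_abs_comp_rpow_neg_le hδ0 hδ1 (volume.measurePreserving_sub_left t) E)
      (setLIntegral_abs_comp_rpow_neg_le hδ0 hδ1 (measurePreserving_add_left volume t) E)).trans ?_
    rw [← two_mul, ← mul_assoc]
    exact le_of_eq rfl
  refine ⟨Real.toNNReal C₀ * (2 * (2 * D) * Real.toNNReal (1 / (ρ - 1))),
    fun κ hκ ε hε F hF => ?_⟩
  set a : ℝ → ℝ := fun t => (∫ x, ‖F t x‖ ^ r) ^ (1 / r) with ha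
  have ha0 : ∀ t, 0 ≤ a t := fun t => by positivity
  have ham : Measurable a := (hF.measurable_integral_norm_rpow r).pow_const _
  have hls := lintegral_lintegral_mul_kernel_le hδ0 hδ1 hρ hkm hks hkC ham ha0
  set w : E3 → ℝ := fun ξ => rad ξ ^ (-c) * Real.exp (-ε * rad ξ) with hw
  have hw0 : ∀ ξ, 0 ≤ w ξ := fun ξ =>
    mul_nonneg (Real.rpow_nonneg (rad_nonneg ξ) _) (Real.exp_pos _).le
  set H : E3 → ℝ × ℝ → ℂ := fun ξ z => ((w ξ * (κ (z.1 * rad ξ) * κ (z.2 * rad ξ)) : ℝ) : ℂ) *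
    ((starRingEnd ℂ) (𝓕⁻ (F z.2) ξ) * 𝓕⁻ (F z.1) ξ) with hH
  have hHm : Measurable (Function.uncurry H) := by
    obtain ⟨φ, hφ⟩ : ∃ φ : ℝ × E3 → ℂ, φ = fun w => 𝓕⁻ (F w.1) w.2 := ⟨_, rfl⟩
    have h1 : Measurable φ := hφ ▸ hF.measurable_fourierInv
    have h3 := hκ.cont.measurable
    have h4 := measurable_rad
    have e : Function.uncurry H = fun p : E3 × ℝ × ℝ =>
        ((w p.1 * (κ (p.2.1 * rad p.1) * κ (p.2.2 * rad p.1)) : ℝ) : ℂ) *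
          ((starRingEnd ℂ) (φ (p.2.2, p.1)) * φ (p.2.1, p.1)) := by
      simp only [hH, hφ]; rfl
    have h5 : Measurable fun p : E3 × ℝ × ℝ => (starRingEnd ℂ) (φ (p.2.2, p.1)) :=
      Complex.continuous_conj.measurable.comp (by fun_prop)
    rw [e]
    simp only [hw]
    fun_prop
  have hHi : Integrable (Function.uncurry H) := by
    have i1 := integrable_rad_rpow_mul_exp (r := -c) (by linarith) hε
    have i2 := hF.integrable_norm.mul_prod hF.integrable_norm
    refine (i1.mul_prod i2).mono' hHm.aestronglyMeasurable
      (Filter.Eventually.of_forall fun z => ?_)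
    simp only [hH, Function.uncurry_def]
    rw [norm_mul, Complex.norm_real, norm_mul, Real.norm_of_nonneg (hw0 _), norm_mul, norm_mul]
    refine mul_le_mul (mul_le_of_le_one_right (hw0 _) ?_) ?_ (by positivity) (hw0 _)
    · exact mul_le_one₀ (hκ.bdd _) (norm_nonneg _) (hκ.bdd _)
    · rw [mul_comm]
      rw [RCLike.norm_conj]
      exact mul_le_mul (norm_fourierInv_le _) (norm_fourierInv_le _) (norm_nonneg _) (by positivity)
  have hHadj : ∀ ξ, ∫ z, H ξ z = ((w ξ * ‖adj κ F ξ‖ ^ 2 : ℝ) : ℂ) := by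
    intro ξ
    have : ∀ z : ℝ × ℝ, H ξ z = (w ξ : ℂ) * (((κ (z.1 * rad ξ) : ℂ) * 𝓕⁻ (F z.1) ξ) *
        (starRingEnd ℂ) ((κ (z.2 * rad ξ) : ℂ) * 𝓕⁻ (F z.2) ξ)) := by
      intro z
      simp only [hH]
      rw [map_mul, Complex.conj_ofReal]
      push_cast; ring
    simp_rw [this]
    rw [integral_const_mul, Measure.volume_eq_prod, integral_prod_mul
      (fun t => (κ (t * rad ξ) : ℂ) * 𝓕⁻ (F t) ξ)
      (fun t => (starRingEnd ℂ) ((κ (t * rad ξ) : ℂ) * 𝓕⁻ (F t) ξ)), integral_conj]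
    change (w ξ : ℂ) * (adj κ F ξ * (starRingEnd ℂ) (adj κ F ξ)) = _
    rw [Complex.mul_conj, Complex.normSq_eq_norm_sq]
    push_cast; ring
  have hn : ∀ ξ, ‖∫ z, H ξ z‖ = w ξ * ‖adj κ F ξ‖ ^ 2 := fun ξ => by
    rw [hHadj, Complex.norm_real, Real.norm_of_nonneg (mul_nonneg (hw0 ξ) (by positivity))]
  have hint : Integrable fun ξ => w ξ * ‖adj κ F ξ‖ ^ 2 :=
    (hHi.integral_prod_left.norm).congr (Filter.Eventually.of_forall hn)
  have e1 : ∫⁻ ξ, ENNReal.ofReal (w ξ * ‖adj κ F ξ‖ ^ 2) = ‖∫ ξ, ∫ z, H ξ z‖ₑ := by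
    rw [← ofReal_integral_eq_lintegral_ofReal hint (Filter.Eventually.of_forall fun ξ =>
      mul_nonneg (hw0 ξ) (by positivity))]
    simp_rw [hHadj]
    rw [integral_complex_ofReal, ← ofReal_norm, Complex.norm_real, Real.norm_of_nonneg]
    exact integral_nonneg fun ξ => mul_nonneg (hw0 ξ) (by positivity)
  have e2 : ∫ ξ, ∫ z, H ξ z = ∫ t, ∫ s, ∫ ξ, H ξ (t, s) := by
    rw [integral_integral_swap hHi]
    exact integral_prod _ hHi.integral_prod_right
  have hpt : ∀ t s : ℝ, t - s ≠ 0 → t + s ≠ 0 → ‖∫ ξ, H ξ (t, s)‖ₑ ≤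
      Real.toNNReal C₀ * (ENNReal.ofReal (a t) * ENNReal.ofReal (a s) * k t s) := by
    intro t s hts hts'
    have key := H₀ κ hκ ε hε t s hts hts' _ _ (hF.bddFinSupp s).conj (hF.bddFinSupp t)
    simp_rw [← conj_fourierInv] at key
    rw [← ofReal_norm]
    refine (ENNReal.ofReal_le_ofReal key).trans_eq ?_
    have hnn : ∀ y : ℝ, 0 ≤ |y| ^ (-δ) := fun y => by positivity
    have e : (∫ x, ‖(starRingEnd ℂ) (F s x)‖ ^ r) ^ (1 / r) = a s := by simp [ha]
    rw [e, ENNReal.ofReal_mul (mul_nonneg hC₀ (add_nonneg (hnn _) (hnn _))),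
      ENNReal.ofReal_mul hC₀, ENNReal.ofReal_add (hnn _) (hnn _), ENNReal.ofReal_mul (ha0 s)]
    simp only [hk]
    change ENNReal.ofReal C₀ * _ * (_ * ENNReal.ofReal (a t)) = ENNReal.ofReal C₀ * _
    ring
  change ∫⁻ ξ, ENNReal.ofReal (w ξ * ‖adj κ F ξ‖ ^ 2) ≤ _
  rw [e1, e2]
  calc ‖∫ t, ∫ s, ∫ ξ, H ξ (t, s)‖ₑ
      ≤ ∫⁻ t, ‖∫ s, ∫ ξ, H ξ (t, s)‖ₑ := enorm_integral_le_lintegral_enorm _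
    _ ≤ ∫⁻ t, ∫⁻ s, ‖∫ ξ, H ξ (t, s)‖ₑ :=
        lintegral_mono fun t => enorm_integral_le_lintegral_enorm _
    _ ≤ ∫⁻ t, ∫⁻ s, Real.toNNReal C₀ * (ENNReal.ofReal (a t) * ENNReal.ofReal (a s) * k t s) := by
        refine lintegral_mono fun t => lintegral_mono_ae ?_
        have n1 : ∀ᵐ s : ℝ, s ≠ t := by simp [ae_iff]
        have n2 : ∀ᵐ s : ℝ, s ≠ -t := by simp [ae_iff]
        filter_upwards [n1, n2] with s hs1 hs2
        exact hpt t s (sub_ne_zero.2 hs1.symm) fun h => hs2 (by linarith)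
    _ = Real.toNNReal C₀ * ∫⁻ t, ∫⁻ s, ENNReal.ofReal (a t) * ENNReal.ofReal (a s) * k t s := by
        simp_rw [lintegral_const_mul' _ _ ENNReal.coe_ne_top]
    _ ≤ Real.toNNReal C₀ * (2 * ((2 * D : ℝ≥0) : ℝ≥0∞) * ENNReal.ofReal (1 / (ρ - 1)) *
          (∫⁻ t, ENNReal.ofReal (a t ^ ρ)) ^ (2 / ρ)) := by gcongr
    _ = _ := by
        simp only [ENNReal.ofReal, ENNReal.coe_mul, ENNReal.coe_ofNat]
        ring

/-- The trigonometric propagator applied to a function given on the frequency side. -/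
def trigProp (κ : ℝ → ℝ) (h : E3 → ℂ) (t : ℝ) : E3 → ℂ :=
  𝓕⁻ fun ξ => (κ (t * rad ξ) : ℂ) * h ξ

lemma measurable_adj {κ : ℝ → ℝ} (hκ : TrigLike κ) {F : ℝ → E3 → ℂ} (hF : TestFun F) :
    Measurable (adj κ F) := by
  obtain ⟨φ, hφ⟩ : ∃ φ : ℝ × E3 → ℂ, φ = fun w => 𝓕⁻ (F w.1) w.2 := ⟨_, rfl⟩
  have h1 : Measurable φ := hφ ▸ hF.measurable_fourierInv
  have h3 := hκ.cont.measurable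
  have h4 := measurable_rad
  have e : adj κ F = fun ξ => ∫ t, (κ (t * rad ξ) : ℂ) * φ (t, ξ) := by rw [hφ]; rfl
  rw [e]
  refine (StronglyMeasurable.integral_prod_right (f := fun (ξ : E3) (t : ℝ) =>
    (κ (t * rad ξ) : ℂ) * φ (t, ξ)) (Measurable.stronglyMeasurable ?_)).measurable
  unfold Function.uncurry
  fun_prop

lemma integral_trigProp_mul {κ : ℝ → ℝ} (hκ : TrigLike κ) {h : E3 → ℂ} (hm : Measurable h)
    (hi : Integrable h) {F : ℝ → E3 → ℂ} (hF : TestFun F) :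
    ∫ w : ℝ × E3, trigProp κ h w.1 w.2 * F w.1 w.2 = ∫ ξ, h ξ * adj κ F ξ := by
  set K : (ℝ × E3) → E3 → ℂ := fun w ξ => Complex.exp ((2 * Real.pi * ⟪ξ, w.2⟫ : ℝ) * Complex.I) *
    ((κ (w.1 * rad ξ) : ℂ) * h ξ) * Function.uncurry F w with hK
  have hFm := hF.meas
  have hr := measurable_rad
  have hκm := hκ.cont.measurable
  have hKi : Integrable (Function.uncurry K) := by
    refine (hF.integrable.norm.mul_prod hi.norm).mono' ?_ (Filter.Eventually.of_forall fun z => ?_)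
    · have : Function.uncurry K = fun z : (ℝ × E3) × E3 =>
          Complex.exp ((2 * Real.pi * ⟪z.2, z.1.2⟫ : ℝ) * Complex.I) *
          ((κ (z.1.1 * rad z.2) : ℂ) * h z.2) * Function.uncurry F z.1 := rfl
      rw [this]
      exact Measurable.aestronglyMeasurable (by fun_prop)
    · simp only [hK, Function.uncurry_def]
      rw [norm_mul, norm_mul, Complex.norm_exp_ofReal_mul_I, one_mul, mul_comm, norm_mul,
        Complex.norm_real]
      gcongr
      exact mul_le_of_le_one_left (norm_nonneg _) (hκ.bdd _)
  have e1 : ∀ w : ℝ × E3, trigProp κ h w.1 w.2 * F w.1 w.2 = ∫ ξ, K w ξ := by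
    intro w
    simp only [hK]
    rw [integral_mul_const, trigProp, Real.fourierInv_eq']
    rfl
  simp_rw [e1]
  rw [integral_integral_swap hKi]
  refine integral_congr_ae (Filter.Eventually.of_forall fun ξ => ?_)
  have hKξ : Integrable fun w => K w ξ := by
    have hFi := hF.integrable
    refine (hFi.norm.const_mul ‖h ξ‖).mono' ?_ (Filter.Eventually.of_forall fun w => ?_)
    · exact Measurable.aestronglyMeasurable (by simp only [hK]; fun_prop)
    · simp only [hK]
      rw [norm_mul, norm_mul, Complex.norm_exp_ofReal_mul_I, one_mul, norm_mul,
        Complex.norm_real]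
      gcongr
      exact mul_le_of_le_one_left (norm_nonneg _) (hκ.bdd _)
  beta_reduce
  rw [Measure.volume_eq_prod, integral_prod _ hKξ, adj, ← integral_const_mul]
  refine integral_congr_ae (Filter.Eventually.of_forall fun t => ?_)
  simp only [hK, Function.uncurry_apply_pair]
  rw [Real.fourierInv_eq', ← integral_const_mul, ← integral_const_mul]
  refine integral_congr_ae (Filter.Eventually.of_forall fun x => ?_)
  simp only [smul_eq_mul]
  rw [real_inner_comm]
  ring

lemma exists_enorm_integral_trigProp_mul_le {β r ρ : ℝ} (h0 : 0 < β) (h1 : β ≤ 1)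
    (hr1 : 1 < r) (hr2 : r < 2) (hρ : ρ * (2 - β * (2 / r - 1)) = 2) :
    ∃ C : ℝ≥0, ∀ κ : ℝ → ℝ, TrigLike κ → ∀ h : E3 → ℂ, Measurable h → Integrable h →
      ∀ F : ℝ → E3 → ℂ, TestFun F →
      ‖∫ w : ℝ × E3, trigProp κ h w.1 w.2 * F w.1 w.2‖ₑ ≤
        C * eLpNorm (fun ξ => ((rad ξ ^ ((3 - β) * (2 / r - 1) / 2) : ℝ) : ℂ) * h ξ) 2 volume *
          (∫⁻ t, ENNReal.ofReal (((∫ x, ‖F t x‖ ^ r) ^ (1 / r)) ^ ρ)) ^ (1 / ρ) := by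
  obtain ⟨C, H⟩ := exists_lintegral_adj_sq_le h0 h1 hr1 hr2 hρ
  refine ⟨C ^ (1 / 2 : ℝ), fun κ hκ h hm hi F hF => ?_⟩
  set c := (3 - β) * (2 / r - 1) with hc
  set I := ∫⁻ t, ENNReal.ofReal (((∫ x, ‖F t x‖ ^ r) ^ (1 / r)) ^ ρ) with hI
  have hrm := measurable_rad
  have ham := measurable_adj hκ hF
  have hw0 : ∀ ξ : E3, ∀ b : ℝ, 0 ≤ rad ξ ^ b := fun ξ b => Real.rpow_nonneg (rad_nonneg ξ) b
  have hadj : ∫⁻ ξ, ENNReal.ofReal (rad ξ ^ (-c) * ‖adj κ F ξ‖ ^ 2) ≤ C * I ^ (2 / ρ) := by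
    set f : ℕ → E3 → ℝ≥0∞ := fun n ξ => ENNReal.ofReal (rad ξ ^ (-c) *
      Real.exp (-(1 / ((n : ℝ) + 1)) * rad ξ) * ‖adj κ F ξ‖ ^ 2) with hf
    refine le_of_tendsto' (lintegral_tendsto_of_tendsto_of_monotone (f := f)
      (fun n => Measurable.aemeasurable (by fun_prop)) ?_ ?_) fun n => H κ hκ _ (by positivity) F hF
    · refine Filter.Eventually.of_forall fun ξ => monotone_nat_of_le_succ fun n =>
        ENNReal.ofReal_le_ofReal ?_
      have := hw0 ξ (-c)
      have h3 := rad_nonneg ξ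
      gcongr
      simp
    · refine Filter.Eventually.of_forall fun ξ => ENNReal.tendsto_ofReal ?_
      have t1 : Filter.Tendsto (fun n : ℕ => -(1 / ((n : ℝ) + 1)) * rad ξ) Filter.atTop
          (nhds (-0 * rad ξ)) := tendsto_one_div_add_atTop_nhds_zero_nat.neg.mul_const _
      have t2 := ((Real.continuous_exp.tendsto _).comp t1)
      simp only [neg_zero, zero_mul, Real.exp_zero] at t2
      simpa using ((t2.const_mul (rad ξ ^ (-c))).mul_const (‖adj κ F ξ‖ ^ 2))
  rw [integral_trigProp_mul hκ hm hi hF]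
  set f : E3 → ℝ≥0∞ := fun ξ => ‖((rad ξ ^ (c / 2) : ℝ) : ℂ) * h ξ‖ₑ with hf
  set g : E3 → ℝ≥0∞ := fun ξ => ENNReal.ofReal (rad ξ ^ (-c / 2) * ‖adj κ F ξ‖) with hg
  have hCS := ENNReal.lintegral_mul_le_Lp_mul_Lq (volume : Measure E3) Real.HolderConjugate.two_two
    (f := f) (g := g) (Measurable.aemeasurable (by simp only [hf]; fun_prop))
    (Measurable.aemeasurable (by fun_prop))
  have hfn : (∫⁻ ξ, f ξ ^ (2 : ℝ)) ^ (1 / 2 : ℝ) =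
      eLpNorm (fun ξ => ((rad ξ ^ (c / 2) : ℝ) : ℂ) * h ξ) 2 volume := by
    rw [eLpNorm_eq_lintegral_rpow_enorm_toReal (by norm_num) (by norm_num)]
    simp [hf]
  have hgn : ∫⁻ ξ, g ξ ^ (2 : ℝ) = ∫⁻ ξ, ENNReal.ofReal (rad ξ ^ (-c) * ‖adj κ F ξ‖ ^ 2) := by
    refine lintegral_congr fun ξ => ?_
    simp only [hg]
    rw [ENNReal.ofReal_rpow_of_nonneg (mul_nonneg (hw0 _ _) (norm_nonneg _)) (by norm_num),
      Real.mul_rpow (hw0 _ _) (norm_nonneg _), ← Real.rpow_mul (rad_nonneg ξ)]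
    congr 2
    · congr 1; ring
    · norm_cast
  calc ‖∫ ξ, h ξ * adj κ F ξ‖ₑ ≤ ∫⁻ ξ, ‖h ξ * adj κ F ξ‖ₑ := enorm_integral_le_lintegral_enorm _
    _ = ∫⁻ ξ, (f * g) ξ := by
        refine lintegral_congr_ae ?_
        filter_upwards [ae_rad_pos] with ξ hξ
        simp only [Pi.mul_apply, hf, hg]
        rw [← ofReal_norm, ← ofReal_norm, ← ENNReal.ofReal_mul (norm_nonneg _), norm_mul, norm_mul,
          Complex.norm_real, Real.norm_of_nonneg (hw0 _ _)]
        congr 1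
        have : rad ξ ^ (c / 2) * rad ξ ^ (-c / 2) = 1 := by
          rw [← Real.rpow_add hξ, neg_div, add_neg_cancel, Real.rpow_zero]
        linear_combination (-(‖h ξ‖ * ‖adj κ F ξ‖)) * this
    _ ≤ _ := hCS
    _ ≤ _ := by
        rw [hfn, hgn, mul_comm (((C ^ (1 / 2 : ℝ) : ℝ≥0) : ℝ≥0∞)), mul_assoc]
        gcongr
        refine (ENNReal.rpow_le_rpow hadj (by norm_num)).trans_eq ?_
        rw [ENNReal.mul_rpow_of_nonneg _ _ (by norm_num), ← ENNReal.rpow_mul,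
          ENNReal.coe_rpow_of_nonneg _ (by norm_num)]
        congr 2; ring

/-- Converse duality for mixed norms, on a truncated region. -/
lemma setLIntegral_rpow_le_of_dual {p q : ℝ} (hp : 1 < p) (hq : 1 < q) {u : ℝ → E3 → ℂ}
    (hu : Measurable (Function.uncurry u)) {M : ℝ} (hM : ∀ t x, ‖u t x‖ ≤ M) {K : ℝ≥0∞}
    (H : ∀ F, TestFun F → ‖∫ w : ℝ × E3, u w.1 w.2 * F w.1 w.2‖ₑ ≤
      K * (∫⁻ t, ENNReal.ofReal (((∫ x, ‖F t x‖ ^ (q / (q - 1))) ^ (1 / (q / (q - 1)))) ^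
        (p / (p - 1)))) ^ (1 / (p / (p - 1)))) (R : ℝ) {a : ℝ} (ha : 0 < a) :
    ∫⁻ t in {t | |t| ≤ R ∧ a ≤ ∫ x in closedBall 0 R, ‖u t x‖ ^ q},
      ENNReal.ofReal ((∫ x in closedBall 0 R, ‖u t x‖ ^ q) ^ (p / q)) ≤ K ^ p := by
  have hp0 : 0 < p := by linarith
  have hq0 : 0 < q := by linarith
  have hM0 : 0 ≤ M := (norm_nonneg _).trans (hM 0 0)
  have hum : ∀ t, Measurable (u t) := fun t => hu.comp measurable_prodMk_left
  set B : Set E3 := closedBall 0 R with hB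
  have hBm : MeasurableSet B := measurableSet_closedBall
  have hBf : volume B ≠ ∞ := measure_closedBall_lt_top.ne
  set v : ℝ → ℝ := fun t => ∫ x in B, ‖u t x‖ ^ q with hv
  have hvm : Measurable v :=
    (StronglyMeasurable.integral_prod_right (f := fun (t : ℝ) (x : E3) => ‖u t x‖ ^ q)
      (hu.norm.pow_const q).stronglyMeasurable).measurable
  have hv0 : ∀ t, 0 ≤ v t := fun t => integral_nonneg fun x => by positivity
  have hvi : ∀ t, IntegrableOn (fun x => ‖u t x‖ ^ q) B := fun t =>
    Measure.integrableOn_of_bounded (M := M ^ q) hBf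
      ((hum t).norm.pow_const q).aestronglyMeasurable (Filter.Eventually.of_forall fun x => by
        rw [Real.norm_of_nonneg (by positivity)]
        exact Real.rpow_le_rpow (norm_nonneg _) (hM t x) hq0.le)
  obtain ⟨V, hV⟩ : ∃ V, ∀ t, v t ≤ V := by
    refine ⟨M ^ q * volume.real B, fun t => (Real.le_norm_self _).trans ?_⟩
    refine norm_setIntegral_le_of_norm_le_const hBf.lt_top fun x _ => ?_
    rw [Real.norm_of_nonneg (by positivity)]
    exact Real.rpow_le_rpow (norm_nonneg _) (hM t x) hq0.le
  set T : Set ℝ := {t | |t| ≤ R ∧ a ≤ v t} with hT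
  have hTm : MeasurableSet T :=
    (measurableSet_le measurable_id.abs measurable_const).inter (measurableSet_le measurable_const hvm)
  have hTf : volume T < ∞ := by
    refine (measure_mono fun t ht => ?_).trans_lt (measure_Icc_lt_top (a := -R) (b := R))
    exact abs_le.1 ht.1
  set e : ℝ := p / q - 1 with he
  set P : ℝ → E3 → ℝ := fun t x => (T ×ˢ B).indicator (fun _ => v t ^ e * ‖u t x‖ ^ (q - 2)) (t, x)
    with hP
  have hP0 : ∀ t x, 0 ≤ P t x := fun t x => indicator_nonneg (fun _ _ =>
    mul_nonneg (Real.rpow_nonneg (hv0 t) _) (by positivity)) _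
  set F : ℝ → E3 → ℂ := fun t x => (P t x : ℂ) * (starRingEnd ℂ) (u t x) with hF
  have hPm : Measurable (Function.uncurry P) := by
    have : Function.uncurry P = (T ×ˢ B).indicator
        (fun w => v w.1 ^ e * ‖Function.uncurry u w‖ ^ (q - 2)) := by
      ext ⟨t, x⟩
      simp only [hP, Function.uncurry_apply_pair, indicator]
    rw [this]
    exact Measurable.indicator (by fun_prop) (hTm.prod hBm)
  have hFn : ∀ t x, ‖F t x‖ = (T ×ˢ B).indicator (fun _ => v t ^ e * ‖u t x‖ ^ (q - 1)) (t, x) := by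
    intro t x
    simp only [hF]
    rw [norm_mul, RCLike.norm_conj, Complex.norm_real, Real.norm_of_nonneg (hP0 t x)]
    simp only [hP]
    by_cases hw : (t, x) ∈ T ×ˢ B
    · rw [indicator_of_mem hw, indicator_of_mem hw, mul_assoc]
      congr 1
      rcases eq_or_ne ‖u t x‖ 0 with h | h
      · rw [h, mul_zero, Real.zero_rpow (by linarith)]
      · rw [← Real.rpow_add_one h]; congr 1; ring
    · rw [indicator_of_notMem hw, indicator_of_notMem hw, zero_mul]
  have hFt : TestFun F := by
    refine ⟨?_, ⟨(a ^ e + V ^ e) * M ^ (q - 1), fun t x => ?_⟩, R, fun t x hne => ?_⟩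
    · have : Function.uncurry F = fun w => ((Function.uncurry P w : ℝ) : ℂ) *
        (starRingEnd ℂ) (Function.uncurry u w) := rfl
      rw [this]
      exact (Complex.measurable_ofReal.comp hPm).mul
        (Complex.continuous_conj.measurable.comp hu)
    · rw [hFn]
      by_cases hw : (t, x) ∈ T ×ˢ B
      · rw [indicator_of_mem hw]
        have hat : a ≤ v t := hw.1.2
        have hva : 0 ≤ V ^ e := Real.rpow_nonneg ((hv0 t).trans (hV t)) _
        have haa : 0 ≤ a ^ e := Real.rpow_nonneg ha.le _
        have h1 : v t ^ e ≤ a ^ e + V ^ e := by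
          rcases le_total 0 e with he0 | he0
          · exact (Real.rpow_le_rpow (hv0 t) (hV t) he0).trans (by linarith)
          · exact (Real.rpow_le_rpow_of_nonpos ha hat he0).trans (by linarith)
        refine mul_le_mul h1 (Real.rpow_le_rpow (norm_nonneg _) (hM t x) (by linarith))
          (by positivity) (by linarith)
      · rw [indicator_of_notMem hw]
        have : (0 : ℝ) ≤ V := (hv0 0).trans (hV 0)
        positivity
    · have hw : (t, x) ∈ T ×ˢ B := by
        by_contra hw
        rw [← norm_ne_zero_iff, hFn, indicator_of_notMem hw] at hne
        exact hne rfl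
      exact ⟨hw.1.1, by simpa [hB] using hw.2⟩
  set X := ∫⁻ t in T, ENNReal.ofReal (v t ^ (p / q)) with hX
  have hXf : X ≠ ∞ := by
    refine ne_top_of_le_ne_top (b := ENNReal.ofReal (V ^ (p / q)) * volume T)
      (ENNReal.mul_ne_top ENNReal.ofReal_ne_top hTf.ne) ?_
    rw [← setLIntegral_const]
    refine lintegral_mono fun t => ENNReal.ofReal_le_ofReal ?_
    exact Real.rpow_le_rpow (hv0 t) (hV t) (by positivity)
  have hr0 : 0 < q / (q - 1) := div_pos hq0 (by linarith)
  have hρ0 : 0 < p / (p - 1) := div_pos hp0 (by linarith)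
  have hq1 : q - 1 ≠ 0 := by linarith
  have hp1 : p - 1 ≠ 0 := by linarith
  have hI : ∫⁻ t, ENNReal.ofReal (((∫ x, ‖F t x‖ ^ (q / (q - 1))) ^ (1 / (q / (q - 1)))) ^
        (p / (p - 1))) = X := by
    rw [hX, ← lintegral_indicator hTm]
    refine lintegral_congr fun t => ?_
    by_cases ht : t ∈ T
    · have hvt : 0 < v t := ha.trans_le ht.2
      have h1 : ∀ x, ‖F t x‖ ^ (q / (q - 1)) =
          B.indicator (fun x => v t ^ (e * (q / (q - 1))) * ‖u t x‖ ^ q) x := by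
        intro x
        rw [hFn]
        by_cases hx : x ∈ B
        · rw [indicator_of_mem hx, indicator_of_mem (show (t, x) ∈ T ×ˢ B from ⟨ht, hx⟩),
            Real.mul_rpow (by positivity) (by positivity), ← Real.rpow_mul hvt.le,
            ← Real.rpow_mul (norm_nonneg _), mul_div_cancel₀ _ hq1]
        · rw [indicator_of_notMem hx, indicator_of_notMem (show (t, x) ∉ T ×ˢ B from fun h => hx h.2),
            Real.zero_rpow hr0.ne']
      simp_rw [h1]
      rw [integral_indicator hBm, integral_const_mul, indicator_of_mem ht]
      change ENNReal.ofReal (((_ * v t) ^ _) ^ _) = _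
      rw [← Real.rpow_add_one hvt.ne', ← Real.rpow_mul hvt.le, ← Real.rpow_mul hvt.le]
      congr 2
      rw [he]; field_simp; ring
    · have h1 : ∀ x, ‖F t x‖ ^ (q / (q - 1)) = 0 := fun x => by
        rw [hFn, indicator_of_notMem (show (t, x) ∉ T ×ˢ B from fun h => ht h.1),
          Real.zero_rpow hr0.ne']
      simp_rw [h1]
      rw [integral_zero, Real.zero_rpow (one_div_pos.2 hr0).ne', Real.zero_rpow hρ0.ne',
        indicator_of_notMem ht, ENNReal.ofReal_zero]
  have hpair : ‖∫ w : ℝ × E3, u w.1 w.2 * F w.1 w.2‖ₑ = X := by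
    have h1 : ∀ w : ℝ × E3, u w.1 w.2 * F w.1 w.2 =
        (((T ×ˢ B).indicator (fun w => v w.1 ^ e * ‖u w.1 w.2‖ ^ q) w : ℝ) : ℂ) := by
      intro w
      have : u w.1 w.2 * F w.1 w.2 = ((P w.1 w.2 * ‖u w.1 w.2‖ ^ 2 : ℝ) : ℂ) := by
        simp only [hF]
        rw [mul_left_comm, Complex.mul_conj, Complex.normSq_eq_norm_sq]
        push_cast; ring
      rw [this]
      congr 1
      simp only [hP]
      by_cases hw : w ∈ T ×ˢ B
      · rw [indicator_of_mem hw, indicator_of_mem (show (w.1, w.2) ∈ T ×ˢ B from hw), mul_assoc]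
        congr 1
        rcases eq_or_ne ‖u w.1 w.2‖ 0 with h | h
        · rw [h, Real.zero_rpow hq0.ne']; ring
        · rw [← Real.rpow_natCast, ← Real.rpow_add (by positivity)]; congr 1; norm_num
      · rw [indicator_of_notMem hw, indicator_of_notMem (show (w.1, w.2) ∉ T ×ˢ B from hw), zero_mul]
    set Y : ℝ × E3 → ℝ := (T ×ˢ B).indicator (fun w => v w.1 ^ e * ‖u w.1 w.2‖ ^ q) with hY
    have hYm : Measurable Y := by
      have hu' : Measurable fun w : ℝ × E3 => u w.1 w.2 := hu
      exact Measurable.indicator (by fun_prop) (hTm.prod hBm)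
    have hY0 : ∀ w, 0 ≤ Y w := fun w => indicator_nonneg (fun _ _ =>
      mul_nonneg (Real.rpow_nonneg (hv0 _) _) (by positivity)) _
    have hYl : ∫⁻ w, ENNReal.ofReal (Y w) = X := by
      rw [Measure.volume_eq_prod, lintegral_prod _ (by fun_prop), hX, ← lintegral_indicator hTm]
      refine lintegral_congr fun t => ?_
      by_cases ht : t ∈ T
      · have hvt : 0 < v t := ha.trans_le ht.2
        have h2 : ∀ x, ENNReal.ofReal (Y (t, x)) = B.indicator (fun x =>
            ENNReal.ofReal (v t ^ e) * ENNReal.ofReal (‖u t x‖ ^ q)) x := by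
          intro x
          by_cases hx : x ∈ B
          · rw [indicator_of_mem hx, hY, indicator_of_mem (show (t, x) ∈ T ×ˢ B from ⟨ht, hx⟩),
              ENNReal.ofReal_mul (by positivity)]
          · rw [indicator_of_notMem hx, hY,
              indicator_of_notMem (show (t, x) ∉ T ×ˢ B from fun h => hx h.2), ENNReal.ofReal_zero]
        have hut := hum t
        simp_rw [h2]
        rw [lintegral_indicator hBm, lintegral_const_mul _ (by fun_prop),
          ← ofReal_integral_eq_lintegral_ofReal (hvi t)
            (Filter.Eventually.of_forall fun x => by positivity), indicator_of_mem ht,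
          ← ENNReal.ofReal_mul (by positivity)]
        change ENNReal.ofReal (_ * v t) = _
        rw [← Real.rpow_add_one hvt.ne']
        congr 2
        rw [he]; ring
      · have h2 : ∀ x, ENNReal.ofReal (Y (t, x)) = 0 := fun x => by
          rw [hY, indicator_of_notMem (show (t, x) ∉ T ×ˢ B from fun h => ht h.1),
            ENNReal.ofReal_zero]
        simp_rw [h2]
        rw [lintegral_zero, indicator_of_notMem ht]
    have hYi : Integrable Y := by
      refine ⟨hYm.aestronglyMeasurable, ?_⟩
      rw [hasFiniteIntegral_iff_ofReal (Filter.Eventually.of_forall hY0), hYl]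
      exact hXf.lt_top
    simp_rw [h1]
    rw [integral_complex_ofReal, ← ofReal_norm, Complex.norm_real,
      Real.norm_of_nonneg (integral_nonneg hY0),
      ofReal_integral_eq_lintegral_ofReal hYi (Filter.Eventually.of_forall hY0), hYl]
  have key := H F hFt
  rw [hpair, hI] at key
  rcases eq_or_ne X 0 with hX0 | hX0
  · rw [hX0]; exact zero_le
  have hXs : X = X ^ (1 / p) * X ^ (1 / (p / (p - 1))) := by
    rw [← ENNReal.rpow_add _ _ hX0 hXf]
    have : 1 / p + 1 / (p / (p - 1)) = 1 := by field_simp; ring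
    rw [this, ENNReal.rpow_one]
  have hle : X ^ (1 / p) ≤ K := by
    have hY0 : X ^ (1 / (p / (p - 1))) ≠ 0 := by
      rw [Ne, ENNReal.rpow_eq_zero_iff_of_pos (by positivity)]; exact hX0
    have hYf : X ^ (1 / (p / (p - 1))) ≠ ∞ := ENNReal.rpow_ne_top_of_nonneg (by positivity) hXf
    rw [← ENNReal.mul_le_mul_iff_left hY0 hYf, ← hXs]
    exact key
  calc X = (X ^ (1 / p)) ^ p := by
        rw [← ENNReal.rpow_mul, one_div_mul_cancel hp0.ne', ENNReal.rpow_one]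
    _ ≤ K ^ p := ENNReal.rpow_le_rpow hle hp0.le

/-- Converse duality for mixed norms. -/
lemma lintegral_rpow_le_of_dual {p q : ℝ} (hp : 1 < p) (hq : 1 < q) {u : ℝ → E3 → ℂ}
    (hu : Measurable (Function.uncurry u)) {M : ℝ} (hM : ∀ t x, ‖u t x‖ ≤ M) {K : ℝ≥0∞}
    (H : ∀ F, TestFun F → ‖∫ w : ℝ × E3, u w.1 w.2 * F w.1 w.2‖ₑ ≤
      K * (∫⁻ t, ENNReal.ofReal (((∫ x, ‖F t x‖ ^ (q / (q - 1))) ^ (1 / (q / (q - 1)))) ^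
        (p / (p - 1)))) ^ (1 / (p / (p - 1)))) :
    ∫⁻ t, (∫⁻ x, ‖u t x‖ₑ ^ q) ^ (p / q) ≤ K ^ p := by
  have hp0 : 0 < p := by linarith
  have hq0 : 0 < q := by linarith
  have hum : ∀ t, Measurable (u t) := fun t => hu.comp measurable_prodMk_left
  set B : ℕ → Set E3 := fun n => closedBall 0 n with hB
  have hBmono : Monotone B := fun m n h => closedBall_subset_closedBall (by exact_mod_cast h)
  have hBU : ⋃ n, B n = univ := iUnion_closedBall_nat 0
  have hBf : ∀ n, volume (B n) ≠ ∞ := fun n => measure_closedBall_lt_top.ne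
  set v : ℕ → ℝ → ℝ := fun n t => ∫ x in B n, ‖u t x‖ ^ q with hv
  have hvm : ∀ n, Measurable (v n) := fun n =>
    (StronglyMeasurable.integral_prod_right (f := fun (t : ℝ) (x : E3) => ‖u t x‖ ^ q)
      (hu.norm.pow_const q).stronglyMeasurable).measurable
  have hv0 : ∀ n t, 0 ≤ v n t := fun n t => integral_nonneg fun x => by positivity
  have hvl : ∀ n t, ENNReal.ofReal (v n t) = ∫⁻ x in B n, ‖u t x‖ₑ ^ q := by
    intro n t
    have hi : IntegrableOn (fun x => ‖u t x‖ ^ q) (B n) :=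
      Measure.integrableOn_of_bounded (M := M ^ q) (hBf n)
        ((hum t).norm.pow_const q).aestronglyMeasurable (Filter.Eventually.of_forall fun x => by
          rw [Real.norm_of_nonneg (by positivity)]
          exact Real.rpow_le_rpow (norm_nonneg _) (hM t x) hq0.le)
    simp only [hv]
    rw [ofReal_integral_eq_lintegral_ofReal hi
      (Filter.Eventually.of_forall fun x => by positivity)]
    refine lintegral_congr fun x => ?_
    rw [← ofReal_norm, ENNReal.ofReal_rpow_of_nonneg (norm_nonneg _) hq0.le]
  set L : ℝ → ℝ≥0∞ := fun t => ∫⁻ x, ‖u t x‖ₑ ^ q with hL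
  have hlim : ∀ t, Filter.Tendsto (fun n => ENNReal.ofReal (v n t)) Filter.atTop (nhds (L t)) := by
    intro t
    have : L t = ⨆ n, ENNReal.ofReal (v n t) := by
      simp only [hvl]
      rw [← setLIntegral_iUnion_of_directed _ hBmono.directed_le, hBU, setLIntegral_univ]
    rw [this]
    refine tendsto_atTop_iSup fun m n h => ?_
    rw [hvl, hvl]
    exact lintegral_mono_set (hBmono h)
  set T : ℕ → Set ℝ := fun n => {t | |t| ≤ n ∧ 1 / ((n : ℝ) + 1) ≤ v n t} with hT
  have hTm : ∀ n, MeasurableSet (T n) := fun n =>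
    (measurableSet_le measurable_id.abs measurable_const).inter
      (measurableSet_le measurable_const (hvm n))
  set f : ℕ → ℝ → ℝ≥0∞ := fun n => (T n).indicator fun t => ENNReal.ofReal (v n t ^ (p / q)) with hf
  have hfi : ∀ n, ∫⁻ t, f n t ≤ K ^ p := fun n => by
    simp only [hf]
    rw [lintegral_indicator (hTm n)]
    exact setLIntegral_rpow_le_of_dual hp hq hu hM H n (by positivity)
  have hft : ∀ t, Filter.Tendsto (fun n => f n t) Filter.atTop (nhds (L t ^ (p / q))) := by
    intro t
    have hr : ∀ n, ENNReal.ofReal (v n t ^ (p / q)) = ENNReal.ofReal (v n t) ^ (p / q) := fun n =>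
      (ENNReal.ofReal_rpow_of_nonneg (hv0 n t) (by positivity)).symm
    have ht := (hlim t).ennrpow_const (p / q)
    rcases eq_or_ne (L t) 0 with h0 | h0
    · rw [h0] at ht ⊢
      refine tendsto_of_tendsto_of_tendsto_of_le_of_le tendsto_const_nhds ht
        (fun n => ?_) fun n => ?_
      · rw [ENNReal.zero_rpow_of_pos (by positivity)]; exact zero_le
      · exact (indicator_le_self _ _ t).trans_eq (hr n)
    · refine ht.congr' ?_
      obtain ⟨c, hc0, hcL⟩ := ENNReal.lt_iff_exists_nnreal_btwn.1 (pos_iff_ne_zero.2 h0)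
      have hc0' : (0 : ℝ) < c := by exact_mod_cast hc0
      have e1 : ∀ᶠ n : ℕ in Filter.atTop, 1 / ((n : ℝ) + 1) < c :=
        tendsto_one_div_add_atTop_nhds_zero_nat.eventually_lt_const hc0'
      have e2 : ∀ᶠ n : ℕ in Filter.atTop, |t| ≤ n :=
        tendsto_natCast_atTop_atTop.eventually_ge_atTop _
      have e3 := (hlim t).eventually_const_lt hcL
      filter_upwards [e1, e2, e3] with n h1 h2 h3
      have h4 : (c : ℝ) < v n t := by
        rw [← ENNReal.ofReal_coe_nnreal] at h3
        exact (ENNReal.ofReal_lt_ofReal_iff_of_nonneg c.2).1 h3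
      simp only [hf]
      rw [indicator_of_mem (show t ∈ T n from ⟨h2, (h1.trans h4).le⟩), hr]
  calc ∫⁻ t, L t ^ (p / q) = ∫⁻ t, Filter.liminf (fun n => f n t) Filter.atTop :=
        lintegral_congr fun t => (hft t).liminf_eq.symm
    _ ≤ Filter.liminf (fun n => ∫⁻ t, f n t) Filter.atTop := lintegral_liminf_le fun n =>
        Measurable.indicator (by have := hvm n; fun_prop) (hTm n)
    _ ≤ K ^ p := Filter.liminf_le_of_le (by isBoundedDefault) fun b hb => by
        obtain ⟨n, hn⟩ := hb.exists
        exact hn.trans (hfi n)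

lemma integral_rad_rpow_mul_exp_div (a : ℝ) {A : ℝ} (hA : 0 < A) :
    ∫ ξ : E3, rad ξ ^ (-a) * Real.exp (-(1 / A) * rad ξ) =
      A ^ (3 - a) * ∫ ξ : E3, rad ξ ^ (-a) * Real.exp (-1 * rad ξ) := by
  have h := Measure.integral_comp_smul (volume : Measure E3)
    (fun ξ : E3 => rad ξ ^ (-a) * Real.exp (-1 * rad ξ)) A⁻¹
  have hr : ∀ ξ : E3, rad (A⁻¹ • ξ) = A⁻¹ * rad ξ := fun ξ => by
    unfold rad; rw [norm_smul, Real.norm_of_nonneg (by positivity)]; ring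
  have e : ∀ ξ : E3, rad ξ ^ (-a) * Real.exp (-(1 / A) * rad ξ) =
      A ^ (-a) * (rad (A⁻¹ • ξ) ^ (-a) * Real.exp (-1 * rad (A⁻¹ • ξ))) := fun ξ => by
    rw [hr, Real.mul_rpow (by positivity) (rad_nonneg ξ), Real.inv_rpow hA.le, ← mul_assoc,
      ← mul_assoc, mul_inv_cancel₀ (Real.rpow_pos_of_pos hA _).ne', one_mul]
    congr 2; ring
  simp_rw [e]
  rw [integral_const_mul, h, finrank_euclideanSpace_fin, smul_eq_mul, ← mul_assoc]
  congr 1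
  rw [inv_pow, inv_inv, abs_of_pos (by positivity), ← Real.rpow_natCast, ← Real.rpow_add hA]
  congr 1; push_cast; ring

lemma exists_lintegral_low_le {s : ℝ} (hs : s < 3 / 2) :
    ∃ c : ℝ, 0 < c ∧ ∀ A : ℝ, 0 < A → ∀ h : E3 → ℂ, Measurable h →
      ∫⁻ ξ in {ξ | rad ξ < A}, ‖h ξ‖ₑ ≤ ENNReal.ofReal (c * A ^ (3 / 2 - s)) *
        eLpNorm (fun ξ => ((rad ξ ^ s : ℝ) : ℂ) * h ξ) 2 volume := by
  set I := ∫ ξ : E3, rad ξ ^ (-(2 * s)) * Real.exp (-1 * rad ξ) with hI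
  have hw0 : ∀ ξ : E3, ∀ b : ℝ, 0 ≤ rad ξ ^ b := fun ξ b => Real.rpow_nonneg (rad_nonneg ξ) b
  have hI0 : 0 ≤ I := integral_nonneg fun ξ => mul_nonneg (hw0 _ _) (Real.exp_pos _).le
  refine ⟨√(Real.exp 1 * I) + 1, by positivity, fun A hA h hm => ?_⟩
  have hrm := measurable_rad
  set S : Set E3 := {ξ | rad ξ < A} with hS
  have hSm : MeasurableSet S := measurableSet_lt hrm measurable_const
  set f : E3 → ℝ≥0∞ := fun ξ => S.indicator (fun ξ => ENNReal.ofReal (rad ξ ^ (-s))) ξ with hf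
  set g : E3 → ℝ≥0∞ := fun ξ => ‖((rad ξ ^ s : ℝ) : ℂ) * h ξ‖ₑ with hg
  have hCS := ENNReal.lintegral_mul_le_Lp_mul_Lq (volume : Measure E3) Real.HolderConjugate.two_two
    (f := f) (g := g) (Measurable.aemeasurable (Measurable.indicator (by fun_prop) hSm))
    (Measurable.aemeasurable (by simp only [hg]; fun_prop))
  have hgn : (∫⁻ ξ, g ξ ^ (2 : ℝ)) ^ (1 / 2 : ℝ) =
      eLpNorm (fun ξ => ((rad ξ ^ s : ℝ) : ℂ) * h ξ) 2 volume := by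
    rw [eLpNorm_eq_lintegral_rpow_enorm_toReal (by norm_num) (by norm_num)]
    simp [hg]
  have hfn : ∫⁻ ξ, f ξ ^ (2 : ℝ) ≤ ENNReal.ofReal (Real.exp 1 * (A ^ (3 - 2 * s) * I)) := by
    rw [← integral_rad_rpow_mul_exp_div _ hA, ← integral_const_mul,
      ofReal_integral_eq_lintegral_ofReal
        ((integrable_rad_rpow_mul_exp (by linarith) (by positivity)).const_mul _)
        (Filter.Eventually.of_forall fun ξ => by have := hw0 ξ (-(2 * s)); positivity)]
    refine lintegral_mono fun ξ => ?_
    simp only [hf]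
    by_cases hξ : ξ ∈ S
    · rw [indicator_of_mem hξ, ENNReal.ofReal_rpow_of_nonneg (hw0 _ _) (by norm_num),
        ← Real.rpow_mul (rad_nonneg ξ)]
      refine ENNReal.ofReal_le_ofReal ?_
      have h1 : (1 : ℝ) ≤ Real.exp 1 * Real.exp (-(1 / A) * rad ξ) := by
        rw [← Real.exp_add]
        refine Real.one_le_exp ?_
        have : (1 / A) * rad ξ ≤ 1 := by
          rw [one_div_mul_eq_div, div_le_one hA]; exact (le_of_lt hξ)
        linarith
      have h2 := hw0 ξ (-(2 * s))
      have e : -s * 2 = -(2 * s) := by ring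
      rw [e]
      nlinarith
    · rw [indicator_of_notMem hξ, ENNReal.zero_rpow_of_pos (by norm_num)]
      exact zero_le
  have hfn2 : (∫⁻ ξ, f ξ ^ (2 : ℝ)) ^ (1 / 2 : ℝ) ≤
      ENNReal.ofReal ((√(Real.exp 1 * I) + 1) * A ^ (3 / 2 - s)) := by
    refine (ENNReal.rpow_le_rpow hfn (by norm_num)).trans ?_
    rw [ENNReal.ofReal_rpow_of_nonneg (by positivity) (by norm_num)]
    refine ENNReal.ofReal_le_ofReal ?_
    have e : Real.exp 1 * (A ^ (3 - 2 * s) * I) = (Real.exp 1 * I) * A ^ (3 - 2 * s) := by ring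
    rw [e, Real.mul_rpow (by positivity) (by positivity), ← Real.sqrt_eq_rpow, ← Real.rpow_mul hA.le]
    have e2 : (3 - 2 * s) * (1 / 2) = 3 / 2 - s := by ring
    rw [e2]
    gcongr
    linarith
  calc ∫⁻ ξ in S, ‖h ξ‖ₑ = ∫⁻ ξ, (f * g) ξ := by
        rw [← lintegral_indicator hSm]
        refine lintegral_congr_ae ?_
        filter_upwards [ae_rad_pos] with ξ hξ
        simp only [Pi.mul_apply, hf, hg]
        by_cases hξS : ξ ∈ S
        · rw [indicator_of_mem hξS, indicator_of_mem hξS, ← ofReal_norm, ← ofReal_norm,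
            ← ENNReal.ofReal_mul (hw0 _ _), norm_mul, Complex.norm_real,
            Real.norm_of_nonneg (hw0 _ _), ← mul_assoc, ← Real.rpow_add hξ, neg_add_cancel,
            Real.rpow_zero, one_mul]
        · rw [indicator_of_notMem hξS, indicator_of_notMem hξS, zero_mul]
    _ ≤ _ := hCS
    _ ≤ _ := by rw [hgn]; gcongr

lemma fourierInv_add_apply {f g : E3 → ℂ} (hf : Integrable f) (hg : Integrable g) (x : E3) :
    𝓕⁻ (f + g) x = 𝓕⁻ f x + 𝓕⁻ g x := by
  simp only [Real.fourierInv_eq_fourier_neg]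
  exact congrFun (VectorFourier.fourierIntegral_add Real.continuous_fourierChar
    (by exact continuous_inner) hf hg) (-x)

lemma meas_lt_fourierInv_le {q : ℝ} (hq : 2 < q) {c : ℝ} (hc : 0 < c)
    (H : ∀ A : ℝ, 0 < A → ∀ h : E3 → ℂ, Measurable h →
      ∫⁻ ξ in {ξ | rad ξ < A}, ‖h ξ‖ₑ ≤ ENNReal.ofReal (c * A ^ (3 / q)) *
        eLpNorm (fun ξ => ((rad ξ ^ (3 / 2 - 3 / q) : ℝ) : ℂ) * h ξ) 2 volume)
    {h : E3 → ℂ} (hm : Measurable h) (hi : Integrable h) {g : ℝ} (hg : 0 < g)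
    (hG : eLpNorm (fun ξ => ((rad ξ ^ (3 / 2 - 3 / q) : ℝ) : ℂ) * h ξ) 2 volume =
      ENNReal.ofReal g) {l : ℝ} (hl : 0 < l) :
    volume {x | l < ‖𝓕⁻ h x‖} * ENNReal.ofReal (l ^ (q - 1)) ≤
      ∫⁻ ξ, {ξ | l ≤ 2 * c * g * rad ξ ^ (3 / q)}.indicator
        (fun ξ => ENNReal.ofReal (4 * l ^ (q - 3)) * ‖h ξ‖ₑ ^ 2) ξ := by
  have hq0 : 0 < q := by linarith
  have hrm := measurable_rad
  set b := 2 * c * g with hb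
  have hb0 : 0 < b := by positivity
  set S : Set E3 := {ξ | l ≤ b * rad ξ ^ (3 / q)} with hS
  have hSm : MeasurableSet S := measurableSet_le measurable_const (by fun_prop)
  set A := (l / b) ^ (q / 3) with hA
  have hA0 : 0 < A := by positivity
  have hAq : A ^ (3 / q) = l / b := by
    rw [hA, ← Real.rpow_mul (by positivity)]
    have : q / 3 * (3 / q) = 1 := by field_simp
    rw [this, Real.rpow_one]
  have hSA : ∀ ξ, ξ ∈ S ↔ A ≤ rad ξ := fun ξ => by
    have h1 : ξ ∈ S ↔ A ^ (3 / q) ≤ rad ξ ^ (3 / q) := by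
      rw [hAq, div_le_iff₀' hb0]; rfl
    rw [h1, Real.rpow_le_rpow_iff hA0.le (rad_nonneg ξ) (by positivity)]
  have hSc : Sᶜ = {ξ | rad ξ < A} := by
    ext ξ; rw [mem_compl_iff, hSA, not_le]; rfl
  have hs0 : 0 < 3 / 2 - 3 / q := by
    rw [sub_pos, div_lt_div_iff₀ hq0 (by norm_num)]; linarith
  have hhi : Integrable (S.indicator h) := hi.indicator hSm
  have hlo : Integrable (Sᶜ.indicator h) := hi.indicator hSm.compl
  have h2 : MemLp (S.indicator h) 2 := by
    have hw : MemLp (fun ξ => ((rad ξ ^ (3 / 2 - 3 / q) : ℝ) : ℂ) * h ξ) 2 volume :=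
      ⟨Measurable.aestronglyMeasurable (by fun_prop), by rw [hG]; exact ENNReal.ofReal_lt_top⟩
    refine hw.of_le_mul (c := (A ^ (3 / 2 - 3 / q))⁻¹)
      (hm.indicator hSm).aestronglyMeasurable (Filter.Eventually.of_forall fun ξ => ?_)
    have hAp := Real.rpow_pos_of_pos hA0 (3 / 2 - 3 / q)
    by_cases hξ : ξ ∈ S
    · rw [indicator_of_mem hξ, norm_mul, Complex.norm_real,
        Real.norm_of_nonneg (Real.rpow_nonneg (rad_nonneg ξ) _), ← mul_assoc]
      refine le_mul_of_one_le_left (norm_nonneg _) ?_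
      rw [inv_mul_eq_div, one_le_div hAp]
      exact Real.rpow_le_rpow hA0.le ((hSA ξ).1 hξ) hs0.le
    · rw [indicator_of_notMem hξ, norm_zero]; positivity
  have hlow : ∀ x, ‖𝓕⁻ (Sᶜ.indicator h) x‖ ≤ l / 2 := fun x => by
    refine (norm_fourierInv_le x).trans ?_
    rw [← ENNReal.ofReal_le_ofReal_iff (by positivity),
      ofReal_integral_eq_lintegral_ofReal hlo.norm
        (Filter.Eventually.of_forall fun _ => norm_nonneg _)]
    have e : ∀ ξ, ENNReal.ofReal ‖Sᶜ.indicator h ξ‖ = Sᶜ.indicator (fun ξ => ‖h ξ‖ₑ) ξ := fun ξ => by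
      rw [ofReal_norm, enorm_indicator_eq_indicator_enorm]
    simp_rw [e]
    rw [lintegral_indicator hSm.compl, hSc]
    refine (H A hA0 h hm).trans ?_
    rw [hG, hAq, ← ENNReal.ofReal_mul (by positivity)]
    refine (congrArg ENNReal.ofReal ?_).le
    rw [hb]; field_simp
  have hsub : {x | l < ‖𝓕⁻ h x‖} ⊆ {x | ENNReal.ofReal (l / 2) ≤ ‖𝓕⁻ (S.indicator h) x‖ₑ} := by
    intro x hx
    have hx' : l < ‖𝓕⁻ h x‖ := hx
    have e : 𝓕⁻ h x = 𝓕⁻ (S.indicator h) x + 𝓕⁻ (Sᶜ.indicator h) x := by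
      rw [← fourierInv_add_apply hhi hlo, indicator_self_add_compl]
    rw [mem_ofPred_eq, ← ofReal_norm]
    refine ENNReal.ofReal_le_ofReal ?_
    rw [e] at hx'
    have := norm_add_le (𝓕⁻ (S.indicator h) x) (𝓕⁻ (Sᶜ.indicator h) x)
    linarith [hlow x]
  have hch := mul_meas_ge_le_pow_eLpNorm' (volume : Measure E3) (p := 2) (by norm_num) (by norm_num)
    (continuous_fourierInv hhi).aestronglyMeasurable (ENNReal.ofReal (l / 2))
  rw [eLpNorm_fourierInv_eq hhi h2] at hch
  have hn : eLpNorm (S.indicator h) 2 volume ^ (2 : ℝ≥0∞).toReal =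
      ∫⁻ ξ, S.indicator (fun ξ => ‖h ξ‖ₑ ^ 2) ξ := by
    rw [eLpNorm_eq_lintegral_rpow_enorm_toReal (by norm_num) (by norm_num), ← ENNReal.rpow_mul]
    have : 1 / (2 : ℝ≥0∞).toReal * (2 : ℝ≥0∞).toReal = 1 := by norm_num
    rw [this, ENNReal.rpow_one]
    refine lintegral_congr fun ξ => ?_
    by_cases hξ : ξ ∈ S
    · rw [indicator_of_mem hξ, indicator_of_mem hξ]; simp
    · rw [indicator_of_notMem hξ, indicator_of_notMem hξ]; simp
  rw [hn] at hch
  have hR : ∫⁻ ξ, S.indicator (fun ξ => ENNReal.ofReal (4 * l ^ (q - 3)) * ‖h ξ‖ₑ ^ 2) ξ =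
      ENNReal.ofReal (4 * l ^ (q - 3)) * ∫⁻ ξ, S.indicator (fun ξ => ‖h ξ‖ₑ ^ 2) ξ := by
    rw [← lintegral_const_mul _ (Measurable.indicator (by fun_prop) hSm)]
    refine lintegral_congr fun ξ => ?_
    by_cases hξ : ξ ∈ S
    · rw [indicator_of_mem hξ, indicator_of_mem hξ]
    · rw [indicator_of_notMem hξ, indicator_of_notMem hξ, mul_zero]
  rw [hR]
  refine le_trans ?_ (mul_le_mul_right hch _)
  rw [ENNReal.ofReal_rpow_of_nonneg (by positivity) (by norm_num), ← mul_assoc,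
    ← ENNReal.ofReal_mul (by positivity), mul_comm]
  refine mul_le_mul' (ENNReal.ofReal_le_ofReal ?_) (measure_mono hsub)
  have e2 : q - 1 = (q - 3) + 2 := by ring
  rw [e2, Real.rpow_add hl]
  norm_num
  apply le_of_eq; ring

/-- The Sobolev embedding into `L^q`, on the frequency side. -/
lemma exists_eLpNorm_fourierInv_le {q : ℝ} (hq : 2 < q) :
    ∃ C : ℝ≥0, ∀ h : E3 → ℂ, Measurable h → Integrable h →
      eLpNorm (𝓕⁻ h) (ENNReal.ofReal q) volume ≤
        C * eLpNorm (fun ξ => ((rad ξ ^ (3 / 2 - 3 / q) : ℝ) : ℂ) * h ξ) 2 volume := by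
  have hq0 : 0 < q := by linarith
  have hrm := measurable_rad
  obtain ⟨c, hc, H⟩ := exists_lintegral_low_le (s := 3 / 2 - 3 / q) (by
    have : 0 < 3 / q := by positivity
    linarith)
  rw [sub_sub_cancel] at H
  set D : ℝ := q * (4 * (2 * c) ^ (q - 2) / (q - 2)) with hD
  have hq2 : 0 < q - 2 := by linarith
  have hD0 : 0 < D := by positivity
  refine ⟨(D ^ (1 / q)).toNNReal, fun h hm hi => ?_⟩
  set G := eLpNorm (fun ξ => ((rad ξ ^ (3 / 2 - 3 / q) : ℝ) : ℂ) * h ξ) 2 volume with hG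
  have hw0 : ∀ ξ : E3, ∀ b : ℝ, 0 ≤ rad ξ ^ b := fun ξ b => Real.rpow_nonneg (rad_nonneg ξ) b
  have hDp : 0 < D ^ (1 / q) := by positivity
  change _ ≤ ENNReal.ofReal (D ^ (1 / q)) * G
  rcases eq_or_ne G ∞ with hGt | hGt
  · rw [hGt, ENNReal.mul_top (by simpa using hDp)]; exact le_top
  rcases eq_or_ne G 0 with hG0 | hG0
  · have hz : h =ᵐ[volume] 0 := by
      rw [hG, eLpNorm_eq_zero_iff (Measurable.aestronglyMeasurable (by fun_prop)) (by norm_num)] at hG0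
      filter_upwards [hG0, ae_rad_pos] with ξ hξ hr
      have := (Real.rpow_pos_of_pos hr (3 / 2 - 3 / q)).ne'
      simpa [this] using hξ
    have : 𝓕⁻ h = 0 := by
      ext x
      have hI : ∫ ξ, ‖h ξ‖ = 0 := by
        rw [integral_eq_zero_iff_of_nonneg (fun _ => norm_nonneg _) hi.norm]
        filter_upwards [hz] with ξ hξ
        simp [hξ]
      simpa [hI] using norm_fourierInv_le (f := h) x
    rw [this, eLpNorm_zero]; exact zero_le
  set g := G.toReal with hg
  have hg0 : 0 < g := ENNReal.toReal_pos hG0 hGt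
  have hGg : G = ENNReal.ofReal g := (ENNReal.ofReal_toReal hGt).symm
  set b := 2 * c * g with hb
  have hb0 : 0 < b := by positivity
  have hcont := continuous_fourierInv hi
  have hlay := lintegral_rpow_eq_lintegral_meas_lt_mul (volume : Measure E3)
    (f := fun x => ‖𝓕⁻ h x‖) (Filter.Eventually.of_forall fun _ => norm_nonneg _)
    hcont.norm.measurable.aemeasurable hq0
  have key : ∫⁻ l in Ioi 0, volume {x | l < ‖𝓕⁻ h x‖} * ENNReal.ofReal (l ^ (q - 1)) ≤
      ENNReal.ofReal (4 * b ^ (q - 2) / (q - 2)) * G ^ 2 := by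
    calc
      _ ≤ ∫⁻ l in Ioi 0, ∫⁻ ξ, {w : ℝ × E3 | w.1 ≤ b * rad w.2 ^ (3 / q)}.indicator
            (fun w => ENNReal.ofReal (4 * w.1 ^ (q - 3)) * ‖h w.2‖ₑ ^ 2) (l, ξ) :=
          setLIntegral_mono' measurableSet_Ioi fun l hl =>
            meas_lt_fourierInv_le hq hc H hm hi hg0 hGg hl
      _ = ∫⁻ ξ, ∫⁻ l in Ioi 0, {w : ℝ × E3 | w.1 ≤ b * rad w.2 ^ (3 / q)}.indicator
        (fun w => ENNReal.ofReal (4 * w.1 ^ (q - 3)) * ‖h w.2‖ₑ ^ 2) (l, ξ) := by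
          refine lintegral_lintegral_swap (Measurable.aemeasurable ?_)
          exact Measurable.indicator (by fun_prop) (measurableSet_le (by fun_prop) (by fun_prop))
      _ = ∫⁻ ξ, ENNReal.ofReal (4 * b ^ (q - 2) / (q - 2)) *
          ‖((rad ξ ^ (3 / 2 - 3 / q) : ℝ) : ℂ) * h ξ‖ₑ ^ 2 := by
          refine lintegral_congr fun ξ => ?_
          have e : ∀ l, {w : ℝ × E3 | w.1 ≤ b * rad w.2 ^ (3 / q)}.indicator
              (fun w => ENNReal.ofReal (4 * w.1 ^ (q - 3)) * ‖h w.2‖ₑ ^ 2) (l, ξ) =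
              (Iic (b * rad ξ ^ (3 / q))).indicator
              (fun l => 4 * ‖h ξ‖ₑ ^ 2 * ENNReal.ofReal (l ^ (-(3 - q)))) l := fun l => by
            by_cases hl : l ≤ b * rad ξ ^ (3 / q)
            · rw [indicator_of_mem (show l ∈ Iic _ from hl), indicator_of_mem (by exact hl),
                ENNReal.ofReal_mul (by norm_num)]
              norm_num
              ring
            · rw [indicator_of_notMem (show l ∉ Iic _ from hl), indicator_of_notMem (by exact hl)]
          simp_rw [e]
          have hA : 0 ≤ b * rad ξ ^ (3 / q) := mul_nonneg hb0.le (hw0 _ _)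
          rw [lintegral_indicator measurableSet_Iic, Measure.restrict_restrict measurableSet_Iic,
            inter_comm, Ioi_inter_Iic, lintegral_const_mul _ (by fun_prop),
            lintegral_Ioc_rpow_neg (by linarith) hA, ← ofReal_norm, ← ofReal_norm,
            ← ENNReal.ofReal_pow (norm_nonneg _), ← ENNReal.ofReal_pow (norm_nonneg _),
            ← ENNReal.ofReal_mul (by positivity), ← ENNReal.ofReal_ofNat,
            ← ENNReal.ofReal_mul (by norm_num), ← ENNReal.ofReal_mul (by positivity), norm_mul,
            Complex.norm_real, Real.norm_of_nonneg (hw0 _ _), mul_pow,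
            Real.mul_rpow hb0.le (hw0 _ _), ← Real.rpow_mul (rad_nonneg ξ),
            ← Real.rpow_mul_natCast (rad_nonneg ξ)]
          have e1 : 3 / q * (1 - (3 - q)) = (3 / 2 - 3 / q) * (2 : ℕ) := by
            push_cast; field_simp; ring
          rw [e1]
          have e2 : 1 - (3 - q) = q - 2 := by ring
          rw [e2]
          congr 1
          ring
      _ = _ := by
          rw [lintegral_const_mul _ (by fun_prop), hG,
            eLpNorm_eq_lintegral_rpow_enorm_toReal (by norm_num) (by norm_num),
            ← ENNReal.rpow_natCast, ← ENNReal.rpow_mul]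
          norm_num
  rw [eLpNorm_eq_lintegral_rpow_enorm_toReal (by simpa using hq0) ENNReal.ofReal_ne_top,
    ENNReal.toReal_ofReal hq0.le]
  have e3 : ∫⁻ x, ‖𝓕⁻ h x‖ₑ ^ q = ∫⁻ x, ENNReal.ofReal (‖𝓕⁻ h x‖ ^ q) :=
    lintegral_congr fun x => by
      rw [← ofReal_norm, ENNReal.ofReal_rpow_of_nonneg (norm_nonneg _) hq0.le]
  rw [e3, hlay]
  refine (ENNReal.rpow_le_rpow (mul_le_mul_right key _) (by positivity)).trans_eq ?_
  rw [hGg, ← ENNReal.ofReal_pow hg0.le, ← ENNReal.ofReal_mul (by positivity),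
    ← ENNReal.ofReal_mul hq0.le, ENNReal.ofReal_rpow_of_nonneg (by positivity) (by positivity),
    ← ENNReal.ofReal_mul hDp.le]
  congr 1
  have e4 : q * (4 * b ^ (q - 2) / (q - 2) * g ^ 2) = D * g ^ q := by
    have : g ^ q = g ^ (q - 2) * g ^ 2 := by
      rw [← Real.rpow_natCast, ← Real.rpow_add hg0]; congr 1; push_cast; ring
    rw [hD, hb, Real.mul_rpow (by positivity) hg0.le, this]; ring
  rw [e4, Real.mul_rpow hD0.le (by positivity), ← Real.rpow_mul hg0.le,
    mul_one_div_cancel hq0.ne', Real.rpow_one]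

lemma measurable_trigProp {κ : ℝ → ℝ} (hκ : TrigLike κ) {h : E3 → ℂ} (hm : Measurable h) :
    Measurable (Function.uncurry (trigProp κ h)) := by
  have hκm := hκ.cont.measurable
  have hr := measurable_rad
  have : Function.uncurry (trigProp κ h) = fun w : ℝ × E3 => ∫ ξ,
      Complex.exp ((2 * Real.pi * ⟪ξ, w.2⟫ : ℝ) * Complex.I) * ((κ (w.1 * rad ξ) : ℂ) * h ξ) := by
    ext w
    exact Real.fourierInv_eq' _ _
  rw [this]
  refine (StronglyMeasurable.integral_prod_right (f := fun (w : ℝ × E3) (ξ : E3) =>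
    Complex.exp ((2 * Real.pi * ⟪ξ, w.2⟫ : ℝ) * Complex.I) * ((κ (w.1 * rad ξ) : ℂ) * h ξ))
    (Measurable.stronglyMeasurable ?_)).measurable
  unfold Function.uncurry
  fun_prop

lemma integrable_trig_mul {κ : ℝ → ℝ} (hκ : TrigLike κ) {h : E3 → ℂ} (hi : Integrable h) (t : ℝ) :
    Integrable fun ξ => (κ (t * rad ξ) : ℂ) * h ξ := by
  have hκc := hκ.cont
  have hr := continuous_rad
  refine hi.bdd_mul (c := 1) (Continuous.aestronglyMeasurable (by fun_prop))
    (Filter.Eventually.of_forall fun ξ => ?_)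
  rw [Complex.norm_real]; exact hκ.bdd _

lemma norm_trigProp_le {κ : ℝ → ℝ} (hκ : TrigLike κ) {h : E3 → ℂ} (hi : Integrable h) (t : ℝ)
    (x : E3) : ‖trigProp κ h t x‖ ≤ ∫ ξ, ‖h ξ‖ := by
  refine (norm_fourierInv_le x).trans (integral_mono (integrable_trig_mul hκ hi t).norm hi.norm ?_)
  intro ξ
  beta_reduce
  rw [norm_mul, Complex.norm_real]
  exact mul_le_of_le_one_left (norm_nonneg _) (hκ.bdd _)

lemma exists_lintegral_trigProp_le {p q : ℝ} (hp : 2 < p) (hq : 2 < q)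
    (hadm : 1 / p + 1 / q ≤ 1 / 2) :
    ∃ C : ℝ≥0, ∀ κ : ℝ → ℝ, TrigLike κ → ∀ h : E3 → ℂ, Measurable h → Integrable h →
      (∫⁻ t, eLpNorm (trigProp κ h t) (ENNReal.ofReal q) volume ^ p) ^ (1 / p) ≤
        C * eLpNorm (fun ξ => ((rad ξ ^ (3 / 2 - 1 / p - 3 / q) : ℝ) : ℂ) * h ξ) 2 volume := by
  have hp0 : 0 < p := by linarith
  have hq0 : 0 < q := by linarith
  have hq1 : 0 < q - 1 := by linarith
  have hp1 : 0 < p - 1 := by linarith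
  have hθ : 0 < 1 - 2 / q := by rw [sub_pos, div_lt_one hq0]; exact hq
  have hrθ : 2 / (q / (q - 1)) - 1 = 1 - 2 / q := by field_simp; ring
  set β := (2 / p) / (1 - 2 / q) with hβ
  have hβθ : β * (1 - 2 / q) = 2 / p := div_mul_cancel₀ _ hθ.ne'
  have hβ0 : 0 < β := by positivity
  have hβ1 : β ≤ 1 := by
    rw [hβ, div_le_one hθ]
    have e1 : 2 / p = 2 * (1 / p) := by ring
    have e2 : 2 / q = 2 * (1 / q) := by ring
    rw [e1, e2]; linarith
  obtain ⟨C, H⟩ := exists_enorm_integral_trigProp_mul_le (β := β) (r := q / (q - 1))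
    (ρ := p / (p - 1)) hβ0 hβ1 (by rw [lt_div_iff₀ hq1]; linarith)
    (by rw [div_lt_iff₀ hq1]; linarith) (by rw [hrθ, hβθ]; field_simp)
  have hexp : (3 - β) * (2 / (q / (q - 1)) - 1) / 2 = 3 / 2 - 1 / p - 3 / q := by
    rw [hrθ, sub_mul, hβθ]; ring
  rw [hexp] at H
  refine ⟨C, fun κ hκ h hm hi => ?_⟩
  have key := lintegral_rpow_le_of_dual (p := p) (q := q) (by linarith) (by linarith)
    (measurable_trigProp hκ hm) (norm_trigProp_le hκ hi) (fun F hF => H κ hκ h hm hi F hF)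
  have e : ∀ t, eLpNorm (trigProp κ h t) (ENNReal.ofReal q) volume ^ p =
      (∫⁻ x, ‖trigProp κ h t x‖ₑ ^ q) ^ (p / q) := fun t => by
    rw [eLpNorm_eq_lintegral_rpow_enorm_toReal (by simpa using hq0) ENNReal.ofReal_ne_top,
      ENNReal.toReal_ofReal hq0.le, ← ENNReal.rpow_mul]
    congr 1; ring
  simp_rw [e]
  refine (ENNReal.rpow_le_rpow key (by positivity)).trans_eq ?_
  rw [← ENNReal.rpow_mul, mul_one_div_cancel hp0.ne', ENNReal.rpow_one]

/-- The half-wave propagator on the frequency side. -/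
lemma fourierInv_halfWave_eq {σ : ℝ} (hσ : σ = 1 ∨ σ = -1) {h : E3 → ℂ} (hi : Integrable h) (t : ℝ) :
    𝓕⁻ (fun ξ => Complex.exp (Complex.I * (σ * (2 * Real.pi * t * ‖ξ‖))) * h ξ) =
      trigProp Real.cos h t + fun x => (Complex.I * σ) * trigProp Real.sin h t x := by
  have e : (fun ξ => Complex.exp (Complex.I * (σ * (2 * Real.pi * t * ‖ξ‖))) * h ξ) =
      (fun ξ => (Real.cos (t * rad ξ) : ℂ) * h ξ) +
        fun ξ => (Complex.I * σ) * ((Real.sin (t * rad ξ) : ℂ) * h ξ) := by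
    ext ξ
    have e1 : Complex.I * (σ * (2 * Real.pi * t * ‖ξ‖)) =
        ((σ * (t * rad ξ) : ℝ) : ℂ) * Complex.I := by
      unfold rad; push_cast; ring
    rw [e1, Complex.exp_mul_I, ← Complex.ofReal_cos, ← Complex.ofReal_sin]
    simp only [Pi.add_apply]
    rcases hσ with rfl | rfl
    · simp; ring
    · simp; ring
  ext x
  rw [e, fourierInv_add_apply (integrable_trig_mul trigLike_cos hi t)
    ((integrable_trig_mul trigLike_sin hi t).const_mul _), Pi.add_apply]
  congr 1
  rw [trigProp, Real.fourierInv_eq', Real.fourierInv_eq', ← integral_const_mul]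
  refine integral_congr_ae (Filter.Eventually.of_forall fun ξ => ?_)
  simp only [smul_eq_mul]; ring

lemma exists_lintegral_fourierInv_halfWave_le {p q : ℝ} (hp : 2 < p) (hq : 2 < q)
    (hadm : 1 / p + 1 / q ≤ 1 / 2) :
    ∃ C : ℝ≥0, ∀ σ : ℝ, (σ = 1 ∨ σ = -1) → ∀ h : E3 → ℂ, Measurable h → Integrable h →
      (∫⁻ t : ℝ, eLpNorm (𝓕⁻ fun ξ : E3 =>
        Complex.exp (Complex.I * (σ * (2 * Real.pi * t * ‖ξ‖))) * h ξ)
        (ENNReal.ofReal q) volume ^ p) ^ (1 / p) ≤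
        C * eLpNorm (fun ξ => ((rad ξ ^ (3 / 2 - 1 / p - 3 / q) : ℝ) : ℂ) * h ξ) 2 volume := by
  obtain ⟨C, H⟩ := exists_lintegral_trigProp_le hp hq hadm
  refine ⟨C + C, fun σ hσ h hm hi => ?_⟩
  have hp0 : 0 < p := by linarith
  have hq0 : 0 < q := by linarith
  have hms : ∀ κ, TrigLike κ → Measurable fun t =>
      eLpNorm (trigProp κ h t) (ENNReal.ofReal q) volume := fun κ hκ => by
    have hT : Measurable fun w : ℝ × E3 => trigProp κ h w.1 w.2 := measurable_trigProp hκ hm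
    simp_rw [eLpNorm_eq_lintegral_rpow_enorm_toReal (p := ENNReal.ofReal q) (by simpa using hq0)
      ENNReal.ofReal_ne_top]
    refine Measurable.pow_const ?_ _
    exact Measurable.lintegral_prod_right' (f := fun w : ℝ × E3 =>
      ‖trigProp κ h w.1 w.2‖ₑ ^ (ENNReal.ofReal q).toReal) (by fun_prop)
  have hle : ∀ t : ℝ, eLpNorm (𝓕⁻ fun ξ : E3 =>
        Complex.exp (Complex.I * (σ * (2 * Real.pi * t * ‖ξ‖))) * h ξ) (ENNReal.ofReal q) volume ≤
      eLpNorm (trigProp Real.cos h t) (ENNReal.ofReal q) volume +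
        eLpNorm (trigProp Real.sin h t) (ENNReal.ofReal q) volume := fun t => by
    rw [fourierInv_halfWave_eq hσ hi]
    have m1 := (measurable_trigProp trigLike_cos hm).comp (measurable_prodMk_left (x := t))
    have m2 := (measurable_trigProp trigLike_sin hm).comp (measurable_prodMk_left (x := t))
    refine (eLpNorm_add_le m1.aestronglyMeasurable (m2.const_mul _).aestronglyMeasurable
      (ENNReal.one_le_ofReal.2 (by linarith))).trans ?_
    refine add_le_add le_rfl (eLpNorm_mono fun x => ?_)
    have : ‖Complex.I * σ‖ = 1 := by rcases hσ with rfl | rfl <;> simp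
    rw [norm_mul, this, one_mul]
    exact le_rfl
  refine (ENNReal.rpow_le_rpow (lintegral_mono fun t => ENNReal.rpow_le_rpow (hle t) hp0.le)
    (by positivity)).trans ?_
  refine (ENNReal.lintegral_Lp_add_le (hms _ trigLike_cos).aemeasurable
    (hms _ trigLike_sin).aemeasurable (by linarith)).trans ?_
  rw [ENNReal.coe_add, add_mul]
  exact add_le_add (H _ trigLike_cos h hm hi) (H _ trigLike_sin h hm hi)

lemma fourierInv_congr_ae {f g : E3 → ℂ} (h : f =ᵐ[volume] g) : 𝓕⁻ f = 𝓕⁻ g := by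
  ext x
  rw [Real.fourierInv_eq', Real.fourierInv_eq']
  refine integral_congr_ae ?_
  filter_upwards [h] with ξ hξ
  rw [hξ]

lemma fourier_eq_zero_of_not_integrable {f : E3 → ℂ} (h : ¬ Integrable f) : 𝓕 f = 0 := by
  ext ξ
  rw [Real.fourier_eq]
  exact integral_undef fun hi => h ((Real.fourierIntegral_convergent_iff ξ).1 hi)

lemma fmul3_fourierInv (m : E3 → ℂ) {h : E3 → ℂ} (hi : Integrable h)
    (hc : ∀ ξ, ξ ≠ 0 → ContinuousAt h ξ) :
    fmul3 m (𝓕⁻ h) = (𝓕⁻ fun ξ => m ξ * h ξ) ∨ fmul3 m (𝓕⁻ h) = 0 := by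
  by_cases hI : Integrable (𝓕⁻ h)
  · left
    refine fourierInv_congr_ae ?_
    have hF : Integrable (𝓕 h) := by
      have e : 𝓕 h = fun x => 𝓕⁻ h (-x) := by
        ext x; rw [Real.fourierInv_eq_fourier_neg, neg_neg]
      rw [e]; exact hI.comp_neg
    filter_upwards [Measure.ae_ne volume (0 : E3)] with ξ hξ
    rw [hi.fourier_fourierInv_eq hF (hc ξ hξ)]
  · right
    ext x
    rw [fmul3, fourier_eq_zero_of_not_integrable hI, Real.fourierInv_eq']
    simp

lemma integrable_rad_rpow_mul_schwartz {a : ℝ} (ha : -3 < a) (g : 𝓢(E3, ℂ)) :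
    Integrable fun ξ => ((rad ξ ^ a : ℝ) : ℂ) * g ξ := by
  obtain ⟨k, hk⟩ := exists_nat_ge a
  have hrm := measurable_rad
  have hgm := g.continuous.measurable
  obtain ⟨M, hM⟩ : ∃ M, ∀ ξ, ‖g ξ‖ ≤ M := ⟨_, fun ξ => SchwartzMap.norm_le_seminorm ℝ g ξ⟩
  have hM0 : 0 ≤ M := (norm_nonneg _).trans (hM 0)
  have i1 := (integrable_rad_rpow_mul_exp ha one_pos).const_mul (M * Real.exp 1)
  have i2 := (g.integrable_pow_mul volume k).const_mul ((2 * Real.pi) ^ k)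
  refine (i1.add i2).mono' (Measurable.aestronglyMeasurable (by fun_prop))
    (Filter.Eventually.of_forall fun ξ => ?_)
  have hr := rad_nonneg ξ
  have hra : 0 ≤ rad ξ ^ a := Real.rpow_nonneg hr a
  have e2 : (2 * Real.pi) ^ k * (‖ξ‖ ^ k * ‖g ξ‖) = rad ξ ^ k * ‖g ξ‖ := by
    rw [← mul_assoc, ← mul_pow]; rfl
  rw [Pi.add_apply, e2, norm_mul, Complex.norm_real, Real.norm_of_nonneg hra]
  rcases le_total (rad ξ) 1 with h1 | h1
  · have h2 : (1 : ℝ) ≤ Real.exp 1 * Real.exp (-1 * rad ξ) := by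
      rw [← Real.exp_add]; exact Real.one_le_exp (by linarith)
    have h3 : rad ξ ^ a * ‖g ξ‖ ≤ (rad ξ ^ a * M) * (Real.exp 1 * Real.exp (-1 * rad ξ)) :=
      (mul_le_mul_of_nonneg_left (hM ξ) hra).trans (le_mul_of_one_le_right (by positivity) h2)
    have h4 : 0 ≤ rad ξ ^ k * ‖g ξ‖ := by positivity
    calc _ ≤ _ := h3
      _ = M * Real.exp 1 * (rad ξ ^ a * Real.exp (-1 * rad ξ)) := by ring
      _ ≤ _ := le_add_of_nonneg_right h4
  · have h2 : rad ξ ^ a ≤ rad ξ ^ k := by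
      rw [← Real.rpow_natCast]; exact Real.rpow_le_rpow_of_exponent_le h1 hk
    have h3 : 0 ≤ M * Real.exp 1 * (rad ξ ^ a * Real.exp (-1 * rad ξ)) := by positivity
    exact (mul_le_mul_of_nonneg_right h2 (norm_nonneg _)).trans (le_add_of_nonneg_left h3)

lemma eLpNorm_absGrad3_one (f : 𝓢(E3, ℂ)) :
    eLpNorm (absGrad3 1 f) 2 volume = eLpNorm (fun ξ => (rad ξ : ℂ) * 𝓕 (f : E3 → ℂ) ξ) 2 volume := by
  have e : absGrad3 1 f = 𝓕⁻ fun ξ => (rad ξ : ℂ) * 𝓕 (f : E3 → ℂ) ξ := by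
    simp only [absGrad3, fmul3, Real.rpow_one]; rfl
  rw [e]
  have i1 : ∀ a : ℝ, -3 < a → Integrable fun ξ => ((rad ξ ^ a : ℝ) : ℂ) * 𝓕 (f : E3 → ℂ) ξ :=
    fun a ha => integrable_rad_rpow_mul_schwartz ha (𝓕 f)
  have h1 := i1 1 (by norm_num)
  simp only [Real.rpow_one] at h1
  refine eLpNorm_fourierInv_eq h1 ((memLp_two_iff_integrable_sq_norm h1.1).2 ?_)
  have hF : Continuous (𝓕 (f : E3 → ℂ)) := (𝓕 f).continuous
  refine ((i1 2 (by norm_num)).norm.bdd_mul (f := fun ξ => ‖𝓕 (f : E3 → ℂ) ξ‖)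
    (c := ∫ x, ‖f x‖) hF.norm.aestronglyMeasurable
    (Filter.Eventually.of_forall fun ξ => by rw [norm_norm]; exact norm_fourier_le ξ)).congr
    (Filter.Eventually.of_forall fun ξ => ?_)
  beta_reduce
  rw [norm_mul, norm_mul, Complex.norm_real, Complex.norm_real,
    Real.norm_of_nonneg (Real.rpow_nonneg (rad_nonneg ξ) _), Real.rpow_ofNat, mul_pow,
    Real.norm_of_nonneg (rad_nonneg ξ)]
  ring

lemma exists_eLpNorm_fourierInv_halfWave_le {q : ℝ} (hq : 2 ≤ q) :
    ∃ C : ℝ≥0, ∀ σ t : ℝ, ∀ h : E3 → ℂ, Measurable h → Integrable h →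
      eLpNorm (𝓕⁻ fun ξ : E3 => Complex.exp (Complex.I * (σ * (2 * Real.pi * t * ‖ξ‖))) * h ξ)
        (ENNReal.ofReal q) volume ≤
        C * eLpNorm (fun ξ => ((rad ξ ^ (3 / 2 - 3 / q) : ℝ) : ℂ) * h ξ) 2 volume := by
  obtain ⟨C, H⟩ : ∃ C : ℝ≥0, ∀ h : E3 → ℂ, Measurable h → Integrable h →
      eLpNorm (𝓕⁻ h) (ENNReal.ofReal q) volume ≤
        C * eLpNorm (fun ξ => ((rad ξ ^ (3 / 2 - 3 / q) : ℝ) : ℂ) * h ξ) 2 volume := by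
    rcases hq.eq_or_lt with rfl | hq
    · refine ⟨1, fun h hm hi => ?_⟩
      simp only [sub_self, Real.rpow_zero, Complex.ofReal_one, one_mul, ENNReal.coe_one,
        ENNReal.ofReal_ofNat]
      by_cases h2 : MemLp h 2
      · exact (eLpNorm_fourierInv_eq hi h2).le
      · have : eLpNorm h 2 volume = ∞ := by
          by_contra hne
          exact h2 ⟨hm.aestronglyMeasurable, lt_top_iff_ne_top.2 hne⟩
        rw [this]; exact le_top
    · exact exists_eLpNorm_fourierInv_le hq
  refine ⟨C, fun σ t h hm hi => ?_⟩
  have hn : ∀ ξ : E3, ‖Complex.exp (Complex.I * (σ * (2 * Real.pi * t * ‖ξ‖)))‖ = 1 := fun ξ => by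
    have e1 : Complex.I * (σ * (2 * Real.pi * t * ‖ξ‖)) =
        ((σ * (2 * Real.pi * t * ‖ξ‖) : ℝ) : ℂ) * Complex.I := by push_cast; ring
    rw [e1, Complex.norm_exp_ofReal_mul_I]
  refine (H _ (by fun_prop) (hi.bdd_mul (c := 1) (Measurable.aestronglyMeasurable (by fun_prop))
    (Filter.Eventually.of_forall fun ξ => (hn ξ).le))).trans_eq ?_
  congr 1
  refine eLpNorm_congr_norm_ae (Filter.Eventually.of_forall fun ξ => ?_)
  rw [norm_mul, norm_mul, norm_mul, hn, one_mul]

lemma halfWave3_absGrad3 {s : ℝ} (hs : -3 < s) (f : 𝓢(E3, ℂ)) (σ t : ℝ) :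
    halfWave3 σ t (absGrad3 s f) = (𝓕⁻ fun ξ : E3 =>
      Complex.exp (Complex.I * (σ * (2 * Real.pi * t * ‖ξ‖))) *
        (((rad ξ ^ s : ℝ) : ℂ) * 𝓕 (f : E3 → ℂ) ξ)) ∨ halfWave3 σ t (absGrad3 s f) = 0 := by
  refine fmul3_fourierInv _ (integrable_rad_rpow_mul_schwartz hs (𝓕 f)) fun ξ hξ => ?_
  have h1 : ContinuousAt (fun ξ => ((rad ξ ^ s : ℝ) : ℂ)) ξ :=
    Complex.continuous_ofReal.continuousAt.comp
      (continuous_rad.continuousAt.rpow_const (Or.inl (rad_pos hξ).ne'))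
  exact h1.mul (𝓕 f).continuous.continuousAt

lemma eLpNorm_rad_rpow_mul_rpow_mul {a b : ℝ} (hab : a + b = 1) (g : E3 → ℂ) :
    eLpNorm (fun ξ => ((rad ξ ^ a : ℝ) : ℂ) * (((rad ξ ^ b : ℝ) : ℂ) * g ξ)) 2 volume =
      eLpNorm (fun ξ => (rad ξ : ℂ) * g ξ) 2 volume := by
  refine eLpNorm_congr_ae ?_
  filter_upwards [ae_rad_pos] with ξ hξ
  rw [← mul_assoc, ← Complex.ofReal_mul, ← Real.rpow_add hξ, hab, Real.rpow_one]

/-- **Homogeneous Strichartz estimate for the half-wave propagator in `d = 3`.** -/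
theorem strichartz_halfWave (p q : ℝ≥0∞) (hp : 2 ≤ p) (hq2 : 2 ≤ q) (hq : q ≠ ∞)
    (hadm : 1 / p + 1 / q ≤ 1 / 2) :
    ∃ C : ℝ≥0, ∀ (σ : ℝ), (σ = 1 ∨ σ = -1) →
      ∀ (f : 𝓢(E3, ℂ)) (J : Set ℝ), J.OrdConnected →
        mixedNorm3 p q J
            (fun t => halfWave3 σ t
              (absGrad3 (1 / p.toReal + 3 / q.toReal - 1 / 2) (⇑f))) ≤
          (C : ℝ≥0∞) * eLpNorm (absGrad3 1 (⇑f)) 2 volume := by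
  obtain ⟨b, hb0, rfl⟩ : ∃ b : ℝ, 0 ≤ b ∧ q = ENNReal.ofReal b :=
    ⟨q.toReal, ENNReal.toReal_nonneg, (ENNReal.ofReal_toReal hq).symm⟩
  have hb2 : 2 ≤ b := by
    rw [← ENNReal.ofReal_ofNat] at hq2
    exact (ENNReal.ofReal_le_ofReal_iff hb0).1 hq2
  rw [ENNReal.toReal_ofReal hb0]
  have hb3 : 0 < 3 / b := by positivity
  have hγ : -3 < 1 / p.toReal + 3 / b - 1 / 2 := by
    have : 0 ≤ 1 / p.toReal := by positivity
    linarith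
  have hrm := measurable_rad
  have hFm : ∀ f : 𝓢(E3, ℂ), Measurable (𝓕 (f : E3 → ℂ)) := fun f => (𝓕 f).continuous.measurable
  rcases eq_or_ne p ∞ with rfl | hpt
  · obtain ⟨C, H⟩ := exists_eLpNorm_fourierInv_halfWave_le hb2
    refine ⟨C, fun σ _ f J _ => ?_⟩
    rw [mixedNorm3, if_pos rfl]
    refine essSup_le_of_ae_le _ (Filter.Eventually.of_forall fun t => ?_)
    rcases halfWave3_absGrad3 hγ f σ t with e | e
    · have hFf := hFm f
      beta_reduce
      rw [e, eLpNorm_absGrad3_one]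
      refine (H σ t _ (by fun_prop) (integrable_rad_rpow_mul_schwartz hγ (𝓕 f))).trans_eq ?_
      rw [eLpNorm_rad_rpow_mul_rpow_mul (by rw [ENNReal.toReal_top]; ring)]
      rfl
    · beta_reduce
      rw [e, eLpNorm_zero]; exact zero_le
  · obtain ⟨a, ha0, rfl⟩ : ∃ a : ℝ, 0 ≤ a ∧ p = ENNReal.ofReal a :=
      ⟨p.toReal, ENNReal.toReal_nonneg, (ENNReal.ofReal_toReal hpt).symm⟩
    have ha2 : 2 ≤ a := by
      rw [← ENNReal.ofReal_ofNat] at hp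
      exact (ENNReal.ofReal_le_ofReal_iff ha0).1 hp
    rw [ENNReal.toReal_ofReal ha0] at hγ ⊢
    have had : 1 / a + 1 / b ≤ 1 / 2 := by
      rw [← ENNReal.ofReal_one, ← ENNReal.ofReal_ofNat 2, ← ENNReal.ofReal_div_of_pos (by linarith),
        ← ENNReal.ofReal_div_of_pos (by linarith), ← ENNReal.ofReal_div_of_pos (by norm_num),
        ← ENNReal.ofReal_add (by positivity) (by positivity)] at hadm
      exact (ENNReal.ofReal_le_ofReal_iff (by norm_num)).1 hadm
    have haa : 0 < 1 / a := by positivity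
    have hbb : 0 < 1 / b := by positivity
    have ha : 2 < a := (one_div_lt_one_div (by linarith) (by norm_num)).1 (by linarith)
    have hb : 2 < b := (one_div_lt_one_div (by linarith) (by norm_num)).1 (by linarith)
    obtain ⟨C, H⟩ := exists_lintegral_fourierInv_halfWave_le ha hb had
    refine ⟨C, fun σ hσ f J _ => ?_⟩
    have hFf := hFm f
    rw [mixedNorm3, if_neg ENNReal.ofReal_ne_top, ENNReal.toReal_ofReal ha0, eLpNorm_absGrad3_one]
    refine le_trans (ENNReal.rpow_le_rpow ((setLIntegral_le_lintegral _ _).trans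
      (lintegral_mono fun t => ENNReal.rpow_le_rpow ?_ ha0)) haa.le)
      ((H σ hσ _ (by fun_prop) (integrable_rad_rpow_mul_schwartz hγ (𝓕 f))).trans_eq ?_)
    · rcases halfWave3_absGrad3 hγ f σ t with e | e
      · rw [e]; rfl
      · rw [e, eLpNorm_zero]; exact zero_le
    · rw [eLpNorm_rad_rpow_mul_rpow_mul (by ring)]
      rfl

end
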